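/- arXiv:1001.3363 — 3 statements merged into one kernel-verified Lean document; each statement's English description precedes it below -/
import Mathlib

section
/- Let $k$ be a field of characteristic $p > 0$, let $R = k[x_1,\dots,x_n]$ be the polynomial ring in $n$ variables over $k$, and let $I = (f_1,\dots,f_s)$ be an ideal of $R$ generated by polynomials $f_1,\dots,f_s$ with $\deg f_1 + \dots + \deg f_s < n$. Then for every $i$ and every associated prime $P$ of the local cohomology module $H^i_I(R)$, one has $\dim R/P \geq n - \sum_{j=1}^s \deg f_j$. -/
section

open scoped Classical in
/-- projection to the top component over `q`-th powers -/
noncomputable def DeltaOp (σ : Type) [Fintype σ] (A : Type) [CommRing A] (q : ℕ) :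
    MvPolynomial σ A →ₗ[A] MvPolynomial σ A :=
  (MvPolynomial.basisMonomials σ A).constr A (fun α =>
    if ∀ j, α j % q = q - 1 then
      MvPolynomial.monomial (α - Finsupp.equivFunOnFinite.symm (fun _ => q - 1)) 1 else 0)

open scoped Classical in
theorem DeltaOp_monomial {σ : Type} [Fintype σ] {A : Type} [CommRing A] (q : ℕ) (α : σ →₀ ℕ)
    (c : A) :
    DeltaOp σ A q (MvPolynomial.monomial α c) =
      if ∀ j, α j % q = q - 1 then
      MvPolynomial.monomial (α - Finsupp.equivFunOnFinite.symm (fun _ => q - 1)) c else 0 := by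
  have h : MvPolynomial.monomial α c = c • (MvPolynomial.basisMonomials σ A) α := by
    simp [MvPolynomial.smul_monomial]
  rw [h, map_smul, DeltaOp, Module.Basis.constr_basis]
  split_ifs
  · simp [MvPolynomial.smul_monomial]
  · simp

theorem DeltaOp_eq_zero {σ : Type} [Fintype σ] {A : Type} [CommRing A] (q : ℕ)
    (g : MvPolynomial σ A) (h : g.totalDegree < Fintype.card σ * (q - 1)) :
    DeltaOp σ A q g = 0 := by
  classical
  rw [MvPolynomial.as_sum g, map_sum]
  refine Finset.sum_eq_zero fun α hα => ?_
  rw [DeltaOp_monomial, if_neg]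
  intro hall
  have h1 := MvPolynomial.le_totalDegree hα
  have h2 : Fintype.card σ * (q - 1) ≤ α.sum fun _ e => e := by
    rw [Finsupp.sum_fintype _ _ (fun _ => rfl)]
    have : ∑ j : σ, (q - 1) ≤ ∑ j, α j :=
      Finset.sum_le_sum fun j _ => by rw [← hall j]; exact Nat.mod_le _ _
    simpa using this
  omega

theorem DeltaOp_X_pow {σ : Type} [Fintype σ] {A : Type} [CommRing A] (q : ℕ) (hq : 0 < q) (i : σ)
    (g : MvPolynomial σ A) :
    DeltaOp σ A q (MvPolynomial.X i ^ q * g) = MvPolynomial.X i ^ q * DeltaOp σ A q g := by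
  classical
  induction g using MvPolynomial.induction_on' with
  | add a b ha hb => simp [mul_add, ha, hb]
  | monomial α c =>
    rw [MvPolynomial.X_pow_eq_monomial, MvPolynomial.monomial_mul, DeltaOp_monomial,
      DeltaOp_monomial]
    have hiff : (∀ j, (Finsupp.single i q + α) j % q = q - 1) ↔ (∀ j, α j % q = q - 1) := by
      refine forall_congr' fun j => ?_
      by_cases hj : i = j
      · subst hj; simp
      · simp [hj]
    by_cases hc : ∀ j, α j % q = q - 1
    · rw [if_pos (hiff.2 hc), if_pos hc, MvPolynomial.monomial_mul]
      refine congrArg₂ (fun s c => MvPolynomial.monomial s c) ?_ rfl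
      ext j
      have := Nat.mod_le (α j) q
      have := hc j
      simp only [Finsupp.coe_tsub, Finsupp.coe_add, Pi.sub_apply, Pi.add_apply,
        Finsupp.equivFunOnFinite_symm_apply_apply]
      omega
    · rw [if_neg (hiff.not.2 hc), if_neg hc, mul_zero]

theorem DeltaOp_pow_mul {σ : Type} [Fintype σ] {A : Type} [CommRing A] (p : ℕ) [Fact p.Prime]
    [CharP A p] (e : ℕ) (h g : MvPolynomial σ A) :
    DeltaOp σ A (p ^ e) (h ^ (p ^ e) * g) = h ^ (p ^ e) * DeltaOp σ A (p ^ e) g := by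
  have hq : 0 < p ^ e := pow_pos (Fact.out : p.Prime).pos e
  induction h using MvPolynomial.induction_on generalizing g with
  | C a => rw [← map_pow, MvPolynomial.C_mul', map_smul, MvPolynomial.C_mul']
  | add a b ha hb => rw [add_pow_char_pow, add_mul, map_add, ha, hb, add_mul]
  | mul_X a i ha => rw [mul_pow, mul_assoc, ha, DeltaOp_X_pow _ hq, mul_assoc]

theorem DeltaOp_decomp {σ : Type} [Fintype σ] [DecidableEq σ] {A : Type} [CommRing A] (q : ℕ)
    (hq : 0 < q) (g : MvPolynomial σ A) :
    g = ∑ a : σ → Fin q,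
      MvPolynomial.monomial (Finsupp.equivFunOnFinite.symm (fun j => (a j : ℕ))) 1 *
        DeltaOp σ A q (MvPolynomial.monomial
          (Finsupp.equivFunOnFinite.symm (fun j => q - 1 - (a j : ℕ))) 1 * g) := by
  classical
  induction g using MvPolynomial.induction_on' with
  | add a b ha hb =>
    simp only [mul_add, map_add, Finset.sum_add_distrib]
    rw [← ha, ← hb]
  | monomial α c =>
    rw [Finset.sum_eq_single (fun j => (⟨α j % q, Nat.mod_lt _ hq⟩ : Fin q))]
    · rw [MvPolynomial.monomial_mul, DeltaOp_monomial, if_pos, MvPolynomial.monomial_mul]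
      · simp only [one_mul]
        refine congrArg₂ (fun s c => MvPolynomial.monomial s c) ?_ rfl
        ext j
        have h1 := Nat.mod_le (α j) q
        have h2 := Nat.mod_lt (α j) hq
        simp only [Finsupp.coe_tsub, Finsupp.coe_add, Pi.sub_apply, Pi.add_apply,
          Finsupp.equivFunOnFinite_symm_apply_apply]
        omega
      · intro j
        have h2 := Nat.mod_lt (α j) hq
        have h3 := Nat.div_add_mod (α j) q
        simp only [Finsupp.coe_add, Pi.add_apply, Finsupp.equivFunOnFinite_symm_apply_apply]
        have : q - 1 - α j % q + α j = (q - 1) + q * (α j / q) := by omega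
        rw [this, Nat.add_mul_mod_self_left, Nat.mod_eq_of_lt (by omega)]
    · intro a _ ha
      rw [MvPolynomial.monomial_mul, DeltaOp_monomial, if_neg, mul_zero]
      intro hall
      apply ha
      funext j
      ext
      have hj := hall j
      simp only [Finsupp.coe_add, Pi.add_apply,
        Finsupp.equivFunOnFinite_symm_apply_apply] at hj
      have h4 := (a j).2
      have h5 := Nat.div_add_mod (q - 1 - (a j : ℕ) + α j) q
      rw [hj] at h5
      simp only
      have hk : α j = a j + q * ((q - 1 - (a j : ℕ) + α j) / q) := by omega
      rw [hk, Nat.add_mul_mod_self_left, Nat.mod_eq_of_lt h4]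
    · simp

end

section

theorem elem_key {R : Type} [CommRing R] {A : Type} [CommRing A] (p : ℕ) [Fact p.Prime]
    [CharP A p] {σ : Type} [Fintype σ] (Φ : R ≃+* MvPolynomial σ A)
    {B : Type} [Fintype B] (Bd : ℕ → Submodule R (B → R)) (W : B → R) (d : ℕ)
    (hd : d < Fintype.card σ)
    (hstab : ∀ e : ℕ, ∀ Δ : R →+ R, (∀ r g, Δ (r ^ (p ^ e) * g) = r ^ (p ^ e) * Δ g) →
      ∀ v ∈ Bd (p ^ e), (fun S => Δ (v S)) ∈ Bd (p ^ e))
    (htrans : ∀ t q, t ≤ q → ∀ v ∈ Bd t, (fun S => W S ^ (q - t) * v S) ∈ Bd q)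
    (hdeg : ∀ S, (Φ (W S)).totalDegree ≤ d)
    (P : Ideal R) [P.IsPrime]
    (G : Finset R)
    (hG : ∀ g, ∃ c : A, Φ.symm (MvPolynomial.C c) ∉ P ∧ ∃ a : R → A,
      Φ.symm (MvPolynomial.C c) * g - ∑ x ∈ G, Φ.symm (MvPolynomial.C (a x)) * x ∈ P)
    (w : B → R) (t₀ : ℕ) (hw : ∀ r ∈ P, r • w ∈ Bd t₀) :
    ∃ c, c ∉ P ∧ ∃ q, t₀ ≤ q ∧ (fun S => c * (W S ^ (q - t₀) * w S)) ∈ Bd q := by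
  classical
  -- uniform `c` for finitely many `g`
  have hGfin : ∀ {ι : Type} (s : Finset ι) (g : ι → R), ∃ c : A, Φ.symm (MvPolynomial.C c) ∉ P ∧
      ∀ i ∈ s, ∃ a : R → A,
      Φ.symm (MvPolynomial.C c) * g i - ∑ x ∈ G, Φ.symm (MvPolynomial.C (a x)) * x ∈ P := by
    intro ι s g
    choose c hc a ha using fun i => hG (g i)
    refine ⟨∏ i ∈ s, c i, ?_, ?_⟩
    · rw [map_prod, map_prod, (inferInstance : P.IsPrime).prod_mem_iff]
      rintro ⟨i, -, hi⟩
      exact hc i hi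
    · intro i hi
      refine ⟨fun x => (∏ j ∈ s.erase i, c j) * a i x, ?_⟩
      have := P.mul_mem_left (Φ.symm (MvPolynomial.C (∏ j ∈ s.erase i, c j))) (ha i)
      rw [← Finset.mul_prod_erase s c hi]
      convert this using 1
      rw [mul_sub, Finset.mul_sum]
      simp only [map_mul]
      congr 1
      · ring
      · exact Finset.sum_congr rfl fun x _ => by ring
  -- degree bound
  let E : ℕ := ∑ x ∈ G, ∑ S, (Φ (x * w S)).totalDegree
  have hE : ∀ x ∈ G, ∀ S, (Φ (x * w S)).totalDegree ≤ E := fun x hx S =>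
    (Finset.single_le_sum (f := fun S => (Φ (x * w S)).totalDegree) (fun _ _ => Nat.zero_le _)
      (Finset.mem_univ S)).trans
      (Finset.single_le_sum (f := fun x => ∑ S, (Φ (x * w S)).totalDegree)
        (fun _ _ => Nat.zero_le _) hx)
  have hp : 1 < p := (Fact.out : p.Prime).one_lt
  let e : ℕ := E + Fintype.card σ + t₀ + 1
  set q : ℕ := p ^ e with hqdef
  have hqe : e < q := Nat.lt_pow_self hp
  have hq0 : 0 < q := by omega
  let Δ : R →+ R := Φ.symm.toAddEquiv.toAddMonoidHom.comp
    ((DeltaOp σ A q).toAddMonoidHom.comp Φ.toAddEquiv.toAddMonoidHom)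
  have hΔ : ∀ g, Δ g = Φ.symm (DeltaOp σ A q (Φ g)) := fun g => rfl
  have hΔpow : ∀ r g, Δ (r ^ q * g) = r ^ q * Δ g := by
    intro r g
    rw [hΔ, hΔ, map_mul, map_pow, hqdef, DeltaOp_pow_mul p e, map_mul, map_pow, RingEquiv.symm_apply_apply]
  have hΔC : ∀ (a : A) g, Δ (Φ.symm (MvPolynomial.C a) * g) = Φ.symm (MvPolynomial.C a) * Δ g := by
    intro a g
    rw [hΔ, hΔ, map_mul, RingEquiv.apply_symm_apply, MvPolynomial.C_mul', map_smul,
      ← MvPolynomial.C_mul', map_mul]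
  let wq : B → R := fun S => W S ^ (q - t₀) * w S
  have hzero : ∀ x ∈ G, ∀ S, Δ (x * wq S) = 0 := by
    intro x hx S
    rw [hΔ, DeltaOp_eq_zero, map_zero]
    have h1 : x * wq S = W S ^ (q - t₀) * (x * w S) := by simp only [wq]; ring
    rw [h1, map_mul, map_pow]
    have h2 := MvPolynomial.totalDegree_mul (Φ (W S) ^ (q - t₀)) (Φ (x * w S))
    have h3 := MvPolynomial.totalDegree_pow (Φ (W S)) (q - t₀)
    have h4 : (q - t₀) * (Φ (W S)).totalDegree ≤ q * d :=
      Nat.mul_le_mul (Nat.sub_le _ _) (hdeg S)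
    have h5 := hE x hx S
    obtain ⟨m, hm⟩ : ∃ m, Fintype.card σ = d + 1 + m := ⟨_, (Nat.add_sub_cancel' hd).symm⟩
    obtain ⟨r, hr⟩ : ∃ r, q = r + 1 := ⟨q - 1, by omega⟩
    have h6 : E + Fintype.card σ < q := by omega
    have h7 : q * d + E < Fintype.card σ * (q - 1) := by
      rw [hm, hr] at *
      simp only [Nat.add_sub_cancel]
      nlinarith [Nat.zero_le (m * r)]
    omega
  obtain ⟨c, hcP, hc⟩ := hGfin (Finset.univ : Finset (σ → Fin q)) (fun a => Φ.symm
    (MvPolynomial.monomial (Finsupp.equivFunOnFinite.symm (fun j => q - 1 - (a j : ℕ))) 1))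
  refine ⟨_, hcP, q, by omega, ?_⟩
  have hmem : ∀ a : σ → Fin q, (fun S => Δ (Φ.symm
    (MvPolynomial.monomial (Finsupp.equivFunOnFinite.symm (fun j => q - 1 - (a j : ℕ))) 1) *
      (Φ.symm (MvPolynomial.C c) * wq S))) ∈ Bd q := by
    intro a
    obtain ⟨b, hb⟩ := hc a (Finset.mem_univ a)
    have h1 := hstab e Δ hΔpow _ (htrans t₀ q (by omega) _ (hw _ hb))
    convert h1 using 2 with S
    generalize (Φ.symm
      (MvPolynomial.monomial (Finsupp.equivFunOnFinite.symm (fun j => q - 1 - (a j : ℕ))) 1)) = y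
    have h2 : Δ (∑ x ∈ G, Φ.symm (MvPolynomial.C (b x)) * (x * wq S)) = 0 := by
      rw [map_sum]
      exact Finset.sum_eq_zero fun x hx => by rw [hΔC, hzero x hx, mul_zero]
    have h3 : y * (Φ.symm (MvPolynomial.C c) * wq S) =
      W S ^ (q - t₀) * ((Φ.symm (MvPolynomial.C c) * y -
        ∑ x ∈ G, Φ.symm (MvPolynomial.C (b x)) * x) * w S) +
        ∑ x ∈ G, Φ.symm (MvPolynomial.C (b x)) * (x * wq S) := by
      have : ∑ x ∈ G, Φ.symm (MvPolynomial.C (b x)) * (x * wq S) =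
        (∑ x ∈ G, Φ.symm (MvPolynomial.C (b x)) * x) * wq S := by
        rw [Finset.sum_mul]; exact Finset.sum_congr rfl fun x _ => by ring
      rw [this]
      simp only [wq]; ring
    rw [h3, map_add, h2, add_zero]
    rfl
  have hsum := Submodule.sum_mem (Bd q) (t := (Finset.univ : Finset (σ → Fin q)))
    fun a _ => (Bd q).smul_mem (Φ.symm (MvPolynomial.monomial
      (Finsupp.equivFunOnFinite.symm (fun j => (a j : ℕ))) 1)) (hmem a)
  convert hsum using 1
  funext S
  simp only [Finset.sum_apply, Pi.smul_apply, smul_eq_mul]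
  apply Φ.injective
  rw [DeltaOp_decomp q hq0 (Φ (Φ.symm (MvPolynomial.C c) * (W S ^ (q - t₀) * w S))), map_sum]
  refine Finset.sum_congr rfl fun a _ => ?_
  rw [hΔ, map_mul Φ (Φ.symm (MvPolynomial.monomial _ _)) (Φ.symm _), RingEquiv.apply_symm_apply,
    RingEquiv.apply_symm_apply, map_mul Φ (Φ.symm (MvPolynomial.monomial _ _)),
    RingEquiv.apply_symm_apply]

end

section

/-- index sets for the Koszul complex: `n`-element subsets of an `s`-element set -/
inductive KI : ℕ → ℕ → Type
  | nil : KI 0 0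
  | skip {s n : ℕ} : KI s n → KI (s + 1) n
  | take {s n : ℕ} : KI s n → KI (s + 1) (n + 1)

namespace KI

theorem take_inj {s n : ℕ} {a b : KI s n} : take a = take b ↔ a = b :=
  ⟨fun h => by cases h; rfl, fun h => by rw [h]⟩

theorem skip_inj {s n : ℕ} {a b : KI s n} : skip a = skip b ↔ a = b :=
  ⟨fun h => by cases h; rfl, fun h => by rw [h]⟩

/-- decomposition -/
def succEquiv (s n : ℕ) : KI s (n + 1) ⊕ KI s n ≃ KI (s + 1) (n + 1) where
  toFun := Sum.elim skip take
  invFun := fun x => match x with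
    | skip a => Sum.inl a
    | take a => Sum.inr a
  left_inv := by rintro (a | a) <;> rfl
  right_inv := by intro x; cases x <;> rfl

/-- decomposition in degree zero -/
def zeroEquiv (s : ℕ) : KI s 0 ≃ KI (s + 1) 0 where
  toFun := skip
  invFun := fun x => match x with
    | skip a => a
  left_inv := by intro a; rfl
  right_inv := by intro x; cases x; rfl

noncomputable instance unique : ∀ s, Unique (KI s 0)
  | 0 => ⟨⟨nil⟩, fun x => by cases x; rfl⟩
  | s + 1 => letI := unique s; (zeroEquiv s).symm.unique

instance isEmpty (n : ℕ) : IsEmpty (KI 0 (n + 1)) := ⟨fun x => by cases x⟩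

theorem finite : ∀ s n, Finite (KI s n)
  | 0, 0 => inferInstance
  | 0, _ + 1 => inferInstance
  | s + 1, 0 => inferInstance
  | s + 1, n + 1 => by
    have := finite s (n + 1)
    have := finite s n
    exact Finite.of_equiv _ (succEquiv s n)

noncomputable instance fintype (s n : ℕ) : Fintype (KI s n) := by
  have := finite s n
  exact Fintype.ofFinite _

theorem sum_succ {s n : ℕ} {M : Type*} [AddCommMonoid M] (F : KI (s + 1) (n + 1) → M) :
    ∑ b, F b = ∑ b, F (skip b) + ∑ b, F (take b) := by
  rw [← (succEquiv s n).sum_comp, Fintype.sum_sum_type]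
  rfl

end KI

open KI

section
variable {R : Type} [CommRing R]

open scoped Classical in
/-- Koszul differential (matrix entries) -/
noncomputable def KE (g : ℕ → R) : ∀ {s n : ℕ}, KI s n → KI s (n + 1) → R
  | _, _, KI.skip a, KI.skip b => KE g a b
  | s + 1, _, KI.skip a, KI.take b => if a = b then g s else 0
  | _, _, KI.take _, KI.skip _ => 0
  | _, _, KI.take a, KI.take b => - KE g a b

/-- weights -/
def KW (h : ℕ → R) : ∀ {s n : ℕ}, KI s n → R
  | _, _, KI.nil => 1
  | _, _, KI.skip a => KW h a
  | s + 1, _, KI.take a => h s * KW h a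

/-- Koszul differential -/
noncomputable def KD (g : ℕ → R) (s n : ℕ) : (KI s (n + 1) → R) →ₗ[R] (KI s n → R) :=
  Matrix.mulVecLin (Matrix.of fun a b => KE g a b)

theorem KD_apply (g : ℕ → R) (s n : ℕ) (x : KI s (n + 1) → R) (a : KI s n) :
    KD g s n x a = ∑ b, KE g a b * x b := rfl

theorem KD_skip (g : ℕ → R) (s n : ℕ) (x : KI (s + 1) (n + 1) → R) (a : KI s n) :
    KD g (s + 1) n x (skip a) = KD g s n (fun b => x (skip b)) a + g s * x (take a) := by
  classical
  rw [KD_apply, KI.sum_succ, KD_apply]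
  congr 1
  rw [Finset.sum_eq_single a]
  · simp [KE]
  · intro b _ hb
    simp [KE, Ne.symm hb]
  · simp

theorem KD_take (g : ℕ → R) (s n : ℕ) (x : KI (s + 1) (n + 2) → R) (a : KI s n) :
    KD g (s + 1) (n + 1) x (take a) = - KD g s n (fun b => x (take b)) a := by
  rw [KD_apply, KI.sum_succ, KD_apply]
  simp [KE]

theorem KD_comp (g : ℕ → R) : ∀ (s n : ℕ) (x : KI s (n + 2) → R),
    KD g s n (KD g s (n + 1) x) = 0
  | 0, _, x => by
    have : x = 0 := Subsingleton.elim _ _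
    rw [this, map_zero, map_zero]
  | s + 1, n, x => by
    funext a
    cases a with
    | skip a =>
      rw [KD_skip, KD_take]
      have h1 : (fun b => KD g (s + 1) (n + 1) x (skip b)) =
          KD g s (n + 1) (fun b => x (skip b)) + g s • (fun b => x (take b)) := by
        funext b; rw [KD_skip]; rfl
      rw [h1, map_add, KD_comp g s n, map_smul]
      simp
    | take a =>
      rw [KD_take]
      have h1 : (fun b => KD g (s + 1) _ x (take b)) =
          - KD g s _ (fun b => x (take b)) := by
        funext b; rw [KD_take]; rfl
      rw [h1, map_neg, KD_comp g s]
      simp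

theorem KE_KW (g h : ℕ → R) : ∀ {s n : ℕ} (a : KI s n) (b : KI s (n + 1)),
    KE g a b * KW h b = KW h a * KE (fun j => g j * h j) a b
  | _, _, KI.skip a, KI.skip b => by simpa [KE, KW] using KE_KW g h a b
  | s + 1, _, KI.skip a, KI.take b => by
    by_cases hab : a = b
    · subst hab; simp [KE, KW]; ring
    · simp [KE, hab]
  | _, _, KI.take _, KI.skip _ => by simp [KE]
  | s + 1, _, KI.take a, KI.take b => by
    have := KE_KW g h a b
    simp only [KE, KW]
    linear_combination (- h s) * this

theorem KW_mul (h h' : ℕ → R) : ∀ {s n : ℕ} (a : KI s n),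
    KW (fun j => h j * h' j) a = KW h a * KW h' a
  | _, _, KI.nil => by simp [KW]
  | _, _, KI.skip a => by simpa [KW] using KW_mul h h' a
  | _, _, KI.take a => by simp only [KW]; rw [KW_mul h h' a]; ring

theorem KW_pow (h : ℕ → R) (m : ℕ) : ∀ {s n : ℕ} (a : KI s n),
    KW (fun j => h j ^ m) a = KW h a ^ m
  | _, _, KI.nil => by simp [KW]
  | _, _, KI.skip a => by simpa [KW] using KW_pow h m a
  | _, _, KI.take a => by simp only [KW]; rw [KW_pow h m a]; ring

theorem KW_zero (h : ℕ → R) : ∀ {s : ℕ} (a : KI s 0), KW h a = 1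
  | _, KI.nil => by simp [KW]
  | _, KI.skip a => by simpa [KW] using KW_zero h a

/-- transition maps -/
def KU (f : ℕ → R) (m s n : ℕ) : (KI s n → R) →ₗ[R] (KI s n → R) where
  toFun x := fun a => KW f a ^ m * x a
  map_add' x y := by funext a; simp [mul_add]
  map_smul' r x := by funext a; simp [mul_left_comm]

theorem KU_apply (f : ℕ → R) (m s n : ℕ) (x : KI s n → R) (a : KI s n) :
    KU f m s n x a = KW f a ^ m * x a := rfl

theorem KE_KW_pow (f : ℕ → R) (t m : ℕ) {s n : ℕ} (a : KI s n) (b : KI s (n + 1)) :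
    KE (fun j => f j ^ t) a b * KW f b ^ m = KW f a ^ m * KE (fun j => f j ^ (t + m)) a b := by
  have := KE_KW (fun j => f j ^ t) (fun j => f j ^ m) a b
  rw [KW_pow, KW_pow] at this
  simpa only [pow_add] using this

theorem KD_KU (f : ℕ → R) (t m s n : ℕ) (x : KI s (n + 1) → R) :
    KD (fun j => f j ^ t) s n (KU f m s (n + 1) x) =
      KU f m s n (KD (fun j => f j ^ (t + m)) s n x) := by
  funext a
  rw [KU_apply, KD_apply, KD_apply, Finset.mul_sum]
  refine Finset.sum_congr rfl fun b _ => ?_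
  rw [KU_apply, ← mul_assoc, KE_KW_pow, mul_assoc]

theorem KU_KU (f : ℕ → R) (m m' s n : ℕ) (x : KI s n → R) :
    KU f m s n (KU f m' s n x) = KU f (m + m') s n x := by
  funext a
  simp only [KU_apply]; ring

theorem KU_zero (f : ℕ → R) (s n : ℕ) (x : KI s n → R) : KU f 0 s n x = x := by
  funext a
  simp [KU_apply]

theorem KU_deg_zero (f : ℕ → R) (m s : ℕ) (x : KI s 0 → R) : KU f m s 0 x = x := by
  funext a
  simp [KU_apply, KW_zero]

/-- Koszul homology is pro-zero in positive degrees. -/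
theorem koszul_proZero [IsNoetherianRing R] (f : ℕ → R) : ∀ (s n t : ℕ), ∃ m, 
    ∀ x : KI s (n + 1) → R, KD (fun j => f j ^ (t + m)) s n x = 0 →
      ∃ y, KD (fun j => f j ^ t) s (n + 1) y = KU f m s (n + 1) x
  | 0, n, t => ⟨0, fun x _ => ⟨0, Subsingleton.elim _ _⟩⟩
  | s + 1, n, t => by
    obtain ⟨m, hm⟩ := koszul_proZero f s n t
    let N : ℕ →o Submodule R (KI s n → R) :=
      ⟨fun k => (LinearMap.range (KD (fun j => f j ^ (t + m)) s n)).comap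
        (LinearMap.lsmul R (KI s n → R) (f s ^ k)), by
        apply monotone_nat_of_le_succ
        intro k x hx
        simp only [Submodule.mem_comap, LinearMap.lsmul_apply] at hx ⊢
        rw [pow_succ', mul_smul]
        exact Submodule.smul_mem _ _ hx⟩
    obtain ⟨k, hk⟩ := monotone_stabilizes_iff_noetherian.2 (inferInstance : IsNoetherian R (KI s n → R)) N
    have hN : ∀ l x, x ∈ N l → x ∈ N k := by
      intro l x hx
      rcases le_total l k with h | h
      · exact N.monotone h hx
      · rw [hk l h]; exact hx
    refine ⟨m + k, fun x hx => ?_⟩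
    set a : KI s (n + 1) → R := fun b => x (skip b) with ha
    set b : KI s n → R := fun c => x (take c) with hb
    have h1 : KD (fun j => f j ^ (t + (m + k))) s n a + f s ^ (t + (m + k)) • b = 0 := by
      funext c
      have := congrFun hx (skip c)
      rw [KD_skip] at this
      exact this
    have h2 : KD (fun j => f j ^ (t + m)) s n (KU f k s (n + 1) a) +
        f s ^ (t + (m + k)) • KU f k s n b = 0 := by
      rw [KD_KU, ← map_smul, ← map_add, add_assoc, h1, map_zero]
    have h3 : KU f k s n b ∈ N k := by
      apply hN (t + (m + k))
      refine ⟨- KU f k s (n + 1) a, ?_⟩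
      rw [map_neg]
      exact (eq_neg_of_add_eq_zero_right h2).symm
    obtain ⟨b', hb'⟩ := h3
    simp only [LinearMap.lsmul_apply] at hb'
    obtain ⟨y₁, hy₁⟩ := hm (KU f k s (n + 1) a + f s ^ (t + m) • b') (by
      rw [map_add, map_smul, hb', smul_smul, ← pow_add, add_assoc, h2])
    let y₂ : KI s (n + 1) → R := - (f s ^ m • KU f m s (n + 1) b')
    let y : KI (s + 1) (n + 2) → R := fun c => Sum.elim y₁ y₂ ((succEquiv s (n + 1)).symm c)
    refine ⟨y, ?_⟩
    funext c
    cases c with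
    | skip c =>
      rw [KD_skip]
      change KD (fun j => f j ^ t) s (n + 1) y₁ c + f s ^ t * y₂ c = _
      rw [hy₁]
      simp only [KU_apply, Pi.add_apply, Pi.smul_apply, smul_eq_mul, y₂, Pi.neg_apply, KW, ha]
      ring
    | take c =>
      rw [KD_take]
      change - KD (fun j => f j ^ t) s n y₂ c = _
      simp only [y₂]
      rw [map_neg, map_smul, KD_KU, hb']
      simp only [KU_apply, Pi.smul_apply, smul_eq_mul, Pi.neg_apply, KW, hb, neg_neg]
      ring

theorem KE_comm (Δ : R →+ R) (g : ℕ → R) (hg : ∀ j x, Δ (g j * x) = g j * Δ x) :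
    ∀ {s n : ℕ} (a : KI s n) (b : KI s (n + 1)) (x : R), Δ (KE g a b * x) = KE g a b * Δ x
  | _, _, KI.skip a, KI.skip b, x => by simpa [KE] using KE_comm Δ g hg a b x
  | s + 1, _, KI.skip a, KI.take b, x => by
    by_cases hab : a = b
    · subst hab; simp [KE, hg]
    · simp [KE, hab]
  | _, _, KI.take _, KI.skip _, x => by simp [KE]
  | s + 1, _, KI.take a, KI.take b, x => by
    have := KE_comm Δ g hg a b x
    simp only [KE, neg_mul, map_neg, this]

theorem KW_degree {σ A : Type} [CommRing A] (Φ : R →+* MvPolynomial σ A) (f : ℕ → R) :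
    ∀ {s n : ℕ} (a : KI s n), (Φ (KW f a)).totalDegree ≤
      ∑ j ∈ Finset.range s, (Φ (f j)).totalDegree
  | _, _, KI.nil => by simp [KW]
  | s + 1, _, KI.skip a => by
    rw [Finset.sum_range_succ]
    exact (KW_degree Φ f a).trans (Nat.le_add_right _ _)
  | s + 1, _, KI.take a => by
    rw [Finset.sum_range_succ, KW, map_mul, add_comm]
    exact (MvPolynomial.totalDegree_mul _ _).trans (Nat.add_le_add_left (KW_degree Φ f a) _)

theorem KD_zero_mem (g : ℕ → R) (J : Ideal R) : ∀ (s : ℕ) (_ : ∀ j < s, g j ∈ J)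
    (x : KI s 1 → R) (a : KI s 0), KD g s 0 x a ∈ J
  | 0, hg, x, a => by
    rw [KD_apply]; simp
  | s + 1, hg, x, a => by
    cases a with
    | skip a =>
      rw [KD_skip]
      exact J.add_mem (KD_zero_mem g J s (fun j hj => hg j (by omega)) _ a)
        (J.mul_mem_right _ (hg s (by omega)))

theorem KD_zero_range (g : ℕ → R) : ∀ (s j : ℕ) (_ : j < s),
    ∃ x, KD g s 0 x = fun _ => g j
  | s + 1, j, hj => by
    rcases Nat.lt_succ_iff_lt_or_eq.1 hj with h | h
    · obtain ⟨x, hx⟩ := KD_zero_range g s j h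
      refine ⟨fun c => Sum.elim x 0 ((succEquiv s 0).symm c), ?_⟩
      funext a
      cases a with
      | skip a =>
        rw [KD_skip]
        change KD g s 0 x a + g s * 0 = _
        rw [hx]; simp
    · subst h
      refine ⟨fun c => Sum.elim 0 (fun _ => 1) ((succEquiv j 0).symm c), ?_⟩
      funext a
      cases a with
      | skip a =>
        rw [KD_skip]
        change KD g j 0 0 a + g j * 1 = _
        simp

theorem KD_zero_range_span (g : ℕ → R) (s : ℕ) (r : R)
    (hr : r ∈ Ideal.span {x | ∃ j < s, x = g j}) : 
    (fun _ => r) ∈ LinearMap.range (KD g s 0) := by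
  let L : R →ₗ[R] (KI s 0 → R) := LinearMap.pi fun _ => LinearMap.id
  have : Ideal.span {x | ∃ j < s, x = g j} ≤ (LinearMap.range (KD g s 0)).comap L := by
    rw [Ideal.span_le]
    rintro x ⟨j, hj, rfl⟩
    exact KD_zero_range g s j hj
  exact this hr

end

end

section

/-- sequences of modules -/
structure Cx (R : Type) [CommRing R] where
  X : ℕ → Type
  [ag : ∀ n, AddCommGroup (X n)]
  [md : ∀ n, Module R (X n)]
  d : ∀ n, X (n + 1) →ₗ[R] X n

attribute [instance] Cx.ag Cx.md

section
variable {R : Type} [CommRing R]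

theorem lift_range {M N L : Type} [AddCommGroup M] [Module R M] [AddCommGroup N] [Module R N]
    [AddCommGroup L] [Module R L] [Module.Projective R M] (u : M →ₗ[R] L) (d : N →ₗ[R] L)
    (h : ∀ x, ∃ y, d y = u x) : ∃ v : M →ₗ[R] N, ∀ x, d (v x) = u x := by
  obtain ⟨v, hv⟩ := Module.projective_lifting_property d.rangeRestrict
    (u.codRestrict (LinearMap.range d) h) d.surjective_rangeRestrict
  refine ⟨v, fun x => ?_⟩
  have := congrArg (fun w => (w x : L)) hv
  exact this

/-- truncated chain maps -/
def IsCM (C D : Cx R) (N : ℕ) (g : ∀ n, C.X n →ₗ[R] D.X n) : Prop :=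
  ∀ n < N, ∀ x, D.d n (g (n + 1) x) = g n (C.d n x)

theorem IsCM.mono {C D : Cx R} {N N' : ℕ} {g : ∀ n, C.X n →ₗ[R] D.X n} (h : IsCM C D N g)
    (hN : N' ≤ N) : IsCM C D N' g := fun n hn => h n (hn.trans_le hN)

theorem IsCM.comp {C D E : Cx R} {N : ℕ} {g : ∀ n, C.X n →ₗ[R] D.X n} {g' : ∀ n, D.X n →ₗ[R] E.X n}
    (h' : IsCM D E N g') (h : IsCM C D N g) : IsCM C E N fun n => g' n ∘ₗ g n := by
  intro n hn x
  simp only [LinearMap.comp_apply]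
  rw [h' n hn, h n hn]

theorem lift_step {C D : Cx R} {N : ℕ} {g : ∀ n, C.X n →ₗ[R] D.X n} (h : IsCM C D N g)
    [Module.Projective R (C.X (N + 1))] (hr : ∀ x, ∃ y, D.d N y = g N (C.d N x)) :
    ∃ g' : ∀ n, C.X n →ₗ[R] D.X n, g' 0 = g 0 ∧ IsCM C D (N + 1) g' := by
  classical
  obtain ⟨v, hv⟩ := lift_range (g N ∘ₗ C.d N) (D.d N) hr
  refine ⟨Function.update g (N + 1) v, Function.update_of_ne (by omega) _ _, fun n hn x => ?_⟩
  have h1 : Function.update g (N + 1) v n = g n := Function.update_of_ne (by omega) _ _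
  rw [h1]
  rcases Nat.lt_succ_iff_lt_or_eq.1 hn with hn | rfl
  · have h2 : Function.update g (N + 1) v (n + 1) = g (n + 1) :=
      Function.update_of_ne (by omega) _ _
    rw [h2]
    exact h n hn x
  · rw [Function.update_self]
    exact hv x

/-- chain map lifting -/
theorem lift_exact {C D : Cx R} (hproj : ∀ n, Module.Projective R (C.X n))
    (hdd : ∀ n x, C.d n (C.d (n + 1) x) = 0)
    (hex : ∀ n y, D.d n y = 0 → ∃ z, D.d (n + 1) z = y) (g0 : ∀ n, C.X n →ₗ[R] D.X n)
    (h0 : ∀ x, ∃ z, D.d 0 z = g0 0 (C.d 0 x)) (N : ℕ) :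
    ∃ g : ∀ n, C.X n →ₗ[R] D.X n, g 0 = g0 0 ∧ IsCM C D N g := by
  induction N with
  | zero => exact ⟨g0, rfl, fun n hn => absurd hn (by omega)⟩
  | succ N ih =>
    obtain ⟨g, hg0, hg⟩ := ih
    obtain ⟨g', hg'0, hg'⟩ := lift_step hg (by
      intro x
      cases N with
      | zero => rw [hg0]; exact h0 x
      | succ N =>
        apply hex
        rw [hg N (by omega), hdd, map_zero])
    exact ⟨g', hg'0.trans hg0, hg'⟩

def Cob (C : Cx R) : ∀ i, (C.X i →ₗ[R] R) → Prop
  | 0, l => l = 0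
  | i + 1, l => ∃ ψ : C.X i →ₗ[R] R, l = ψ ∘ₗ C.d i

theorem Cob.add {C : Cx R} : ∀ {i : ℕ} {l l' : C.X i →ₗ[R] R}, Cob C i l → Cob C i l' →
    Cob C i (l + l')
  | 0, _, _, h, h' => by
    rw [Cob] at h h'; rw [h, h', add_zero]; rfl
  | i + 1, _, _, ⟨ψ, h⟩, ⟨ψ', h'⟩ => ⟨ψ + ψ', by rw [h, h', LinearMap.add_comp]⟩

theorem Cob.smul {C : Cx R} (r : R) : ∀ {i : ℕ} {l : C.X i →ₗ[R] R}, Cob C i l →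
    Cob C i (r • l)
  | 0, _, h => by
    rw [Cob] at h; rw [h, smul_zero]; rfl
  | i + 1, _, ⟨ψ, h⟩ => ⟨r • ψ, by rw [h, LinearMap.smul_comp]⟩

theorem Cob.pull {C D : Cx R} {g : ∀ n, C.X n →ₗ[R] D.X n} : ∀ {i : ℕ} {l : D.X i →ₗ[R] R},
    Cob D i l → IsCM C D i g → Cob C i (l ∘ₗ g i)
  | 0, _, h, _ => by
    rw [Cob] at h; rw [h]; rfl
  | i + 1, _, ⟨ψ, h⟩, hg => ⟨ψ ∘ₗ g i, by
      rw [h]; ext x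
      simp only [LinearMap.comp_apply]
      rw [hg i (by omega)]⟩

theorem homotopy_step {C D : Cx R} (hproj : ∀ n, Module.Projective R (C.X n))
    (hdd : ∀ n x, C.d n (C.d (n + 1) x) = 0)
    (hex : ∀ n y, D.d n y = 0 → ∃ z, D.d (n + 1) z = y)
    (g : ∀ n, C.X n →ₗ[R] D.X n) (h0 : ∀ x, ∃ z, D.d 0 z = g 0 x) (N : ℕ) (hg : IsCM C D N g) :
    ∃ h : C.X N →ₗ[R] D.X (N + 1), ∀ x, g N (C.d N x) = D.d N (h (C.d N x)) := by
  induction N with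
  | zero =>
    obtain ⟨v, hv⟩ := lift_range (g 0) (D.d 0) h0
    exact ⟨v, fun x => (hv _).symm⟩
  | succ N ih =>
    obtain ⟨h, hh⟩ := ih (hg.mono (by omega))
    obtain ⟨v, hv⟩ := lift_range (g (N + 1) - h ∘ₗ C.d N) (D.d (N + 1)) (by
      intro x
      apply hex
      rw [LinearMap.sub_apply, map_sub, hg N (by omega), hh, LinearMap.comp_apply, sub_self])
    refine ⟨v, fun x => ?_⟩
    rw [hv, LinearMap.sub_apply, LinearMap.comp_apply, hdd, map_zero, sub_zero]

theorem homotopy_cob {C D : Cx R} (hproj : ∀ n, Module.Projective R (C.X n))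
    (hdd : ∀ n x, C.d n (C.d (n + 1) x) = 0)
    (hex : ∀ n y, D.d n y = 0 → ∃ z, D.d (n + 1) z = y)
    (g : ∀ n, C.X n →ₗ[R] D.X n) (h0 : ∀ x, ∃ z, D.d 0 z = g 0 x) (i : ℕ) (hg : IsCM C D i g)
    (φ : D.X i →ₗ[R] R) (hφ : ∀ x, φ (D.d i x) = 0) : Cob C i (φ ∘ₗ g i) := by
  cases i with
  | zero =>
    change _ = 0
    ext x
    obtain ⟨z, hz⟩ := h0 x
    rw [LinearMap.comp_apply, ← hz, hφ]; rfl
  | succ N =>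
    obtain ⟨h, hh⟩ := homotopy_step hproj hdd hex g h0 N (hg.mono (by omega))
    refine ⟨φ ∘ₗ h, ?_⟩
    ext x
    obtain ⟨z, hz⟩ := hex N (g (N + 1) x - h (C.d N x)) (by
      rw [map_sub, hg N (by omega), hh, sub_self])
    have := hφ z
    rw [hz, map_sub, sub_eq_zero] at this
    exact this

/-- homotopy for two chain maps -/
theorem homotopy_cob_sub {C D : Cx R} {M : Type} [AddCommGroup M] [Module R M]
    (hproj : ∀ n, Module.Projective R (C.X n))
    (hdd : ∀ n x, C.d n (C.d (n + 1) x) = 0)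
    (hex : ∀ n y, D.d n y = 0 → ∃ z, D.d (n + 1) z = y)
    (ε : D.X 0 →ₗ[R] M) (hε : ∀ y, ε y = 0 → ∃ z, D.d 0 z = y)
    (α β : ∀ n, C.X n →ₗ[R] D.X n) (i : ℕ) (hα : IsCM C D i α) (hβ : IsCM C D i β)
    (h0 : ∀ x, ε (α 0 x) = ε (β 0 x))
    (φ : D.X i →ₗ[R] R) (hφ : ∀ x, φ (D.d i x) = 0)
    (h : Cob C i (φ ∘ₗ α i)) : Cob C i (φ ∘ₗ β i) := by
  have h1 := homotopy_cob hproj hdd hex (fun n => β n - α n) (fun x => hε _ (by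
    rw [LinearMap.sub_apply, map_sub, h0, sub_self])) i (fun n hn x => by
    simp only [LinearMap.sub_apply]
    rw [map_sub, hα n hn, hβ n hn]) φ hφ
  have h2 := h1.add h
  convert h2 using 1
  ext x
  simp
end

end

section
open CategoryTheory Limits Opposite

section
variable {R : Type} [CommRing R]

/-- `e` is represented by `x` -/
def HRep (K : ChainComplex (ModuleCat.{0} R)ᵒᵖ ℕ) (i : ℕ)
    (x : (K.X i).unop) (e : (K.homology i).unop) : Prop :=
  ∃ z : (K.opcycles i).unop, (K.pOpcycles i).unop z = x ∧ (K.homologyι i).unop z = e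

variable (K : ChainComplex (ModuleCat.{0} R)ᵒᵖ ℕ) (i : ℕ)

theorem HRep.smul {K : ChainComplex (ModuleCat.{0} R)ᵒᵖ ℕ} {i : ℕ} {x e} (h : HRep K i x e)
    (r : R) : HRep K i (r • x) (r • e) := by
  obtain ⟨z, rfl, rfl⟩ := h
  exact ⟨r • z, map_smul _ _ _, map_smul _ _ _⟩

theorem HRep_exists (e) : ∃ x, (K.d (i+1) i).unop x = 0 ∧ HRep K i x e := by
  have : Function.Surjective (K.homologyι i).unop := by
    rw [← ModuleCat.epi_iff_surjective]; infer_instance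
  obtain ⟨z, rfl⟩ := this e
  refine ⟨_, ?_, z, rfl, rfl⟩
  have := K.d_pOpcycles (i+1) i
  have := congrArg (fun u => u.unop z) this
  exact this

theorem HRep_of_cocycle (x) (hx : (K.d (i+1) i).unop x = 0) : ∃ e, HRep K i x e := by
  have hcok := K.opcyclesIsCokernel (i+1) i (by simp)
  have ex : (ShortComplex.mk (K.d (i+1) i) (K.pOpcycles i) (by simp)).Exact :=
    ShortComplex.exact_of_g_is_cokernel _ hcok
  have ex2 := ex.unop
  rw [ShortComplex.moduleCat_exact_iff] at ex2
  obtain ⟨z, hz⟩ := ex2 x hx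
  exact ⟨_, z, hz, rfl⟩

theorem HRep_zero_zero {x} (h : HRep K 0 x 0) : x = 0 := by
  obtain ⟨z, rfl, hz⟩ := h
  have : IsIso (K.homologyι 0) := K.isIso_homologyι 0 _ rfl (by simp)
  have : Function.Injective (K.homologyι 0).unop := by
    rw [← ModuleCat.mono_iff_injective]; infer_instance
  rw [this (hz.trans (map_zero _).symm), map_zero]

theorem HRep_succ_zero {x} (h : HRep K (i+1) x 0) : ∃ y, (K.d (i+1) i).unop y = x := by
  obtain ⟨z, rfl, hz⟩ := h
  have hk := K.homologyIsKernel (i+1) i (by simp)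
  have ex : (ShortComplex.mk (K.homologyι (i+1)) (K.fromOpcycles (i+1) i) (by simp)).Exact :=
    ShortComplex.exact_of_f_is_kernel _ hk
  have ex2 := ex.unop
  rw [ShortComplex.moduleCat_exact_iff] at ex2
  obtain ⟨y, hy⟩ := ex2 z hz
  refine ⟨y, ?_⟩
  rw [← K.p_fromOpcycles (i+1) i, ← hy]
  rfl

theorem HRep_inj {x e e'} (h : HRep K i x e) (h' : HRep K i x e') : e = e' := by
  obtain ⟨z, rfl, hz⟩ := h
  obtain ⟨z', h1, hz'⟩ := h'
  have : Function.Injective (K.pOpcycles i).unop := by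
    rw [← ModuleCat.mono_iff_injective]; infer_instance
  rw [← hz, ← hz', this h1]

theorem HRep_boundary {x e} (h : HRep K (i+1) x e) (y) (hy : (K.d (i+1) i).unop y = x) : e = 0 := by
  refine HRep_inj K (i+1) h ⟨(K.fromOpcycles (i+1) i).unop y, ?_, ?_⟩
  · rw [← hy, ← K.p_fromOpcycles (i+1) i]; rfl
  · have := K.homologyι_comp_fromOpcycles (i+1) i
    have := congrArg (fun u => u.unop y) this
    exact this

theorem HRep_nat {K L : ChainComplex (ModuleCat.{0} R)ᵒᵖ ℕ} {i : ℕ} (φ : K ⟶ L) {x e}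
    (h : HRep L i x e) : 
    HRep K i ((φ.f i).unop x) ((HomologicalComplex.homologyMap φ i).unop e) := by
  obtain ⟨z, rfl, rfl⟩ := h
  refine ⟨(HomologicalComplex.opcyclesMap φ i).unop z, ?_, ?_⟩
  · have := HomologicalComplex.p_opcyclesMap φ i
    have := congrArg (fun u => u.unop z) this
    exact this
  · have := HomologicalComplex.homologyι_naturality φ i
    have := congrArg (fun u => u.unop z) this
    exact this.symm

theorem HRep_congr {K : ChainComplex (ModuleCat.{0} R)ᵒᵖ ℕ} {i : ℕ} {x e x' e'}
    (h : HRep K i x e) (hx : x = x') (he : e = e') : HRep K i x' e' := by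
  subst hx he; exact h

/-- represents an element of Ext -/
def ERep {X : ModuleCat.{0} R} (P : ProjectiveResolution X) (Y : ModuleCat.{0} R) (i : ℕ)
    (x : P.complex.X i ⟶ Y) (e : ((Ext R (ModuleCat.{0} R) i).obj (op X)).obj Y) : Prop :=
  HRep ((((linearYoneda R (ModuleCat.{0} R)).obj Y).rightOp.mapHomologicalComplex _).obj P.complex) i x
    ((P.isoLeftDerivedObj ((linearYoneda R (ModuleCat.{0} R)).obj Y).rightOp i).inv.unop e)

theorem ERep.smul {X : ModuleCat.{0} R} {P : ProjectiveResolution X} {Y : ModuleCat.{0} R} {i : ℕ}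
    {x e} (h : ERep P Y i x e) (r : R) : ERep P Y i (r • x) (r • e) := by
  exact HRep_congr (HRep.smul h r) rfl (map_smul
    ((P.isoLeftDerivedObj ((linearYoneda R (ModuleCat.{0} R)).obj Y).rightOp i).inv.unop).hom r e).symm

theorem ERep_exists {X : ModuleCat.{0} R} (P : ProjectiveResolution X) (Y : ModuleCat.{0} R) (i : ℕ)
    (e) : ∃ x, P.complex.d (i+1) i ≫ x = 0 ∧ ERep P Y i x e :=
  HRep_exists ((((linearYoneda R (ModuleCat.{0} R)).obj Y).rightOp.mapHomologicalComplex _).obj P.complex) i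
    ((P.isoLeftDerivedObj ((linearYoneda R (ModuleCat.{0} R)).obj Y).rightOp i).inv.unop e)

theorem ERep_zero_zero {X : ModuleCat.{0} R} (P : ProjectiveResolution X) (Y : ModuleCat.{0} R) 
    {x} (h : ERep P Y 0 x 0) : x = 0 := by
  exact HRep_zero_zero _ (HRep_congr h rfl (map_zero
    ((P.isoLeftDerivedObj ((linearYoneda R (ModuleCat.{0} R)).obj Y).rightOp 0).inv.unop).hom))

theorem ERep_succ_zero {X : ModuleCat.{0} R} (P : ProjectiveResolution X) (Y : ModuleCat.{0} R) (i : ℕ)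
    {x} (h : ERep P Y (i+1) x 0) : ∃ y, P.complex.d (i+1) i ≫ y = x := by
  exact HRep_succ_zero _ i (HRep_congr h rfl (map_zero
    ((P.isoLeftDerivedObj ((linearYoneda R (ModuleCat.{0} R)).obj Y).rightOp (i+1)).inv.unop).hom))

theorem ERep_inv_inj {X : ModuleCat.{0} R} (P : ProjectiveResolution X) (Y : ModuleCat.{0} R) (i : ℕ) :
    Function.Injective (P.isoLeftDerivedObj ((linearYoneda R (ModuleCat.{0} R)).obj Y).rightOp i).inv.unop := by
  rw [← ModuleCat.mono_iff_injective]; infer_instance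

theorem ERep_boundary {X : ModuleCat.{0} R} (P : ProjectiveResolution X) (Y : ModuleCat.{0} R) (i : ℕ)
    {x e} (h : ERep P Y (i+1) x e) (y) (hy : P.complex.d (i+1) i ≫ y = x) : e = 0 := by
  have := HRep_boundary _ i h y hy
  exact ERep_inv_inj P Y (i+1) (this.trans (map_zero _).symm)

theorem ERep_boundary_zero {X : ModuleCat.{0} R} (P : ProjectiveResolution X) (Y : ModuleCat.{0} R) 
    {e} (h : ERep P Y 0 0 e) : e = 0 := by
  have := HRep_inj _ 0 h ⟨0, map_zero _, map_zero _⟩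
  exact ERep_inv_inj P Y 0 (this.trans (map_zero _).symm)

theorem ERep_nat {X X' : ModuleCat.{0} R} (f : X ⟶ X') (P : ProjectiveResolution X)
    (Q : ProjectiveResolution X') (φ : P.complex ⟶ Q.complex)
    (comm : φ.f 0 ≫ Q.π.f 0 = P.π.f 0 ≫ f) (Y : ModuleCat.{0} R) (i : ℕ) {x e}
    (h : ERep Q Y i x e) :
    ERep P Y i (φ.f i ≫ x) (((Ext R (ModuleCat.{0} R) i).map f.op).app Y e) := by
  unfold ERep
  have := ProjectiveResolution.isoLeftDerivedObj_inv_naturality f P Q φ comm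
    ((linearYoneda R (ModuleCat.{0} R)).obj Y).rightOp i
  have := congrArg (fun u => u.unop e) this
  have h2 := HRep_nat ((((linearYoneda R (ModuleCat.{0} R)).obj Y).rightOp.mapHomologicalComplex _).map φ) h
  exact HRep_congr h2 rfl this.symm
end

end

section
open CategoryTheory Limits Opposite

section
variable {R : Type} [CommRing R]

/-- transition maps -/
noncomputable def lcTr (I : Ideal R) {t t' : ℕ} (h : t ≤ t') :
    ModuleCat.of R (R ⧸ I ^ t') ⟶ ModuleCat.of R (R ⧸ I ^ t) :=
  ModuleCat.ofHom (Submodule.mapQ (I^t') (I^t) LinearMap.id (Ideal.pow_le_pow_right h))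

/-- map to the colimit -/
noncomputable def lcMk (I : Ideal R) (i : ℕ) (M : ModuleCat.{0} R) (t : ℕ) :
    ((Ext R (ModuleCat.{0} R) i).obj (op (ModuleCat.of R (R ⧸ I ^ t)))).obj M ⟶
      (localCohomology I i).obj M :=
  (colimit.ι (localCohomology.diagram (localCohomology.idealPowersDiagram I) i) (op (op t))).app M

/-- colimit -/
noncomputable def lcColim (I : Ideal R) (i : ℕ) (M : ModuleCat.{0} R) :=
  isColimitOfPreserves ((evaluation (ModuleCat.{0} R) (ModuleCat.{0} R)).obj M)
    (colimit.isColimit (localCohomology.diagram (localCohomology.idealPowersDiagram I) i))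

theorem lcMk_tr (I : Ideal R) (i : ℕ) (M : ModuleCat.{0} R) {t t' : ℕ} (h : t ≤ t') (e) :
    lcMk I i M t' (((Ext R (ModuleCat.{0} R) i).map (lcTr I h).op).app M e) = lcMk I i M t e := by
  have := colimit.w (localCohomology.diagram (localCohomology.idealPowersDiagram I) i)
    (homOfLE h).op.op
  have := congrArg (fun u => u.app M e) this
  exact this

theorem lcMk_surj (I : Ideal R) (i : ℕ) (M : ModuleCat.{0} R) (z : (localCohomology I i).obj M) :
    ∃ t e, lcMk I i M t e = z := by
  obtain ⟨j, y, hy⟩ := Concrete.isColimit_exists_rep _ (lcColim I i M) z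
  exact ⟨j.unop.unop, y, hy⟩

theorem lcMk_zero (I : Ideal R) (i : ℕ) (M : ModuleCat.{0} R) {t : ℕ} {e}
    (he : lcMk I i M t e = 0) : ∃ t', ∃ h : t ≤ t',
    ((Ext R (ModuleCat.{0} R) i).map (lcTr I h).op).app M e = 0 := by
  obtain ⟨k, f, g, hfg⟩ := Concrete.isColimit_exists_of_rep_eq _ (lcColim I i M) (i := op (op t)) 
    (j := op (op t)) e
    0 (he.trans (map_zero (lcMk I i M t).hom).symm)
  have h : t ≤ k.unop.unop := leOfHom f.unop.unop
  refine ⟨k.unop.unop, h, ?_⟩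
  exact hfg.trans (map_zero _)
end

end

section

theorem dim_ge_of_integral {A S : Type} [CommRing A] [CommRing S] [Algebra A S]
    [Algebra.IsIntegral A S] (hinj : Function.Injective (algebraMap A S)) :
    ringKrullDim A ≤ ringKrullDim S := by
  have : FaithfulSMul A S := (faithfulSMul_iff_algebraMap_injective A S).2 hinj
  refine iSup_le fun l => ?_
  obtain ⟨⟨Q, hQ, hQo⟩⟩ := Ideal.nonempty_primesOver (S := S) l.head.asIdeal
  obtain ⟨L, hL, -⟩ := Ideal.exists_ltSeries_of_hasGoingUp l Q
  rw [← hL]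
  exact le_iSup (fun p : LTSeries (PrimeSpectrum S) => ((p.length : ℕ∞) : WithBot ℕ∞)) L

theorem trdeg_le_dim (k S : Type) [Field k] [CommRing S] [IsDomain S] [Algebra k S]
    [Algebra.FiniteType k S] {ι : Type} [Fintype ι] {x : ι → S} (hx : IsTranscendenceBasis k x) :
    ((Fintype.card ι : ℕ) : WithBot ℕ∞) ≤ ringKrullDim S := by
  obtain ⟨m, g, hg, hi⟩ := exists_integral_inj_algHom_of_fg k S
  let _ := g.toRingHom.toAlgebra
  have hi2 : Algebra.IsIntegral (MvPolynomial (Fin m) k) S := ⟨hi⟩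
  have : FaithfulSMul (MvPolynomial (Fin m) k) S :=
    (faithfulSMul_iff_algebraMap_injective _ S).2 hg
  have : IsScalarTower k (MvPolynomial (Fin m) k) S :=
    IsScalarTower.of_algebraMap_eq fun r => (g.commutes r).symm
  have h1 := trdeg_add_eq k (MvPolynomial (Fin m) k) (A := S)
  rw [trdeg_eq_zero (R := MvPolynomial (Fin m) k) (A := S), MvPolynomial.trdeg_of_isDomain, ← hx.cardinalMk_eq_trdeg] at h1
  simp only [Cardinal.lift_natCast, add_zero, Cardinal.mk_fintype, Fintype.card_fin] at h1
  have h2 : m = Fintype.card ι := by exact_mod_cast h1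
  rw [← h2]
  refine le_trans ?_ (dim_ge_of_integral (A := MvPolynomial (Fin m) k) hg)
  rw [MvPolynomial.ringKrullDim_of_isNoetherianRing]
  simp

theorem fin_up_to_denom {A S : Type} [CommRing A] [IsDomain A] [CommRing S] [Algebra A S]
    {n : ℕ} (x : Fin n → S) (hx : ∀ j, IsAlgebraic A (x j))
    (hgen : ∀ s : Subalgebra A S, (∀ j, x j ∈ s) → s = ⊤) :
    ∃ G : Finset S, ∀ g : S, ∃ c : A, c ≠ 0 ∧ c • g ∈ Submodule.span A (G : Set S) := by
  choose c hc hci using fun j => (hx j).exists_integral_multiple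
  obtain ⟨G, hG⟩ := fg_adjoin_of_finite (Set.finite_range fun j => c j • x j)
    (by rintro _ ⟨j, rfl⟩; exact hci j)
  refine ⟨G, fun g => ?_⟩
  rw [hG]
  let T := Algebra.adjoin A (Set.range fun j => c j • x j)
  let s : Subalgebra A S :=
    { carrier := {g | ∃ c : A, c ≠ 0 ∧ c • g ∈ T}
      mul_mem' := by
        rintro a b ⟨c, hc, ha⟩ ⟨d, hd, hb⟩
        refine ⟨c * d, mul_ne_zero hc hd, ?_⟩
        rw [← smul_mul_smul_comm]
        exact T.mul_mem ha hb
      add_mem' := by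
        rintro a b ⟨c, hc, ha⟩ ⟨d, hd, hb⟩
        refine ⟨c * d, mul_ne_zero hc hd, ?_⟩
        rw [smul_add]
        refine T.add_mem ?_ ?_
        · rw [mul_comm, mul_smul]; exact T.smul_mem ha _
        · rw [mul_smul]; exact T.smul_mem hb _
      algebraMap_mem' := fun a => ⟨1, one_ne_zero, by rw [one_smul]; exact T.algebraMap_mem a⟩ }
  have : s = ⊤ := hgen s fun j => ⟨c j, hc j, Algebra.subset_adjoin ⟨j, rfl⟩⟩
  have h : g ∈ s := by rw [this]; trivial
  exact h

theorem totalDegree_hom_le {k A σ Y : Type} [CommRing k] [CommRing A]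
    (Φ : MvPolynomial σ k →+* MvPolynomial Y A) (hC : ∀ a, (Φ (MvPolynomial.C a)).totalDegree = 0)
    (hX : ∀ j, (Φ (MvPolynomial.X j)).totalDegree ≤ 1) (g : MvPolynomial σ k) :
    (Φ g).totalDegree ≤ g.totalDegree := by
  conv_lhs => rw [g.as_sum, map_sum]
  refine MvPolynomial.totalDegree_finsetSum_le fun m hm => ?_
  rw [MvPolynomial.monomial_eq, map_mul, Finsupp.prod, map_prod]
  refine (MvPolynomial.totalDegree_mul _ _).trans ?_
  rw [hC, zero_add]
  refine (MvPolynomial.totalDegree_finsetProd _ _).trans ?_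
  refine le_trans ?_ (MvPolynomial.le_totalDegree hm)
  refine Finset.sum_le_sum fun j _ => ?_
  rw [map_pow]
  refine (MvPolynomial.totalDegree_pow _ _).trans ?_
  exact (Nat.mul_le_mul_left _ (hX j)).trans (by simp)

theorem param_aux {k S : Type} [Field k] [CommRing S] [IsDomain S] [Algebra k S] {n : ℕ}
    (π : MvPolynomial (Fin n) k →ₐ[k] S) (hπ : Function.Surjective π) :
    ∃ (τ Y : Type) (_ : Fintype τ) (_ : Fintype Y)
      (Φ : MvPolynomial (Fin n) k ≃+* MvPolynomial Y (MvPolynomial τ k)),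
      n = Fintype.card τ + Fintype.card Y ∧
      ((Fintype.card τ : ℕ) : WithBot ℕ∞) ≤ ringKrullDim S ∧
      (∀ g, (Φ g).totalDegree ≤ g.totalDegree) ∧
      ∃ G : Finset (MvPolynomial (Fin n) k), ∀ g, ∃ c : MvPolynomial τ k,
        π (Φ.symm (MvPolynomial.C c)) ≠ 0 ∧ ∃ a : MvPolynomial (Fin n) k → MvPolynomial τ k,
        π (Φ.symm (MvPolynomial.C c) * g - ∑ x ∈ G, Φ.symm (MvPolynomial.C (a x)) * x) = 0 := by
  classical
  have hfin : Algebra.FiniteType k S := Algebra.FiniteType.of_surjective π hπ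
  let x : Fin n → S := fun j => π (MvPolynomial.X j)
  have hadj : Algebra.adjoin k (Set.range x) = ⊤ := by
    have h1 := MvPolynomial.adjoin_range_X (R := k) (σ := Fin n)
    have h2 := congrArg (Subalgebra.map (π)) h1
    rw [AlgHom.map_adjoin, ← Set.range_comp, Algebra.map_top] at h2
    rw [(AlgHom.range_eq_top _).2 hπ] at h2
    exact h2
  have : Algebra.IsAlgebraic (Algebra.adjoin k (Set.range x)) S := by
    rw [hadj]
    exact ⟨fun a => isAlgebraic_algebraMap (⟨a, trivial⟩ : (⊤ : Subalgebra k S))⟩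
  obtain ⟨t, htx, ht⟩ := exists_isTranscendenceBasis_subset (R := k) (Set.range x)
  have : Finite t := (Set.finite_range x).subset htx
  let _ : Fintype t := Fintype.ofFinite t
  choose ρ hρ using fun a : t => htx a.2
  have hρi : Function.Injective ρ := fun a b h => Subtype.ext (by rw [← hρ a, ← hρ b, h])
  let E : ((Set.range ρ)ᶜ : Set (Fin n)) ⊕ t ≃ Fin n :=
    (Equiv.sumComm _ _).trans ((Equiv.sumCongr (Equiv.ofInjective ρ hρi) (Equiv.refl _)).trans
      (Equiv.Set.sumCompl (Set.range ρ)))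
  have hEr : ∀ a : t, E (Sum.inr a) = ρ a := fun a => rfl
  let Φ := (MvPolynomial.renameEquiv k E.symm).trans (MvPolynomial.sumAlgEquiv k
    ((Set.range ρ)ᶜ : Set (Fin n)) t)
  have hΦr : ∀ a, Φ.symm (MvPolynomial.C (MvPolynomial.X a)) = MvPolynomial.X (ρ a) := by
    intro a
    rw [AlgEquiv.symm_apply_eq]
    simp [Φ, ← hEr]
  have hΦk : ∀ r, Φ (MvPolynomial.C r) = MvPolynomial.C (MvPolynomial.C r) := by
    intro r
    simp [Φ]
  have hΦC : ∀ c, π (Φ.symm (MvPolynomial.C c)) =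
      MvPolynomial.aeval (fun a : t => (a : S)) c := by
    intro c
    induction c using MvPolynomial.induction_on with
    | C r => 
      rw [MvPolynomial.aeval_C, ← hΦk, AlgEquiv.symm_apply_apply, ← MvPolynomial.algebraMap_eq, AlgHom.commutes]
    | add p q hp hq => simp only [map_add, hp, hq]
    | mul_X p a hp => 
      rw [map_mul, map_mul, map_mul, hp, hΦr, map_mul, MvPolynomial.aeval_X]
      congr 1
      exact hρ a
  have hind := ht.1
  let g0 : MvPolynomial t k →ₐ[k] S := MvPolynomial.aeval (fun a : t => (a : S))
  have hg0 : Function.Injective g0 := hind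
  let _ : Algebra (MvPolynomial t k) S := g0.toRingHom.toAlgebra
  have hsm : ∀ (c : MvPolynomial t k) (s : S), c • s = g0 c * s := fun c s => rfl
  have htow : IsScalarTower k (MvPolynomial t k) S :=
    IsScalarTower.of_algebraMap_eq fun r => (g0.commutes r).symm
  have halg : ∀ j, IsAlgebraic (MvPolynomial t k) (x j) := by
    intro j
    have h1 : IsAlgebraic (Algebra.adjoin k (Set.range ((↑) : t → S))) (x j) :=
      ht.isAlgebraic.isAlgebraic _
    have e := hind.aevalEquiv
    refine (isAlgebraic_ringHom_iff_of_comp_eq hind.aevalEquiv.toRingEquiv (RingHom.id S) Function.injective_id ?_ ).1 h1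
    refine RingHom.ext fun u => ?_
    exact hind.algebraMap_aevalEquiv u
  obtain ⟨G, hG⟩ := fin_up_to_denom x halg (by
    intro s hs
    rw [eq_top_iff]
    have : Algebra.adjoin k (Set.range x) ≤ s.restrictScalars k := by
      rw [Algebra.adjoin_le_iff]
      rintro _ ⟨j, rfl⟩
      exact hs j
    rw [hadj] at this
    exact fun y _ => this (by trivial : y ∈ (⊤ : Subalgebra k S)))
  choose lift hlift using hπ
  have hlinj : Function.Injective lift := fun a b h => by rw [← hlift a, ← hlift b, h]
  refine ⟨t, ((Set.range ρ)ᶜ : Set (Fin n)), inferInstance, inferInstance, Φ.toRingEquiv, ?_, ?_, ?_, 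
    G.image lift, ?_⟩
  · have := Fintype.card_congr E
    rw [Fintype.card_sum, Fintype.card_fin] at this
    omega
  · exact trdeg_le_dim k S ht
  · refine totalDegree_hom_le Φ.toRingEquiv.toRingHom ?_ ?_
    · intro a
      simp [hΦk]
    · intro j
      obtain ⟨u, rfl⟩ := E.surjective j
      rcases u with a | a
      · simp [Φ]
      · simp [Φ]
  · intro g
    obtain ⟨c, hc, hcg⟩ := hG (π g)
    refine ⟨c, ?_, ?_⟩
    ·       exact fun h => hc (hg0 (((hΦC c).symm.trans h).trans (map_zero g0).symm))
    · obtain ⟨a, ha⟩ := Submodule.mem_span_finset.1 hcg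
      refine ⟨fun r => a (π r), ?_⟩
      rw [map_sub, map_mul, map_sum, Finset.sum_image hlinj.injOn]
      simp only [map_mul, hlift]
      rw [sub_eq_zero]
      have h2 := ha.2.symm
      simp only [hsm] at h2
      erw [hΦC]
      refine h2.trans (Finset.sum_congr rfl fun u _ => ?_)
      congr 1
      exact (hΦC _).symm

theorem param_exists {k : Type} [Field k] {n : ℕ} (P : Ideal (MvPolynomial (Fin n) k)) [P.IsPrime] :
    ∃ (τ Y : Type) (_ : Fintype τ) (_ : Fintype Y)
      (Φ : MvPolynomial (Fin n) k ≃+* MvPolynomial Y (MvPolynomial τ k)),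
      n = Fintype.card τ + Fintype.card Y ∧
      ((Fintype.card τ : ℕ) : WithBot ℕ∞) ≤ ringKrullDim (MvPolynomial (Fin n) k ⧸ P) ∧
      (∀ g, (Φ g).totalDegree ≤ g.totalDegree) ∧
      ∃ G : Finset (MvPolynomial (Fin n) k), ∀ g, ∃ c : MvPolynomial τ k,
        Φ.symm (MvPolynomial.C c) ∉ P ∧ ∃ a : MvPolynomial (Fin n) k → MvPolynomial τ k,
        Φ.symm (MvPolynomial.C c) * g - ∑ x ∈ G, Φ.symm (MvPolynomial.C (a x)) * x ∈ P := by
  obtain ⟨τ, Y, i1, i2, Φ, h1, h2, h3, G, hG⟩ :=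
    param_aux (Ideal.Quotient.mkₐ k P) (Ideal.Quotient.mkₐ_surjective k P)
  refine ⟨τ, Y, i1, i2, Φ, h1, h2, h3, G, fun g => ?_⟩
  obtain ⟨c, hc, a, ha⟩ := hG g
  exact ⟨c, fun h => hc (Ideal.Quotient.eq_zero_iff_mem.2 h), a, Ideal.Quotient.eq_zero_iff_mem.1 ha⟩

end

section
open CategoryTheory Limits Opposite

section
variable {R : Type} [CommRing R]

/-- resolutions of the quotients by powers -/
noncomputable def QR (I : Ideal R) (t : ℕ) : ProjectiveResolution (ModuleCat.of R (R ⧸ I ^ t)) :=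
  projectiveResolution (ModuleCat.of R (R ⧸ I ^ t))

/-- the underlying sequence -/
noncomputable def QC (I : Ideal R) (t : ℕ) : Cx R where
  X n := (QR I t).complex.X n
  d n := ((QR I t).complex.d (n + 1) n).hom

theorem QC_proj (I : Ideal R) (t n : ℕ) : Module.Projective R ((QC I t).X n) := by
  have := (QR I t).projective n
  exact (IsProjective.iff_projective _).2 this

theorem QC_dd (I : Ideal R) (t n : ℕ) (x : (QC I t).X (n + 2)) :
    (QC I t).d n ((QC I t).d (n + 1) x) = 0 := by
  have := (QR I t).complex.d_comp_d (n + 2) (n + 1) n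
  exact congrArg (fun u => u.hom x) this

theorem QC_ex (I : Ideal R) (t n : ℕ) (y : (QC I t).X (n + 1)) (hy : (QC I t).d n y = 0) :
    ∃ z, (QC I t).d (n + 1) z = y := by
  have := (QR I t).exact_succ n
  exact ((ShortComplex.moduleCat_exact_iff _).1 this) y hy

/-- augmentation -/
noncomputable def Qe (I : Ideal R) (t : ℕ) : (QC I t).X 0 →ₗ[R] R ⧸ I ^ t :=
  ((QR I t).π.f 0).hom

theorem Qe_surj (I : Ideal R) (t : ℕ) : Function.Surjective (Qe I t) := by
  have : Epi ((QR I t).π.f 0) := inferInstance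
  exact (ModuleCat.epi_iff_surjective _).1 this

theorem Qe_d (I : Ideal R) (t : ℕ) (x : (QC I t).X 1) : Qe I t ((QC I t).d 0 x) = 0 := by
  have := (QR I t).complex_d_comp_π_f_zero
  exact congrArg (fun u => u.hom x) this

theorem Qe_ker (I : Ideal R) (t : ℕ) (y : (QC I t).X 0) (hy : Qe I t y = 0) :
    ∃ z, (QC I t).d 0 z = y := by
  have := (QR I t).exact₀
  exact ((ShortComplex.moduleCat_exact_iff _).1 this) y hy

/-- categorical transition map -/
noncomputable def QuC (I : Ideal R) {t t' : ℕ} (h : t ≤ t') :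
    (QR I t').complex ⟶ (QR I t).complex :=
  ProjectiveResolution.lift (lcTr I h) (QR I t') (QR I t)

theorem QuC_comm (I : Ideal R) {t t' : ℕ} (h : t ≤ t') :
    (QuC I h).f 0 ≫ (QR I t).π.f 0 = (QR I t').π.f 0 ≫ lcTr I h := by
  have := ProjectiveResolution.lift_commutes (lcTr I h) (QR I t') (QR I t)
  have := congrArg (fun u => u.f 0) this
  exact this

/-- transition map -/
noncomputable def Qu (I : Ideal R) {t t' : ℕ} (h : t ≤ t') (n : ℕ) :
    (QC I t').X n →ₗ[R] (QC I t).X n := ((QuC I h).f n).hom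

theorem Qu_cm (I : Ideal R) {t t' : ℕ} (h : t ≤ t') (N : ℕ) :
    IsCM (QC I t') (QC I t) N (Qu I h) := by
  intro n hn x
  have := (QuC I h).comm (n + 1) n
  exact congrArg (fun u => u.hom x) this

theorem Qe_Qu (I : Ideal R) {t t' : ℕ} (h : t ≤ t') (x : (QC I t').X 0) :
    Qe I t (Qu I h 0 x) = Submodule.mapQ (I^t') (I^t) LinearMap.id (Ideal.pow_le_pow_right h)
      (Qe I t' x) :=
  congrArg (fun u => u.hom x) (QuC_comm I h)

/-- representatives -/
def QRep (I : Ideal R) (i t : ℕ) (φ : (QC I t).X i →ₗ[R] R)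
    (e : ((Ext R (ModuleCat.{0} R) i).obj (op (ModuleCat.of R (R ⧸ I ^ t)))).obj
      (ModuleCat.of R R)) : Prop :=
  ERep (QR I t) (ModuleCat.of R R) i (ModuleCat.ofHom φ) e

theorem QRep.smul {I : Ideal R} {i t : ℕ} {φ e} (h : QRep I i t φ e) (r : R) :
    QRep I i t (r • φ) (r • e) := ERep.smul h r

theorem QRep_exists (I : Ideal R) (i t : ℕ) (e) :
    ∃ φ, (∀ x, φ ((QC I t).d i x) = 0) ∧ QRep I i t φ e := by
  obtain ⟨x, hx, h⟩ := ERep_exists (QR I t) (ModuleCat.of R R) i e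
  refine ⟨x.hom, fun y => ?_, h⟩
  exact congrArg (fun u => u.hom y) hx

theorem QRep.cob {I : Ideal R} {i t : ℕ} {φ e} (h : QRep I i t φ e) (he : e = 0) :
    Cob (QC I t) i φ := by
  subst he
  cases i with
  | zero =>
    have := ERep_zero_zero _ _ h
    exact congrArg (fun u => u.hom) this
  | succ i =>
    obtain ⟨y, hy⟩ := ERep_succ_zero _ _ _ h
    exact ⟨y.hom, congrArg (fun u => u.hom) hy.symm⟩

theorem QRep.zero {I : Ideal R} {i t : ℕ} {φ e} (h : QRep I i t φ e) (he : Cob (QC I t) i φ) :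
    e = 0 := by
  cases i with
  | zero =>
    have he : φ = 0 := he
    subst he
    exact ERep_boundary_zero _ _ h
  | succ i =>
    obtain ⟨ψ, hψ⟩ := he
    exact ERep_boundary _ _ _ h (ModuleCat.ofHom ψ) (by rw [hψ]; rfl)

theorem QRep.nat {I : Ideal R} {i t t' : ℕ} {φ e} (h : QRep I i t φ e) (ht : t ≤ t') :
    QRep I i t' (φ ∘ₗ Qu I ht i)
      (((Ext R (ModuleCat.{0} R) i).map (lcTr I ht).op).app (ModuleCat.of R R) e) :=
  ERep_nat (lcTr I ht) (QR I t') (QR I t) (QuC I ht) (QuC_comm I ht) _ i h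

end

end

section
section
variable {R : Type} [CommRing R]

/-- Koszul sequence -/
noncomputable def KC (g : ℕ → R) (s : ℕ) : Cx R where
  X n := KI s n → R
  d n := KD g s n

theorem KC_proj (g : ℕ → R) (s n : ℕ) : Module.Projective R ((KC g s).X n) := by
  change Module.Projective R (KI s n → R)
  infer_instance

/-- Koszul augmentation -/
noncomputable def Ke (I : Ideal R) (g : ℕ → R) (s t : ℕ) : (KC g s).X 0 →ₗ[R] R ⧸ I ^ t :=
  (Submodule.mkQ (I ^ t)) ∘ₗ (LinearMap.proj (R := R) (φ := fun _ : KI s 0 => R) default)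

theorem tau_exists (I : Ideal R) (f : ℕ → R) (s : ℕ) (hf : ∀ j < s, f j ∈ I) (t N : ℕ) :
    ∃ g : ∀ n, (KC (fun j => f j ^ t) s).X n →ₗ[R] (QC I t).X n,
      IsCM (KC (fun j => f j ^ t) s) (QC I t) N g ∧
      ∀ x, Qe I t (g 0 x) = Ke I (fun j => f j ^ t) s t x := by
  have := KC_proj (fun j => f j ^ t) s 0
  obtain ⟨v, hv⟩ := lift_range (Ke I (fun j => f j ^ t) s t) (Qe I t)
    (fun x => Qe_surj I t _)
  classical
  obtain ⟨g, hg0, hg⟩ := lift_exact (D := QC I t) (KC_proj (fun j => f j ^ t) s)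
    (fun n x => KD_comp _ s n x) (QC_ex I t)
    (Function.update (fun n => 0) 0 v) (by
      intro x
      apply Qe_ker
      rw [Function.update_self, hv]
      refine (Submodule.Quotient.mk_eq_zero _).2 ?_
      exact KD_zero_mem _ (I ^ t) s (fun j hj => Ideal.pow_mem_pow (hf j hj) t) x _) N
  rw [Function.update_self] at hg0
  exact ⟨g, hg, fun x => by rw [hg0, hv]⟩

theorem KU_cm (f : ℕ → R) (s : ℕ) {t t' : ℕ} (h : t ≤ t') (N : ℕ) :
    IsCM (KC (fun j => f j ^ t') s) (KC (fun j => f j ^ t) s) N (KU f (t' - t) s) := by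
  obtain ⟨m, rfl⟩ := Nat.exists_eq_add_of_le h
  rw [Nat.add_sub_cancel_left]
  intro n hn x
  exact KD_KU f t m s n x

theorem pow_le_span_pow (f : ℕ → R) (s t : ℕ) : ∃ t', t ≤ t' ∧
    (Ideal.span {x | ∃ j < s, x = f j}) ^ t' ≤ Ideal.span {x | ∃ j < s, x = f j ^ t} := by
  classical
  have : ∃ t', (Ideal.span {x | ∃ j < s, x = f j}) ^ t' ≤ Ideal.span {x | ∃ j < s, x = f j ^ t} := by
    apply Ideal.exists_pow_le_of_le_radical_of_fg
    · rw [Ideal.span_le]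
      rintro x ⟨j, hj, rfl⟩
      exact ⟨t, Ideal.subset_span ⟨j, hj, rfl⟩⟩
    · refine ⟨(Finset.range s).image f, ?_⟩
      congr 1
      ext x
      simp [eq_comm]
  obtain ⟨t', ht'⟩ := this
  exact ⟨max t t', le_max_left _ _, (Ideal.pow_le_pow_right (le_max_right _ _)).trans ht'⟩

theorem sigma_exists [IsNoetherianRing R] (f : ℕ → R) (s : ℕ) (I : Ideal R)
    (hI : I = Ideal.span {x | ∃ j < s, x = f j}) (N : ℕ) : ∀ t : ℕ,
    ∃ t', t ≤ t' ∧ I ^ t' ≤ Ideal.span {x | ∃ j < s, x = f j ^ t} ∧ 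
      ∃ g : ∀ n, (QC I t').X n →ₗ[R] (KC (fun j => f j ^ t) s).X n,
        IsCM (QC I t') (KC (fun j => f j ^ t) s) N g ∧
        ∀ x, Ke I (fun j => f j ^ t) s t' (g 0 x) = Qe I t' x := by
  induction N with
  | zero =>
    intro t
    obtain ⟨t', h, h'⟩ := pow_le_span_pow f s t
    rw [← hI] at h'
    refine ⟨t', h, h', ?_⟩
    have := QC_proj I t' 0
    obtain ⟨v, hv⟩ := lift_range (Qe I t') (Ke I (fun j => f j ^ t) s t') (by
      intro x
      obtain ⟨r, hr⟩ := Submodule.mkQ_surjective _ (Qe I t' x)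
      exact ⟨fun _ => r, hr⟩)
    classical
    refine ⟨Function.update (fun n => 0) 0 v, fun n hn => absurd hn (by omega), fun x => ?_⟩
    rw [Function.update_self, hv]
  | succ N ih =>
    intro t
    cases N with
    | zero =>
      obtain ⟨t', h, h', g, hg, hg0⟩ := ih t
      refine ⟨t', h, h', ?_⟩
      have := QC_proj I t' (0 + 1)
      obtain ⟨g', hg'0, hg'⟩ := lift_step hg (by
        intro x
        have h1 := hg0 ((QC I t').d 0 x)
        rw [Qe_d] at h1
        have h2 : (g 0 ((QC I t').d 0 x) : KI s 0 → R) default ∈ I ^ t' :=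
          (Submodule.Quotient.mk_eq_zero _).1 h1
        obtain ⟨y, hy⟩ := KD_zero_range_span (fun j => f j ^ t) s _ (h' h2)
        refine ⟨y, hy.trans ?_⟩
        funext a
        rw [Unique.eq_default a])
      exact ⟨g', hg', fun x => by rw [hg'0, hg0]⟩
    | succ N =>
      obtain ⟨m, hm⟩ := koszul_proZero f s N t
      obtain ⟨t', h, h', g, hg, hg0⟩ := ih (t + m)
      have hcm := (KU_cm f s (Nat.le_add_right t m) (N + 1)).comp hg
      rw [Nat.add_sub_cancel_left] at hcm
      have := QC_proj I t' (N + 1 + 1)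
      obtain ⟨g', hg'0, hg'⟩ := lift_step hcm (by
        intro x
        apply hm
        have h1 := hg N (by omega) ((QC I t').d (N + 1) x)
        rw [QC_dd, map_zero] at h1
        exact h1)
      refine ⟨t', (Nat.le_add_right t m).trans h, h'.trans ?_, g', hg', fun x => ?_⟩
      · rw [Ideal.span_le]
        rintro x ⟨j, hj, rfl⟩
        rw [pow_add]
        exact Ideal.mul_mem_right _ _ (Ideal.subset_span ⟨j, hj, rfl⟩)
      · rw [hg'0]
        refine Eq.trans ?_ (hg0 x)
        exact congrArg (Ke I (fun j => f j ^ t) s t') (KU_deg_zero f m s (g 0 x))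

/-- transposed Koszul differential -/
noncomputable def KT (g : ℕ → R) (s n : ℕ) : (KI s n → R) →ₗ[R] (KI s (n + 1) → R) where
  toFun v b := ∑ a, v a * KE g a b
  map_add' v w := by funext b; simp [add_mul, Finset.sum_add_distrib]
  map_smul' r v := by funext b; simp [Finset.mul_sum, mul_assoc]

/-- coboundaries in coordinates -/
noncomputable def KB (g : ℕ → R) (s : ℕ) : ∀ i, Submodule R (KI s i → R)
  | 0 => ⊥
  | i + 1 => LinearMap.range (KT g s i)

open scoped Classical in
/-- functional in coordinates -/
noncomputable def kco {s i : ℕ} (l : (KI s i → R) →ₗ[R] R) : KI s i → R :=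
  fun S => l (Pi.single S 1)

theorem kco_apply {s i : ℕ} (l : (KI s i → R) →ₗ[R] R) (x) : l x = ∑ S, x S * kco l S := by
  classical
  conv_lhs => rw [pi_eq_sum_univ' x]
  rw [map_sum]
  refine Finset.sum_congr rfl fun S _ => ?_
  rw [map_smul, smul_eq_mul]
  congr 2

theorem kco_comp (g : ℕ → R) {s i : ℕ} (ψ : (KI s i → R) →ₗ[R] R) :
    kco (ψ ∘ₗ KD g s i) = KT g s i (kco ψ) := by
  classical
  funext b
  change ψ (KD g s i (Pi.single b 1)) = ∑ a, kco ψ a * KE g a b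
  rw [kco_apply]
  refine Finset.sum_congr rfl fun a _ => ?_
  rw [KD_apply, mul_comm]
  simp [Pi.single_apply]

theorem kco_inj {s i : ℕ} {l l' : (KI s i → R) →ₗ[R] R} (h : kco l = kco l') : l = l' := by
  ext1 x
  rw [kco_apply, kco_apply, h]

theorem kco_surj {s i : ℕ} (v : KI s i → R) : ∃ l : (KI s i → R) →ₗ[R] R, kco l = v := by
  classical
  refine ⟨∑ S, v S • LinearMap.proj S, ?_⟩
  funext S
  simp [kco, Pi.single_apply]

theorem cob_iff (g : ℕ → R) (s : ℕ) : ∀ (i : ℕ) (l : (KI s i → R) →ₗ[R] R),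
    Cob (KC g s) i l ↔ kco l ∈ KB g s i
  | 0, l => by
    change l = 0 ↔ kco l = 0
    constructor
    · rintro rfl; rfl
    · intro h; exact kco_inj h
  | i + 1, l => by
    constructor
    · rintro ⟨ψ, rfl⟩
      exact ⟨kco ψ, (kco_comp g ψ).symm⟩
    · rintro ⟨v, hv⟩
      obtain ⟨ψ, rfl⟩ := kco_surj v
      refine ⟨ψ, kco_inj ?_⟩
      rw [← hv, ← kco_comp]; rfl

theorem kco_KU (f : ℕ → R) (m s i : ℕ) (l : (KI s i → R) →ₗ[R] R) (S) :
    kco (l ∘ₗ KU f m s i) S = KW f S ^ m * kco l S := by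
  classical
  change l (KU f m s i (Pi.single S 1)) = KW f S ^ m * l (Pi.single S 1)
  rw [← smul_eq_mul, ← map_smul]
  congr 1
  funext a
  rw [KU_apply]
  by_cases h : a = S
  · subst h; simp
  · simp [Pi.single_apply, h]

theorem KB_stab (g : ℕ → R) (s : ℕ) (Δ : R →+ R) (hΔ : ∀ j x, Δ (g j * x) = g j * Δ x) :
    ∀ i, ∀ v ∈ KB g s i, (fun S => Δ (v S)) ∈ KB g s i
  | 0, v, hv => by
    have hv : v = 0 := hv
    subst hv
    change _ = _
    funext S; simp
  | i + 1, v, ⟨w, hw⟩ => by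
    subst hw
    refine ⟨fun S => Δ (w S), ?_⟩
    funext b
    change ∑ a, Δ (w a) * KE g a b = Δ (∑ a, w a * KE g a b)
    rw [map_sum]
    refine Finset.sum_congr rfl fun a _ => ?_
    rw [mul_comm (w a), KE_comm Δ g hΔ, mul_comm]

theorem KB_trans (f : ℕ → R) (s i : ℕ) (t q : ℕ) (h : t ≤ q) (v)
    (hv : v ∈ KB (fun j => f j ^ t) s i) :
    (fun S => KW f S ^ (q - t) * v S) ∈ KB (fun j => f j ^ q) s i := by
  obtain ⟨l, rfl⟩ := kco_surj v
  rw [← cob_iff] at hv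
  have := (cob_iff _ _ _ _).1 (hv.pull (KU_cm f s h i))
  convert this using 1
  funext S
  exact (kco_KU f _ s i l S).symm
end

end

section
variable {R : Type} [CommRing R]

theorem lc_coord [IsNoetherianRing R] (f : ℕ → R) (s : ℕ) (I : Ideal R)
    (hI : I = Ideal.span {x | ∃ j < s, x = f j}) (i : ℕ)
    (z : (localCohomology I i).obj (ModuleCat.of R R)) :
    ∃ (t : ℕ) (w : KI s i → R),
      (∀ r : R, r • z = 0 → ∃ t', t ≤ t' ∧ (fun S => KW f S ^ (t' - t) * (r * w S)) ∈
        KB (fun j => f j ^ t') s i) ∧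
      (∀ (c : R) (q : ℕ), t ≤ q → (fun S => c * (KW f S ^ (q - t) * w S)) ∈
        KB (fun j => f j ^ q) s i → c • z = 0) := by
  have hf : ∀ j < s, f j ∈ I := fun j hj => by
    rw [hI]; exact Ideal.subset_span ⟨j, hj, rfl⟩
  obtain ⟨t, e, rfl⟩ := lcMk_surj I i _ z
  obtain ⟨φ, hφ, hrep⟩ := QRep_exists I i t e
  obtain ⟨τ, hτ, hτ0⟩ := tau_exists I f s hf t i
  have hcoord : ∀ (t' : ℕ) (r : R) (S), kco (((r • φ) ∘ₗ τ i) ∘ₗ KU f (t' - t) s i) S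
      = KW f S ^ (t' - t) * (r * kco (φ ∘ₗ τ i) S) := by
    intro t' r S
    refine (kco_KU f (t' - t) s i ((r • φ) ∘ₗ τ i) S).trans ?_
    rfl
  refine ⟨t, kco (φ ∘ₗ τ i), fun r hr => ?_, fun c q hq hc => ?_⟩
  · have h0 : lcMk I i (ModuleCat.of R R) t (r • e) = 0 := by
      rw [← hr]; exact map_smul (lcMk I i (ModuleCat.of R R) t).hom r e
    obtain ⟨t', ht, h1⟩ := lcMk_zero I i _ h0
    have h2 := ((hrep.smul r).nat ht).cob h1
    refine ⟨t', ht, ?_⟩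
    obtain ⟨τ', hτ', hτ'0⟩ := tau_exists I f s hf t' i
    have h3 := h2.pull hτ'
    have h4 := homotopy_cob_sub (KC_proj (fun j => f j ^ t') s) (fun n x => KD_comp _ s n x)
      (QC_ex I t) (Qe I t) (Qe_ker I t) (fun n => Qu I ht n ∘ₗ τ' n)
      (fun n => τ n ∘ₗ KU f (t' - t) s n) i ((Qu_cm I ht i).comp hτ')
      (hτ.comp (KU_cm f s ht i)) (by
        intro x
        change Qe I t (Qu I ht 0 (τ' 0 x)) = Qe I t (τ 0 (KU f (t' - t) s 0 x))
        rw [Qe_Qu, hτ'0]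
        refine Eq.trans ?_ (hτ0 _).symm
        exact congrArg (Ke I (fun j => f j ^ t) s t) (KU_deg_zero f (t' - t) s x).symm) (r • φ) (by intro x; simp [hφ]) h3
    have h5 := (cob_iff _ _ _ _).1 h4
    convert h5 using 1
    funext S
    exact (hcoord t' r S).symm
  · have h1 : Cob (KC (fun j => f j ^ q) s) i (((c • φ) ∘ₗ τ i) ∘ₗ KU f (q - t) s i) := by
      refine (cob_iff _ _ _ _).2 ?_
      convert hc using 1
      funext S
      refine (hcoord q c S).trans ?_
      ring
    obtain ⟨t', hqt, -, σ, hσ, hσ0⟩ := sigma_exists f s I hI i q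
    have ht : t ≤ t' := hq.trans hqt
    have h2 := h1.pull hσ
    have h4 := homotopy_cob_sub (QC_proj I t') (QC_dd I t')
      (QC_ex I t) (Qe I t) (Qe_ker I t) (fun n => τ n ∘ₗ KU f (q - t) s n ∘ₗ σ n)
      (fun n => Qu I ht n) i (hτ.comp ((KU_cm f s hq i).comp hσ)) (Qu_cm I ht i) (by
        intro x
        change Qe I t (τ 0 (KU f (q - t) s 0 (σ 0 x))) = Qe I t (Qu I ht 0 x)
        rw [Qe_Qu, ← hσ0]
        refine (hτ0 _).trans ?_
        exact congrArg (Ke I (fun j => f j ^ t) s t) (KU_deg_zero f (q - t) s (σ 0 x))) (c • φ) (by intro x; simp [hφ]) h2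
    have h5 := ((hrep.smul c).nat ht).zero h4
    have h6 := lcMk_tr I i (ModuleCat.of R R) ht (c • e)
    rw [h5] at h6
    have h7 : lcMk I i (ModuleCat.of R R) t (c • e) = c • lcMk I i (ModuleCat.of R R) t e :=
      map_smul (lcMk I i (ModuleCat.of R R) t).hom c e
    rw [← h7, ← h6]
    exact map_zero (lcMk I i (ModuleCat.of R R) t').hom

theorem common_level [IsNoetherianRing R] (P : Ideal R) (Q : ℕ → Submodule R R)
    (hm : ∀ t t', t ≤ t' → Q t ≤ Q t') (h : ∀ r ∈ P, ∃ t, r ∈ Q t) (t₁ : ℕ) :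
    ∃ t, t₁ ≤ t ∧ ∀ r ∈ P, r ∈ Q t := by
  obtain ⟨G, hG⟩ := (isNoetherian_def.1 (inferInstance : IsNoetherian R R)) P
  have hGP : ∀ g ∈ G, g ∈ P := fun g hg => hG ▸ Submodule.subset_span hg
  choose! T hT using h
  refine ⟨max t₁ (G.sup T), le_max_left _ _, fun r hr => ?_⟩
  have : P ≤ Q (max t₁ (G.sup T)) := by
    rw [← hG, Submodule.span_le]
    intro g hg
    exact hm _ _ ((Finset.le_sup (f := T) hg).trans (le_max_right _ _)) (hT g (hGP g hg))
  exact this hr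
end

set_option maxHeartbeats 1000000 in
theorem dim_quotient_associated_prime_localCohomology_ge
    (p : ℕ) (hp : p.Prime) (k : Type) [Field k] [CharP k p]
    (n s : ℕ) (f : Fin s → MvPolynomial (Fin n) k)
    (hdeg : ∑ j, (f j).totalDegree < n)
    (i : ℕ) (P : Ideal (MvPolynomial (Fin n) k))
    (hP : P ∈ associatedPrimes (MvPolynomial (Fin n) k)
      ((localCohomology (Ideal.span (Set.range f)) i).obj
        (ModuleCat.of (MvPolynomial (Fin n) k) (MvPolynomial (Fin n) k)))) :
    ((n - ∑ j, (f j).totalDegree : ℕ) : WithBot (WithTop ℕ)) ≤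
      ringKrullDim (MvPolynomial (Fin n) k ⧸ P) := by
  have hPp : P.IsPrime := hP.1
  obtain ⟨z, hz⟩ : ∃ z : (localCohomology (Ideal.span (Set.range f)) i).obj
      (ModuleCat.of (MvPolynomial (Fin n) k) (MvPolynomial (Fin n) k)), ∀ r, r ∈ P ↔ r • z = 0 := by
    obtain ⟨z, hz⟩ := ((isAssociatedPrime_iff_exists_injective_linearMap _ _).1 hP).2
    refine ⟨z (Ideal.Quotient.mk P 1), fun r => ?_⟩
    rw [← map_smul, map_eq_zero_iff _ hz, ← Ideal.Quotient.eq_zero_iff_mem]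
    have : r • (Ideal.Quotient.mk P 1) = Ideal.Quotient.mk P r := by
      rw [← Ideal.Quotient.mk_eq_mk, ← Submodule.Quotient.mk_smul, smul_eq_mul, mul_one]; rfl
    rw [this]
  obtain ⟨τ, Y, hτ, hY, Φ, hn, hdim, hΦ, G, hG⟩ := param_exists P
  by_cases hd : ∑ j, (f j).totalDegree < Fintype.card Y
  swap
  · refine le_trans ?_ hdim
    exact (Nat.cast_le (α := WithBot ℕ∞)).2
      (by omega : n - ∑ j, (f j).totalDegree ≤ Fintype.card τ)
  exfalso
  set F : ℕ → MvPolynomial (Fin n) k := fun j => if h : j < s then f ⟨j, h⟩ else 0 with hF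
  have hI : Ideal.span (Set.range f) = Ideal.span {x | ∃ j < s, x = F j} := by
    congr 1
    ext x
    constructor
    · rintro ⟨j, rfl⟩
      exact ⟨j, j.2, by simp [hF]⟩
    · rintro ⟨j, hj, rfl⟩
      exact ⟨⟨j, hj⟩, by simp [hF, hj]⟩
  obtain ⟨t, w, h1, h2⟩ := lc_coord F s _ hI i z
  have hdegF : ∑ j ∈ Finset.range s, (Φ (F j)).totalDegree ≤ ∑ j, (f j).totalDegree := by
    rw [Finset.sum_range]
    refine Finset.sum_le_sum fun j _ => ?_
    refine (hΦ _).trans (le_of_eq ?_)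
    simp [hF]
  let Q : ℕ → Submodule (MvPolynomial (Fin n) k) (MvPolynomial (Fin n) k) := fun t' =>
    (KB (fun j => F j ^ (t + t')) s i).comap
      (LinearMap.toSpanSingleton _ _ (fun S => KW F S ^ t' * w S))
  have hQ : ∀ t' r, r ∈ Q t' ↔ (fun S => r * (KW F S ^ t' * w S)) ∈
      KB (fun j => F j ^ (t + t')) s i := fun t' r => Iff.rfl
  obtain ⟨t₁, -, ht₁⟩ := common_level P Q (by
    intro a b hab r hr
    rw [hQ] at hr ⊢
    have := KB_trans F s i (t + a) (t + b) (by omega) _ hr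
    convert this using 1
    funext S
    rw [show t + b - (t + a) = b - a by omega, show b = (b - a) + a by omega, pow_add,
      Nat.add_sub_cancel]
    ring) (by
    intro r hr
    obtain ⟨t', ht', h⟩ := h1 r ((hz r).1 hr)
    refine ⟨t' - t, ?_⟩
    rw [hQ, Nat.add_sub_cancel' ht']
    convert h using 1
    funext S
    ring) 0
  have : Fact p.Prime := ⟨hp⟩
  obtain ⟨c, hc, q, hq, h⟩ := elem_key p Φ (fun t => KB (fun j => F j ^ t) s i) (KW F)
    (∑ j, (f j).totalDegree) hd
    (fun e Δ hΔ v hv => KB_stab _ s Δ (fun j x => hΔ _ _) i v hv)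
    (fun t q htq v hv => KB_trans F s i t q htq v hv)
    (fun S => (KW_degree Φ.toRingHom F S).trans hdegF) P G hG
    (fun S => KW F S ^ t₁ * w S) (t + t₁) (fun r hr => (hQ _ _).1 (ht₁ r hr))
  apply hc
  rw [hz]
  refine h2 c q (by omega) ?_
  convert h using 1
  funext S
  rw [← mul_assoc (KW F S ^ _) (KW F S ^ _), ← pow_add, show q - (t + t₁) + t₁ = q - t by omega]
end

section
/- Let $k$ be a field of characteristic $p > 0$, let $R = k[x_1,\dots,x_n]$ be the polynomial ring in $n$ variables over $k$, and let $I = (f_1,\dots,f_s)$ be an ideal of $R$ generated by polynomials $f_1,\dots,f_s$ with $\deg f_1 + \dots + \deg f_s < n$. Then for every $i$ and every maximal ideal $m$ of $R$, the zeroth local cohomology of the module $H^i_I(R)$ with support in $m$ vanishes: $H^0_m(H^i_I(R)) = 0$. -/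
/-- The zeroth local cohomology `H⁰_m(M)` of a module `M` with support in an ideal `m`,
i.e. the `m`-torsion submodule `{x ∈ M : mᵗ x = 0 for some t}`. -/
def zerothLocalCohomology {R : Type*} [CommRing R] (m : Ideal R)
    (M : Type*) [AddCommGroup M] [Module R M] : Submodule R M where
  carrier := {x | ∃ t : ℕ, ∀ r ∈ m ^ t, r • x = 0}
  zero_mem' := ⟨0, fun r _ => smul_zero r⟩
  add_mem' := by
    rintro x y ⟨t₁, h₁⟩ ⟨t₂, h₂⟩
    refine ⟨t₁ + t₂, fun r hr => ?_⟩
    rw [smul_add, h₁ r (Ideal.pow_le_pow_right (by omega) hr),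
      h₂ r (Ideal.pow_le_pow_right (by omega) hr), add_zero]
  smul_mem' := by
    rintro c x ⟨t, h⟩
    exact ⟨t, fun r hr => by rw [smul_comm, h r hr, smul_zero]⟩



namespace ZLC
open CategoryTheory Limits Opposite
section ExtInterface
variable {R : Type} [CommRing R]

lemma op_exact {A B C : (ModuleCat.{0} R)ᵒᵖ} (f : A ⟶ B) (g : B ⟶ C) (h : f ≫ g = 0)
    (hE : (ShortComplex.mk f g h).Exact) (x : B.unop) (hx : f.unop x = 0) :
    ∃ y : C.unop, g.unop y = x := by
  have := hE.unop
  rw [ShortComplex.moduleCat_exact_iff] at this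
  exact this x hx

variable (L : ChainComplex (ModuleCat.{0} R)ᵒᵖ ℕ) (n : ℕ)

lemma op_exists_opcycle (ζ : (L.X n).unop) (h : (L.d (n+1) n).unop ζ = 0) :
    ∃ w : (L.opcycles n).unop, (L.pOpcycles n).unop w = ζ :=
  op_exact _ _ (L.d_pOpcycles (n+1) n)
    (ShortComplex.exact_of_g_is_cokernel (.mk _ _ (L.d_pOpcycles (n+1) n)) (L.opcyclesIsCokernel (n+1) n (by simp))) ζ h

lemma op_opcycle_d (w : (L.opcycles n).unop) :
    (L.d (n+1) n).unop ((L.pOpcycles n).unop w) = 0 := by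
  have : (L.pOpcycles n).unop ≫ (L.d (n+1) n).unop = 0 := by
    rw [← unop_comp, L.d_pOpcycles]; rfl
  exact ConcreteCategory.congr_hom this w

lemma op_p_inj : Function.Injective (L.pOpcycles n).unop :=
  (ModuleCat.mono_iff_injective _).1 inferInstance

lemma op_ι_surj : Function.Surjective (L.homologyι n).unop :=
  (ModuleCat.epi_iff_surjective _).1 inferInstance

lemma op_ι_zero_iff (j : ℕ) (hj : (ComplexShape.down ℕ).next n = j) (w : (L.opcycles n).unop) :
    (L.homologyι n).unop w = 0 ↔ ∃ β : (L.X j).unop, (L.d n j).unop β = (L.pOpcycles n).unop w := by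
  have hp : ∀ β, (L.d n j).unop β = (L.pOpcycles n).unop ((L.fromOpcycles n j).unop β) := by
    intro β
    rw [← L.p_fromOpcycles]; rfl
  constructor
  · intro h
    obtain ⟨β, hβ⟩ := op_exact _ _ (L.homologyι_comp_fromOpcycles n j)
      (ShortComplex.exact_of_f_is_kernel (.mk _ _ (L.homologyι_comp_fromOpcycles n j)) (L.homologyIsKernel n j hj)) w h
    exact ⟨β, by rw [hp]; exact congrArg _ hβ⟩
  · rintro ⟨β, hβ⟩
    rw [hp] at hβ
    rw [← op_p_inj L n hβ]
    have : (L.fromOpcycles n j).unop ≫ (L.homologyι n).unop = 0 := by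
      rw [← unop_comp, L.homologyι_comp_fromOpcycles]; rfl
    exact ConcreteCategory.congr_hom this β

variable (N : ModuleCat.{0} R)

/-- The functor `Hom(-, N)` as used in `Ext`. -/
noncomputable abbrev homF : ModuleCat.{0} R ⥤ (ModuleCat.{0} R)ᵒᵖ :=
  ((linearYoneda R (ModuleCat.{0} R)).obj N).rightOp

noncomputable abbrev homC (K : ChainComplex (ModuleCat.{0} R) ℕ) :
    ChainComplex (ModuleCat.{0} R)ᵒᵖ ℕ :=
  ((homF N).mapHomologicalComplex _).obj K

/-- `ζ` is a cocycle representing the Ext class `x`. -/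
def ExtRep {X : ModuleCat.{0} R} (P : ProjectiveResolution X) (ζ : P.complex.X n ⟶ N)
    (x : ((Ext R (ModuleCat.{0} R) n).obj (op X)).obj N) : Prop :=
  ∃ w : ((homC N P.complex).opcycles n).unop,
    ((homC N P.complex).pOpcycles n).unop w = ζ ∧
    (P.isoLeftDerivedObj (homF N) n).hom.unop (((homC N P.complex).homologyι n).unop w) = x

variable {N n}
variable {X : ModuleCat.{0} R} {P : ProjectiveResolution X}

lemma iso_unop_bij : Function.Bijective (P.isoLeftDerivedObj (homF N) n).hom.unop :=
  ConcreteCategory.bijective_of_isIso (P.isoLeftDerivedObj (homF N) n).hom.unop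

lemma ExtRep.exists (x : ((Ext R (ModuleCat.{0} R) n).obj (op X)).obj N) :
    ∃ ζ, ExtRep n N P ζ x := by
  obtain ⟨y, rfl⟩ := (iso_unop_bij (P := P)).2 x
  obtain ⟨w, rfl⟩ := op_ι_surj _ _ y
  exact ⟨_, w, rfl, rfl⟩

lemma ExtRep.d_comp {ζ : P.complex.X n ⟶ N} {x} (h : ExtRep n N P ζ x) :
    P.complex.d (n+1) n ≫ ζ = 0 := by
  obtain ⟨w, rfl, rfl⟩ := h
  exact op_opcycle_d _ _ w

lemma ExtRep.smul {ζ : P.complex.X n ⟶ N} {x} (h : ExtRep n N P ζ x) (r : R) :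
    ExtRep n N P (r • ζ) (r • x) := by
  obtain ⟨w, rfl, rfl⟩ := h
  refine ⟨r • w, ?_, ?_⟩
  · exact map_smul ((homC N P.complex).pOpcycles n).unop.hom r w
  · rw [map_smul]; exact map_smul _ _ _

lemma ExtRep.eq_zero_iff {ζ : P.complex.X n ⟶ N} {x} (h : ExtRep n N P ζ x) 
    (j : ℕ) (hj : (ComplexShape.down ℕ).next n = j) :
    x = 0 ↔ ∃ β : P.complex.X j ⟶ N, ζ = P.complex.d n j ≫ β := by
  obtain ⟨w, rfl, rfl⟩ := h
  have := op_ι_zero_iff (homC N P.complex) n j hj w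
  constructor
  · intro hx
    have h2 := (iso_unop_bij (P := P)).1 (hx.trans (map_zero (P.isoLeftDerivedObj (homF N) n).hom.unop.hom).symm)
    obtain ⟨β, hβ⟩ := this.1 h2
    exact ⟨β, hβ.symm⟩
  · rintro ⟨β, hβ⟩
    have := this.2 ⟨β, hβ.symm⟩
    exact (congrArg _ this).trans (map_zero (P.isoLeftDerivedObj (homF N) n).hom.unop.hom)

lemma ExtRep.map {Y : ModuleCat.{0} R} {Q : ProjectiveResolution Y} (g : X ⟶ Y)
    (φ : P.complex ⟶ Q.complex) (comm : φ.f 0 ≫ Q.π.f 0 = P.π.f 0 ≫ g)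
    {ζ : Q.complex.X n ⟶ N} {y} (h : ExtRep n N Q ζ y) :
    ExtRep n N P (φ.f n ≫ ζ) ((((Ext R (ModuleCat.{0} R) n).map g.op).app N) y) := by
  obtain ⟨w, rfl, rfl⟩ := h
  let Φ := ((homF N).mapHomologicalComplex (ComplexShape.down ℕ)).map φ
  refine ⟨(HomologicalComplex.opcyclesMap Φ n).unop w, ?_, ?_⟩
  · have := HomologicalComplex.p_opcyclesMap Φ n
    exact (ConcreteCategory.congr_hom (congrArg Quiver.Hom.unop this) w)
  · have h1 := HomologicalComplex.homologyι_naturality Φ n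
    have h2 := ProjectiveResolution.isoLeftDerivedObj_hom_naturality g P Q φ comm (homF N) n
    have h1' := ConcreteCategory.congr_hom (congrArg Quiver.Hom.unop h1) w
    have h2' := ConcreteCategory.congr_hom (congrArg Quiver.Hom.unop h2) (((homC N Q.complex).homologyι n).unop w)
    refine Eq.trans ?_ h2'.symm
    exact congrArg _ h1'.symm
end ExtInterface

section LC
variable {R : Type} [CommRing R] (I : Ideal R) (i : ℕ) (N : ModuleCat.{0} R)

/-- The module `R / I ^ t`. -/
noncomputable abbrev Q (t : ℕ) : ModuleCat.{0} R := ModuleCat.of R (R ⧸ I ^ t)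

/-- The canonical projection. -/
noncomputable abbrev proj {t t' : ℕ} (h : t ≤ t') : Q I t' ⟶ Q I t :=
  (localCohomology.ringModIdeals (localCohomology.idealPowersDiagram I)).map (homOfLE h).op

noncomputable abbrev PR (t : ℕ) : ProjectiveResolution (Q I t) := projectiveResolution _

noncomputable abbrev LC : ModuleCat.{0} R := (localCohomology I i).obj N

noncomputable def lcCocone : Cocone (localCohomology.diagram (localCohomology.idealPowersDiagram I) i ⋙
    (evaluation _ _).obj N) :=
  ((evaluation _ _).obj N).mapCocone
    (colimit.cocone (localCohomology.diagram (localCohomology.idealPowersDiagram I) i))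

noncomputable def lcIsColimit : IsColimit (lcCocone I i N) :=
  isColimitOfPreserves ((evaluation _ _).obj N)
    (colimit.isColimit (localCohomology.diagram (localCohomology.idealPowersDiagram I) i))

noncomputable def lcι (t : ℕ) : ((Ext R (ModuleCat.{0} R) i).obj (op (Q I t))).obj N ⟶ LC I i N :=
  (lcCocone I i N).ι.app (op (op t))

variable {I i N}

lemma lc_exists (z : LC I i N) : ∃ t x, lcι I i N t x = z := by
  obtain ⟨t, x, h⟩ := Concrete.isColimit_exists_rep _ (lcIsColimit I i N) z
  exact ⟨t.unop.unop, x, h⟩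

lemma lc_zero_iff (t : ℕ) (x) : lcι I i N t x = 0 ↔ ∃ (t' : ℕ) (h : t ≤ t'),
    ((Ext R (ModuleCat.{0} R) i).map (proj I h).op).app N x = 0 := by
  constructor
  · intro h
    have h' : (lcCocone I i N).ι.app (op (op t)) x = (lcCocone I i N).ι.app (op (op t)) 0 :=
      h.trans (map_zero (lcι I i N t).hom).symm
    obtain ⟨k, f, g, hfg⟩ := Concrete.isColimit_exists_of_rep_eq _ (lcIsColimit I i N) _ _ h'
    refine ⟨k.unop.unop, f.unop.unop.down.down, ?_⟩
    refine hfg.trans ?_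
    exact map_zero (((localCohomology.diagram (localCohomology.idealPowersDiagram I) i ⋙
    (evaluation _ _).obj N).map g).hom)
  · rintro ⟨t', h, hx⟩
    have := (lcCocone I i N).w ((homOfLE h).op.op : op (op t) ⟶ op (op t'))
    refine (ConcreteCategory.congr_hom this.symm x).trans ?_
    refine (congrArg (lcι I i N t') hx).trans ?_
    exact map_zero (lcι I i N t').hom

/-- `ζ` represents `z`. -/
def LCRep (t : ℕ) (ζ : (PR I t).complex.X i ⟶ N) (z : LC I i N) : Prop :=
  ∃ x, ExtRep i N (PR I t) ζ x ∧ lcι I i N t x = z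

lemma LCRep.exists (z : LC I i N) : ∃ t ζ, LCRep t ζ z := by
  obtain ⟨t, x, rfl⟩ := lc_exists z
  obtain ⟨ζ, h⟩ := ExtRep.exists (P := PR I t) x
  exact ⟨t, ζ, x, h, rfl⟩

lemma LCRep.d_comp {t : ℕ} {ζ : (PR I t).complex.X i ⟶ N} {z} (h : LCRep t ζ z) :
    (PR I t).complex.d (i+1) i ≫ ζ = 0 := by
  obtain ⟨x, hx, rfl⟩ := h
  exact hx.d_comp

lemma LCRep.smul {t : ℕ} {ζ : (PR I t).complex.X i ⟶ N} {z} (h : LCRep t ζ z) (r : R) :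
    LCRep t (r • ζ) (r • z) := by
  obtain ⟨x, hx, rfl⟩ := h
  exact ⟨r • x, hx.smul r, map_smul (lcι I i N t).hom r x⟩

lemma LCRep.zero_iff {t : ℕ} {ζ : (PR I t).complex.X i ⟶ N} {z} (h : LCRep t ζ z)
    (j : ℕ) (hj : (ComplexShape.down ℕ).next i = j) :
    z = 0 ↔ ∃ (t' : ℕ) (h : t ≤ t') (β : (PR I t').complex.X j ⟶ N),
      (ProjectiveResolution.lift (proj I h) (PR I t') (PR I t)).f i ≫ ζ =
        (PR I t').complex.d i j ≫ β := by
  obtain ⟨x, hx, rfl⟩ := h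
  rw [lc_zero_iff]
  refine exists_congr fun t' => exists_congr fun h => ?_
  exact (hx.map (proj I h) (ProjectiveResolution.lift (proj I h) (PR I t') (PR I t))
    (ProjectiveResolution.lift_commutes_zero _ _ _)).eq_zero_iff j hj
end LC

section HomAlg
variable {R : Type} [CommRing R]

/-- An augmented chain complex, with explicit linear maps. -/
structure Cx (R : Type) [CommRing R] (M : Type) [AddCommGroup M] [Module R M] where
  X : ℕ → ModuleCat.{0} R
  d : ∀ n, X (n+1) →ₗ[R] X n
  ε : X 0 →ₗ[R] M
  d_d : ∀ n c, d n (d (n+1) c) = 0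
  ε_d : ∀ c, ε (d 0 c) = 0

variable {M M' M'' : Type} [AddCommGroup M] [Module R M] [AddCommGroup M'] [Module R M']
  [AddCommGroup M''] [Module R M'']
variable {A : Cx R M} {B : Cx R M'} {C : Cx R M''}

/-- Cycles in degree `j`. -/
def Cx.IsCyc (A : Cx R M) : ∀ j, A.X j → Prop
  | 0, c => A.ε c = 0
  | j+1, c => A.d j c = 0

lemma Cx.isCyc_d (A : Cx R M) (j : ℕ) (c) : A.IsCyc j (A.d j c) := by
  cases j with
  | zero => exact A.ε_d c
  | succ j => exact A.d_d j c

/-- The map `μ` is the degree `j` part of a truncated chain map over `φ`. -/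
def Lifts (A : Cx R M) (B : Cx R M') (φ : M →ₗ[R] M') : ∀ j, (A.X j →ₗ[R] B.X j) → Prop
  | 0, μ => ∀ c, B.ε (μ c) = φ (A.ε c)
  | j+1, μ => ∃ ν, Lifts A B φ j ν ∧ ∀ c, B.d j (μ c) = ν (A.d j c)

/-- Coboundaries. -/
def Cx.IsCob (A : Cx R M) (N : Type) [AddCommGroup N] [Module R N] : ∀ j, (A.X j →ₗ[R] N) → Prop
  | 0, ζ => ζ = 0
  | j+1, ζ => ∃ β : A.X j →ₗ[R] N, ζ = β ∘ₗ A.d j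

structure Cx.Exact (A : Cx R M) : Prop where
  surj : Function.Surjective A.ε
  ex : ∀ j c, A.IsCyc j c → ∃ b, A.d j b = c

variable {N : Type} [AddCommGroup N] [Module R N]

lemma Cx.IsCob.add {j : ℕ} {ζ ξ : A.X j →ₗ[R] N} (h : A.IsCob N j ζ) (h' : A.IsCob N j ξ) :
    A.IsCob N j (ζ + ξ) := by
  cases j with
  | zero =>
    change ζ + ξ = 0
    rw [show ζ = 0 from h, show ξ = 0 from h', add_zero]
  | succ j =>
    obtain ⟨a, rfl⟩ := h
    obtain ⟨b, rfl⟩ := h'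
    exact ⟨a + b, by rw [LinearMap.add_comp]⟩

lemma Lifts.comp {φ : M →ₗ[R] M'} {ψ : M' →ₗ[R] M''} {j : ℕ} {μ : A.X j →ₗ[R] B.X j}
    {ν : B.X j →ₗ[R] C.X j} (hμ : Lifts A B φ j μ) (hν : Lifts B C ψ j ν) :
    Lifts A C (ψ ∘ₗ φ) j (ν ∘ₗ μ) := by
  induction j with
  | zero => intro c; simp [hν (μ c), hμ c]
  | succ j ih =>
    obtain ⟨μ', h1, h2⟩ := hμ
    obtain ⟨ν', h3, h4⟩ := hν
    exact ⟨ν' ∘ₗ μ', ih h1 h3, fun c => by simp [h2, h4]⟩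

lemma Lifts.sub {φ : M →ₗ[R] M'} {j : ℕ} {μ ν : A.X j →ₗ[R] B.X j}
    (hμ : Lifts A B φ j μ) (hν : Lifts A B φ j ν) :
    Lifts A B 0 j (μ - ν) := by
  induction j with
  | zero => intro c; simp [hν c, hμ c]
  | succ j ih =>
    obtain ⟨μ', h1, h2⟩ := hμ
    obtain ⟨ν', h3, h4⟩ := hν
    exact ⟨μ' - ν', ih h1 h3, fun c => by simp [h2, h4]⟩

lemma Lifts.isCob {φ : M →ₗ[R] M'} {j : ℕ} {μ : A.X j →ₗ[R] B.X j}
    (hμ : Lifts A B φ j μ) {ζ : B.X j →ₗ[R] N} (h : B.IsCob N j ζ) : A.IsCob N j (ζ ∘ₗ μ) := by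
  cases j with
  | zero =>
    change ζ ∘ₗ μ = 0
    rw [show ζ = 0 from h, LinearMap.zero_comp]
  | succ j =>
    obtain ⟨ν, -, h2⟩ := hμ
    obtain ⟨β, rfl⟩ := h
    refine ⟨β ∘ₗ ν, ?_⟩
    ext c
    simp [h2]

lemma lift_range {P X Y : Type} [AddCommGroup P] [Module R P] [AddCommGroup X] [Module R X]
    [AddCommGroup Y] [Module R Y] [Module.Projective R P] (f : P →ₗ[R] Y) (g : X →ₗ[R] Y)
    (h : ∀ c, ∃ b, g b = f c) : ∃ l : P →ₗ[R] X, ∀ c, g (l c) = f c := by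
  obtain ⟨l, hl⟩ := Module.projective_lifting_property g.rangeRestrict
    (f.codRestrict (LinearMap.range g) (fun c => h c)) g.surjective_rangeRestrict
  exact ⟨l, fun c => congrArg Subtype.val (LinearMap.congr_fun hl c)⟩

lemma Lifts.isCyc {φ : M →ₗ[R] M'} {j : ℕ} {μ : A.X j →ₗ[R] B.X j}
    (hμ : Lifts A B φ j μ) (c) : B.IsCyc j (μ (A.d j c)) := by
  cases j with
  | zero =>
    change B.ε _ = 0
    rw [hμ, A.ε_d, map_zero]
  | succ j =>
    obtain ⟨ν, -, h2⟩ := hμ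
    change B.d j _ = 0
    rw [h2, A.d_d, map_zero]

lemma Lifts.exists (hA : ∀ j, Module.Projective R (A.X j)) (hB : B.Exact) (φ : M →ₗ[R] M') (j : ℕ) :
    ∃ μ, Lifts A B φ j μ := by
  induction j with
  | zero =>
    have := hA 0
    obtain ⟨l, hl⟩ := lift_range (φ ∘ₗ A.ε) B.ε (fun c => hB.surj _)
    exact ⟨l, hl⟩
  | succ j ih =>
    obtain ⟨ν, hν⟩ := ih
    have := hA (j+1)
    obtain ⟨l, hl⟩ := lift_range (ν ∘ₗ A.d j) (B.d j) (fun c => hB.ex _ _ (hν.isCyc c))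
    exact ⟨l, ν, hν, hl⟩

/-- Null-homotopic in degree `j`. -/
def NullHt (A : Cx R M) (B : Cx R M') : ∀ j, (A.X j →ₗ[R] B.X j) → (A.X j →ₗ[R] B.X (j+1)) → Prop
  | 0, μ, h => ∀ c, μ c = B.d 0 (h c)
  | j+1, μ, h => ∃ h' : A.X j →ₗ[R] B.X (j+1), ∀ c, μ c = B.d (j+1) (h c) + h' (A.d j c)

lemma NullHt.d {j : ℕ} {μ : A.X j →ₗ[R] B.X j} {h} (H : NullHt A B j μ h) (c) :
    μ (A.d j c) = B.d j (h (A.d j c)) := by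
  cases j with
  | zero => exact H _
  | succ j =>
    obtain ⟨h', H⟩ := H
    rw [H, A.d_d, map_zero, add_zero]

lemma Lifts.null (hA : ∀ j, Module.Projective R (A.X j)) (hB : B.Exact) {j : ℕ}
    {μ : A.X j →ₗ[R] B.X j} (hμ : Lifts A B 0 j μ) : ∃ h, NullHt A B j μ h := by
  induction j with
  | zero =>
    have := hA 0
    obtain ⟨l, hl⟩ := lift_range μ (B.d 0) (fun c => hB.ex _ _ (by
      change B.ε _ = 0
      rw [hμ]; rfl))
    exact ⟨l, fun c => (hl c).symm⟩
  | succ j ih =>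
    obtain ⟨ν, hν, h2⟩ := hμ
    obtain ⟨h', H⟩ := ih hν
    have := hA (j+1)
    obtain ⟨l, hl⟩ := lift_range (μ - h' ∘ₗ A.d j) (B.d (j+1)) (fun c => hB.ex _ _ (by
      change B.d j _ = 0
      simp [h2, H.d]))
    refine ⟨l, h', fun c => ?_⟩
    rw [hl]; simp

lemma Lifts.isCob_sub (hA : ∀ j, Module.Projective R (A.X j)) (hB : B.Exact) {j : ℕ}
    {φ : M →ₗ[R] M'} {μ ν : A.X j →ₗ[R] B.X j} (hμ : Lifts A B φ j μ) (hν : Lifts A B φ j ν)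
    {ζ : B.X j →ₗ[R] N} (hζ : ∀ c, ζ (B.d j c) = 0) : A.IsCob N j (ζ ∘ₗ μ - ζ ∘ₗ ν) := by
  obtain ⟨h, H⟩ := (hμ.sub hν).null hA hB
  cases j with
  | zero =>
    change _ = 0
    ext c
    have := H c
    simp only [LinearMap.sub_apply] at this
    simp [← map_sub, this, hζ]
  | succ j =>
    obtain ⟨h', H⟩ := H
    refine ⟨ζ ∘ₗ h', ?_⟩
    ext c
    have := H c
    simp only [LinearMap.sub_apply] at this
    simp [← map_sub, this, hζ]

/-- Lifting into a pro-exact tower. -/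
lemma Lifts.exists_pro {M : ℕ → Type} [∀ t, AddCommGroup (M t)] [∀ t, Module R (M t)]
    (φ : ∀ {t t' : ℕ}, t ≤ t' → (M t' →ₗ[R] M t))
    (hφ : ∀ {t t' t'' : ℕ} (h : t ≤ t') (h' : t' ≤ t''), φ h ∘ₗ φ h' = φ (h.trans h'))
    (A K : ∀ t, Cx R (M t)) (hA : ∀ t j, Module.Projective R ((A t).X j))
    (u : ∀ {t t' : ℕ}, t ≤ t' → ∀ j, (K t').X j →ₗ[R] (K t).X j)
    (hu : ∀ {t t' : ℕ} (h : t ≤ t') j, Lifts (K t') (K t) (φ h) j (u h j))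
    (hK0 : ∀ t, Function.Surjective (K t).ε)
    (hK : ∀ j t, ∃ (T : ℕ) (h : t ≤ T), ∀ c, (K T).IsCyc j c → ∃ b, (K t).d j b = u h j c)
    (j t : ℕ) : ∃ (T : ℕ) (h : t ≤ T) (μ : (A T).X j →ₗ[R] (K t).X j),
      Lifts (A T) (K t) (φ h) j μ := by
  induction j generalizing t with
  | zero =>
    have := hA t 0
    obtain ⟨l, hl⟩ := lift_range (φ le_rfl ∘ₗ (A t).ε) (K t).ε (fun c => hK0 t _)
    exact ⟨t, le_rfl, l, hl⟩
  | succ j ih =>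
    obtain ⟨t1, h1, H1⟩ := hK j t
    obtain ⟨T, h2, ν, hν⟩ := ih t1
    have := hA T (j+1)
    obtain ⟨l, hl⟩ := lift_range (u h1 j ∘ₗ ν ∘ₗ (A T).d j) ((K t).d j) (fun c => H1 _ (hν.isCyc c))
    refine ⟨T, h1.trans h2, l, u h1 j ∘ₗ ν, ?_, hl⟩
    rw [← hφ h1 h2]
    exact hν.comp (hu h1 j)

end HomAlg

section Koszul

/-- Index set for the Koszul complex: subsets of size `j` of a set with `s` elements. -/
inductive Idx : ℕ → ℕ → Type
  | nil : Idx 0 0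
  | skip {s j : ℕ} : Idx s j → Idx (s+1) j
  | take {s j : ℕ} : Idx s j → Idx (s+1) (j+1)

instance Idx.finite : ∀ s j, Finite (Idx s j) := by
  intro s
  induction s with
  | zero =>
    intro j
    have : Subsingleton (Idx 0 j) := ⟨by rintro ⟨⟩ ⟨⟩; rfl⟩
    infer_instance
  | succ s ih =>
    intro j
    cases j with
    | zero =>
      exact Finite.of_surjective (fun a : Idx s 0 => a.skip) (by rintro ⟨a⟩; exact ⟨_, rfl⟩)
    | succ j =>
      refine Finite.of_surjective
        (fun a : Idx s (j+1) ⊕ Idx s j => Sum.elim Idx.skip Idx.take a) ?_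
      rintro (_ | a | a)
      · exact ⟨Sum.inl a, rfl⟩
      · exact ⟨Sum.inr a, rfl⟩

variable {R : Type} [CommRing R]

/-- Koszul differential. -/
def kd0 (g : ℕ → R) : ∀ {s j : ℕ}, Idx s j → (Idx s (j+1) → R) → R
  | _, _, .nil => fun _ => 0
  | _, _, .skip (s := s) (j := j) a => fun c =>
      kd0 g a (fun b => c (.skip b)) + (-1) ^ j * g s * c (.take a)
  | _, _, .take a => fun c => kd0 g a (fun b => c (.take b))

/-- Koszul differential. -/
def kd (g : ℕ → R) {s j : ℕ} (c : Idx s (j+1) → R) (a : Idx s j) : R := kd0 g a c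

lemma kd_add (g : ℕ → R) {s j : ℕ} (c c' : Idx s (j+1) → R) (a : Idx s j) :
    kd g (c + c') a = kd g c a + kd g c' a := by
  induction a with
  | nil => simp [kd, kd0]
  | skip a ih =>
    have := ih (fun b => c (.skip b)) (fun b => c' (.skip b))
    simp only [kd, kd0] at this ⊢
    rw [show (fun b => (c + c') (Idx.skip b)) =
      (fun b => c (.skip b)) + (fun b => c' (.skip b)) from rfl, this]
    simp; ring
  | take a ih => exact ih (fun b => c (.take b)) (fun b => c' (.take b))

lemma kd_smul (g : ℕ → R) {s j : ℕ} (r : R) (c : Idx s (j+1) → R) (a : Idx s j) :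
    kd g (r • c) a = r * kd g c a := by
  induction a with
  | nil => simp [kd, kd0]
  | skip a ih =>
    have := ih (fun b => c (.skip b))
    simp only [kd, kd0] at this ⊢
    rw [show (fun b => (r • c) (Idx.skip b)) = r • (fun b => c (.skip b)) from rfl, this]
    simp; ring
  | take a ih => exact ih (fun b => c (.take b))

/-- The linear Koszul differential. -/
def kdl (g : ℕ → R) (s j : ℕ) : (Idx s (j+1) → R) →ₗ[R] (Idx s j → R) where
  toFun := kd g
  map_add' c c' := by ext a; exact kd_add g c c' a
  map_smul' r c := by ext a; exact kd_smul g r c a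

lemma kdl_skip (g : ℕ → R) (s j : ℕ) (c) (a : Idx s j) : kdl g (s+1) j c a.skip =
  kdl g s j (fun b => c (.skip b)) a + (-1) ^ j * g s * c (.take a) := rfl

lemma kdl_take (g : ℕ → R) (s j : ℕ) (c) (a : Idx s j) : kdl g (s+1) (j+1) c a.take =
  kdl g s j (fun b => c (.take b)) a := rfl

lemma kdl_kdl (g : ℕ → R) (s j : ℕ) (c : Idx s (j+1+1) → R) : kdl g s j (kdl g s (j+1) c) = 0 := by
  ext a
  induction a with
  | nil => rfl
  | @skip s j a ih =>
    rw [kdl_skip]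
    have : (fun b : Idx s (j+1) => kdl g (s+1) (j+1) c b.skip) =
      kdl g s (j+1) (fun b => c b.skip) + ((-1)^(j+1) * g s) • (fun b => c b.take) := by
      ext b; rw [kdl_skip]; simp
    rw [this, map_add, map_smul, Pi.add_apply, ih, kdl_take]
    simp [pow_succ]
  | take a ih => exact ih _

/-- The weights of the transition maps. -/
def kw (h : ℕ → R) : ∀ {s j : ℕ}, Idx s j → R
  | _, _, .nil => 1
  | _, _, .skip a => kw h a
  | _, _, .take (s := s) a => h s * kw h a

/-- The transition maps. -/
def ku (h : ℕ → R) (s j : ℕ) : (Idx s j → R) →ₗ[R] (Idx s j → R) :=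
  LinearMap.pi fun a => kw h a • LinearMap.proj a

lemma ku_apply (h : ℕ → R) (s j : ℕ) (c : Idx s j → R) (a) : ku h s j c a = kw h a * c a := rfl

lemma kdl_ku (g g' h : ℕ → R) (hg : ∀ l, g l * h l = g' l) (s j : ℕ) (c : Idx s (j+1) → R) :
    kdl g s j (ku h s (j+1) c) = ku h s j (kdl g' s j c) := by
  ext a
  induction a with
  | nil => exact (mul_zero _).symm
  | @skip s j a ih =>
    rw [kdl_skip, ku_apply h (s+1) j, kdl_skip, mul_add]
    have := ih (fun b => c b.skip)
    rw [ku_apply] at this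
    rw [show kw h (Idx.skip a) = kw h a from rfl, ← this]
    congr 1
    rw [ku_apply, show kw h (Idx.take a) = h s * kw h a from rfl, ← hg]
    ring
  | @take s j a ih =>
    have := ih (fun b => c b.take)
    rw [ku_apply] at this
    have e : (fun b : Idx s (j+1) => ku h (s+1) (j+1+1) c b.take) =
        h s • ku h s (j+1) (fun b => c b.take) := by
      funext b
      change h s * kw h b * c b.take = h s * (kw h b * c b.take)
      ring
    rw [kdl_take, ku_apply, kdl_take, show kw h (Idx.take a) = h s * kw h a from rfl,
      mul_assoc, ← this, e, map_smul]
    rfl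

lemma kw_zero (h : ℕ → R) {s : ℕ} (a : Idx s 0) : kw h a = 1 := by
  induction s with
  | zero => cases a; rfl
  | succ s ih => cases a with | skip a => exact ih a

/-- the unique index in degree zero -/
def Idx.bot : ∀ s, Idx s 0
  | 0 => .nil
  | s+1 => .skip (Idx.bot s)

lemma Idx.eq_bot {s : ℕ} (a : Idx s 0) : a = Idx.bot s := by
  induction s with
  | zero => cases a; rfl
  | succ s ih => cases a with | skip a => rw [ih a]; rfl

lemma kw_pow_trans (f : ℕ → R) {s j : ℕ} (x y : ℕ) (a : Idx s j) :
    kw (fun l => f l ^ x) a * kw (fun l => f l ^ y) a = kw (fun l => f l ^ (x + y)) a := by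
  induction a with
  | nil => simp [kw]
  | skip a ih => exact ih
  | take a ih => simp only [kw]; rw [← ih]; ring

/-- pro-exactness in positive degrees -/
lemma kos_pro [IsNoetherianRing R] (f : ℕ → R) (s j t : ℕ) : ∃ T, t ≤ T ∧
    ∀ c : Idx s (j+1) → R, kdl (fun l => f l ^ T) s j c = 0 →
      ∃ b, kdl (fun l => f l ^ t) s (j+1) b = ku (fun l => f l ^ (T - t)) s (j+1) c := by
  induction s generalizing j t with
  | zero =>
    refine ⟨t, le_rfl, fun c _ => ⟨0, ?_⟩⟩
    ext a; cases a
  | succ s ih =>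
    obtain ⟨t1, ht1, H1⟩ := ih j t
    have step : ∃ T, t1 ≤ T ∧ ∀ (a : Idx s (j+1) → R) (b : Idx s j → R),
        kdl (fun l => f l ^ T) (s+1) j
          (fun x => match x with | .skip x => a x | .take x => b x) = 0 →
        ∃ b', kdl (fun l => f l ^ t1) s j b' = 
          f s ^ (T - t1) • ku (fun l => f l ^ (T - t1)) s j b := by
      cases j with
      | succ j =>
        obtain ⟨T, hT, H⟩ := ih j t1
        refine ⟨T, hT, fun a b hab => ?_⟩
        obtain ⟨b', hb'⟩ := H b (by
          ext x
          exact congrFun hab x.take)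
        exact ⟨f s ^ (T - t1) • b', by rw [map_smul, hb']⟩
      | zero =>
        let W := LinearMap.range (kdl (fun l => f l ^ t1) s 0)
        let F : ℕ →o Submodule R (Idx s 0 → R) :=
          ⟨fun e => W.comap (LinearMap.lsmul R _ (f s ^ e)), by
            refine monotone_nat_of_le_succ fun e x hx => ?_
            simp only [Submodule.mem_comap, LinearMap.lsmul_apply] at hx ⊢
            rw [pow_succ', mul_smul]
            exact W.smul_mem _ hx⟩
        obtain ⟨e, he⟩ := monotone_stabilizes_iff_noetherian.2 (inferInstance : IsNoetherian R (Idx s 0 → R)) F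
        refine ⟨t1 + e, by omega, fun a b hab => ?_⟩
        have h1 : b ∈ F (t1 + e) := by
          change f s ^ (t1 + e) • b ∈ W
          refine ⟨- ku (fun l => f l ^ e) s 1 a, ?_⟩
          rw [map_neg, kdl_ku (fun l => f l ^ t1) (fun l => f l ^ (t1 + e)) _ (fun l => by ring)]
          ext x
          have := congrFun hab x.skip
          rw [kdl_skip] at this
          simp only [pow_zero, one_mul, Pi.zero_apply] at this
          simp only [Pi.neg_apply, ku_apply, kw_zero, one_mul, Pi.smul_apply, smul_eq_mul]
          linear_combination -this
        rw [← he _ (by omega)] at h1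
        obtain ⟨b', hb'⟩ := h1
        refine ⟨b', hb'.trans ?_⟩
        ext x
        simp [ku_apply, kw_zero]
    obtain ⟨T, hT, H⟩ := step
    refine ⟨T, ht1.trans hT, fun c hc => ?_⟩
    have hcs : (fun x : Idx (s+1) (j+1) => match x with
        | .skip x => (fun y => c (.skip y)) x | .take x => (fun y => c (.take y)) x) = c := by
      ext x; cases x <;> rfl
    obtain ⟨b', hb'⟩ := H (fun y => c (.skip y)) (fun y => c (.take y)) (by rw [hcs]; exact hc)
    let c1 := ku (fun l => f l ^ (T - t1)) (s+1) (j+1) c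
    have hc1 : kdl (fun l => f l ^ t1) (s+1) j c1 = 0 := by
      rw [kdl_ku _ (fun l => f l ^ T) _ (fun l => by rw [← pow_add]; congr 1; omega), hc, map_zero]
    let a1 : Idx s (j+1) → R := (fun y => c1 (.skip y)) - ((-1)^(j+1) * f s ^ t1) • b'
    have ha1 : kdl (fun l => f l ^ t1) s j a1 = 0 := by
      ext x
      have h1 := congrFun hc1 x.skip
      rw [kdl_skip] at h1
      have h2 := congrFun hb' x
      rw [map_sub, map_smul, Pi.sub_apply, Pi.smul_apply, h2]
      have h3 : c1 x.take = f s ^ (T - t1) * (kw (fun l => f l ^ (T - t1)) x * c x.take) := by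
        simp only [c1, ku_apply, kw]; ring
      rw [h3] at h1
      simp only [Pi.smul_apply, smul_eq_mul, ku_apply, Pi.zero_apply] at h1 ⊢
      linear_combination h1
    obtain ⟨a2, ha2⟩ := H1 a1 ha1
    refine ⟨fun x => match x with
      | .skip x => a2 x
      | .take x => f s ^ (t1 - t) * ku (fun l => f l ^ (t1 - t)) s _ b' x, ?_⟩
    have hsplit : f s ^ t * f s ^ (t1 - t) = f s ^ t1 := by
      rw [← pow_add]; congr 1; omega
    have hTT : T - t1 + (t1 - t) = T - t := by omega
    have hkw : ∀ {s j : ℕ} (x : Idx s j), kw (fun l => f l ^ (t1 - t)) x * kw (fun l => f l ^ (T - t1)) x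
        = kw (fun l => f l ^ (T - t)) x := fun x => by
      rw [mul_comm, kw_pow_trans, hTT]
    ext x
    cases x with
    | skip x =>
      rw [kdl_skip]
      have := congrFun ha2 x
      simp only [this, ku_apply, a1, Pi.sub_apply, Pi.smul_apply, smul_eq_mul, c1]
      rw [show kw (fun l => f l ^ (T - t)) x.skip = kw (fun l => f l ^ (T - t)) x from rfl,
        show kw (fun l => f l ^ (T - t1)) x.skip = kw (fun l => f l ^ (T - t1)) x from rfl,
        ← hkw x, ← hsplit]
      ring
    | take x =>
      rw [kdl_take]
      have h1 : kdl (fun l => f l ^ t) s j (f s ^ (t1 - t) • ku (fun l => f l ^ (t1 - t)) s _ b') x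
          = f s ^ (t1 - t) * (kw (fun l => f l ^ (t1 - t)) x *
            (f s ^ (T - t1) * (kw (fun l => f l ^ (T - t1)) x * c x.take))) := by
        rw [map_smul, kdl_ku _ (fun l => f l ^ t1) _ 
          (fun l => by rw [← pow_add]; congr 1; omega), hb']
        simp [ku_apply]
        ring
      refine h1.trans ?_
      rw [ku_apply, ← hkw x.take]
      simp only [kw]
      ring

lemma kdl_mem (g : ℕ → R) (J : Ideal R) (s : ℕ) (hg : ∀ l < s, g l ∈ J) (c) (a) :
    kdl g s 0 c a ∈ J := by
  induction s with
  | zero => cases a; exact J.zero_mem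
  | succ s ih =>
    cases a with
    | skip a =>
      rw [kdl_skip]
      exact J.add_mem (ih (fun l hl => hg l (by omega)) _ _)
        (J.mul_mem_right _ (J.mul_mem_left _ (hg s (by omega))))

lemma kdl_hits (g : ℕ → R) (s l : ℕ) (hl : l < s) :
    ∃ c, ∀ a, kdl g s 0 c a = g l := by
  induction s with
  | zero => omega
  | succ s ih =>
    by_cases h : l = s
    · subst h
      refine ⟨fun x => match x with | .skip x => 0 | .take x => 1, fun a => ?_⟩
      cases a with
      | skip a =>
        rw [kdl_skip]
        have : kdl g l 0 (fun _ => 0) a = 0 := by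
          change kdl g l 0 0 a = 0
          rw [map_zero]; rfl
        simp only [this]
        simp
    · obtain ⟨c, hc⟩ := ih (by omega)
      refine ⟨fun x => match x with | .skip x => c x | .take x => 0, fun a => ?_⟩
      cases a with
      | skip a =>
        rw [kdl_skip]
        simp only [mul_zero, add_zero]
        exact hc a

end Koszul

section Bridge
variable {R : Type} [CommRing R]

/-- The resolution as explicit complex. -/
noncomputable abbrev prCx (I : Ideal R) (t : ℕ) : Cx R (R ⧸ I ^ t) where
  X n := (PR I t).complex.X n
  d n := ((PR I t).complex.d (n+1) n).hom
  ε := ((PR I t).π.f 0).hom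
  d_d n c := ConcreteCategory.congr_hom ((PR I t).complex.d_comp_d (n+1+1) (n+1) n) c
  ε_d c := ConcreteCategory.congr_hom ((PR I t).complex_d_comp_π_f_zero) c

lemma prCx_exact (I : Ideal R) (t : ℕ) : (prCx I t).Exact where
  surj := (ModuleCat.epi_iff_surjective ((PR I t).π.f 0)).1 inferInstance
  ex j c hc := by
    cases j with
    | zero => exact (ShortComplex.moduleCat_exact_iff _).1 (PR I t).exact₀ c hc
    | succ j => exact (ShortComplex.moduleCat_exact_iff _).1 ((PR I t).exact_succ j) c hc

lemma prCx_proj (I : Ideal R) (t j : ℕ) : Module.Projective R ((prCx I t).X j) :=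
  (IsProjective.iff_projective _).2 ((PR I t).projective j)

/-- projections as linear maps -/
noncomputable def projL (I : Ideal R) {t t' : ℕ} (h : t ≤ t') : (R ⧸ I ^ t') →ₗ[R] (R ⧸ I ^ t) :=
  (proj I h).hom

lemma projL_mk (I : Ideal R) {t t' : ℕ} (h : t ≤ t') (r : R) :
    projL I h (Ideal.Quotient.mk _ r) = Ideal.Quotient.mk _ r := rfl

lemma projL_comp (I : Ideal R) {t t' t'' : ℕ} (h : t ≤ t') (h' : t' ≤ t'') :
    projL I h ∘ₗ projL I h' = projL I (h.trans h') := by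
  ext
  rfl

lemma lift_lifts (I : Ideal R) {t t' : ℕ} (h : t ≤ t') (j : ℕ) :
    Lifts (prCx I t') (prCx I t) (projL I h) j
      ((ProjectiveResolution.lift (proj I h) (PR I t') (PR I t)).f j).hom := by
  induction j with
  | zero =>
    intro c
    exact ConcreteCategory.congr_hom
      (ProjectiveResolution.lift_commutes_zero (proj I h) (PR I t') (PR I t)) c
  | succ j ih =>
    exact ⟨_, ih, fun c => ConcreteCategory.congr_hom
      ((ProjectiveResolution.lift (proj I h) (PR I t') (PR I t)).comm (j+1) j) c⟩

lemma LCRep.zero_iff_isCob {I : Ideal R} {i : ℕ} {t : ℕ}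
    {ζ : (PR I t).complex.X i ⟶ ModuleCat.of R R} {z} (h : LCRep t ζ z) :
    z = 0 ↔ ∃ (t' : ℕ) (h : t ≤ t'),
      (prCx I t').IsCob R i (ζ.hom ∘ₗ
        ((ProjectiveResolution.lift (proj I h) (PR I t') (PR I t)).f i).hom) := by
  cases i with
  | zero =>
    rw [h.zero_iff 0 (by simp)]
    refine exists_congr fun t' => exists_congr fun h => ?_
    constructor
    · rintro ⟨β, hβ⟩
      change _ = 0
      rw [(PR I t').complex.shape 0 0 (by simp), zero_comp] at hβ
      exact congrArg ModuleCat.Hom.hom hβ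
    · intro H
      refine ⟨0, ?_⟩
      rw [comp_zero]
      exact ModuleCat.hom_ext H
  | succ i =>
    rw [h.zero_iff i (by simp)]
    refine exists_congr fun t' => exists_congr fun h => ?_
    constructor
    · rintro ⟨β, hβ⟩
      exact ⟨β.hom, congrArg ModuleCat.Hom.hom hβ⟩
    · rintro ⟨β, hβ⟩
      exact ⟨ModuleCat.ofHom β, ModuleCat.hom_ext hβ⟩

/-- The Koszul complex as explicit complex. -/
noncomputable abbrev kCx (I : Ideal R) (f : ℕ → R) (s : ℕ) (hf : ∀ l < s, f l ∈ I) (t : ℕ) :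
    Cx R (R ⧸ I ^ t) where
  X n := ModuleCat.of R (Idx s n → R)
  d n := kdl (fun l => f l ^ t) s n
  ε := (I ^ t).mkQ ∘ₗ LinearMap.proj (Idx.bot s)
  d_d n c := kdl_kdl _ s n c
  ε_d c := (Submodule.Quotient.mk_eq_zero _).2
    (kdl_mem _ (I ^ t) s (fun l hl => Ideal.pow_mem_pow (hf l hl) t) c _)

lemma kCx_proj (I : Ideal R) (f : ℕ → R) (s : ℕ) (hf : ∀ l < s, f l ∈ I) (t j : ℕ) :
    Module.Projective R ((kCx I f s hf t).X j) :=
  inferInstanceAs (Module.Projective R (Idx s j → R))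

lemma ku_lifts (I : Ideal R) (f : ℕ → R) (s : ℕ) (hf : ∀ l < s, f l ∈ I) {t t' : ℕ} (h : t ≤ t')
    (j : ℕ) : Lifts (kCx I f s hf t') (kCx I f s hf t) (projL I h) j
      (ku (fun l => f l ^ (t' - t)) s j) := by
  induction j with
  | zero =>
    intro c
    change (I ^ t).mkQ (ku (fun l => f l ^ (t' - t)) s 0 c (Idx.bot s)) =
      projL I h (Ideal.Quotient.mk _ (c (Idx.bot s)))
    rw [ku_apply, kw_zero, one_mul]
    rfl
  | succ j ih =>
    exact ⟨_, ih, fun c => kdl_ku _ _ _ (fun l => by rw [← pow_add]; congr 1; omega) s j c⟩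

lemma kCx_pro [IsNoetherianRing R] (I : Ideal R) (f : ℕ → R) (s : ℕ) (hf : ∀ l < s, f l ∈ I)
    (hI : I ≤ Ideal.span (Set.image f {l | l < s})) (j t : ℕ) :
    ∃ (T : ℕ) (_ : t ≤ T), ∀ c, (kCx I f s hf T).IsCyc j c →
      ∃ b, (kCx I f s hf t).d j b = ku (fun l => f l ^ (T - t)) s j c := by
  cases j with
  | succ j =>
    obtain ⟨T, h, H⟩ := kos_pro f s j t
    exact ⟨T, h, H⟩
  | zero =>
    let J : Ideal R := Ideal.span (Set.image (fun l => f l ^ t) {l | l < s})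
    have h1 : I ≤ J.radical := by
      refine hI.trans (Ideal.span_le.2 ?_)
      rintro _ ⟨l, hl, rfl⟩
      exact ⟨t, Ideal.subset_span ⟨l, hl, rfl⟩⟩
    obtain ⟨n, hn⟩ := Ideal.exists_pow_le_of_le_radical_of_fg h1 (IsNoetherian.noetherian I)
    refine ⟨max n t, le_max_right _ _, fun c hc => ?_⟩
    have hc1 : c (Idx.bot s) ∈ I ^ (max n t) := (Submodule.Quotient.mk_eq_zero _).1 hc
    have hc2 : c (Idx.bot s) ∈ J := hn (Ideal.pow_le_pow_right (le_max_left _ _) hc1)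
    have key : J ≤ (LinearMap.range (kdl (fun l => f l ^ t) s 0)).map (LinearMap.proj (Idx.bot s)) := by
      refine Ideal.span_le.2 ?_
      rintro _ ⟨l, hl, rfl⟩
      obtain ⟨b, hb⟩ := kdl_hits (fun l => f l ^ t) s l hl
      exact ⟨_, ⟨b, rfl⟩, hb _⟩
    obtain ⟨_, ⟨b, rfl⟩, hb⟩ := key hc2
    refine ⟨b, ?_⟩
    funext a
    rw [ku_apply, kw_zero, one_mul, Idx.eq_bot a]
    exact hb

/-- Koszul coboundaries. -/
def KCob (g : ℕ → R) (s : ℕ) : ∀ i, ((Idx s i → R) →ₗ[R] R) → Prop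
  | 0, ψ => ψ = 0
  | i+1, ψ => ∃ β, ψ = β ∘ₗ kdl g s i

/-- Eventually a coboundary. -/
def KZ (f : ℕ → R) (s i t : ℕ) (ψ : (Idx s i → R) →ₗ[R] R) : Prop :=
  ∃ t', t ≤ t' ∧ KCob (fun l => f l ^ t') s i (ψ ∘ₗ ku (fun l => f l ^ (t' - t)) s i)

lemma isCob_iff (I : Ideal R) (f : ℕ → R) (s : ℕ) (hf : ∀ l < s, f l ∈ I) (t i : ℕ) (ψ) :
    (kCx I f s hf t).IsCob R i ψ ↔ KCob (fun l => f l ^ t) s i ψ := by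
  cases i <;> rfl

theorem bridge [IsNoetherianRing R] (I : Ideal R) (f : ℕ → R) (s : ℕ)
    (hI : I = Ideal.span (Set.image f {l | l < s})) (i : ℕ) (z : LC I i (ModuleCat.of R R)) :
    ∃ (t : ℕ) (ψ : (Idx s i → R) →ₗ[R] R), ∀ r : R, r • z = 0 ↔ KZ f s i t (r • ψ) := by
  have hf : ∀ l < s, f l ∈ I := fun l hl => by rw [hI]; exact Ideal.subset_span ⟨l, hl, rfl⟩
  obtain ⟨t, ζ, hζ⟩ := LCRep.exists z
  obtain ⟨κ, hκ⟩ := Lifts.exists (A := kCx I f s hf t) (B := prCx I t) (kCx_proj I f s hf t)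
    (prCx_exact I t) LinearMap.id i
  refine ⟨t, ζ.hom ∘ₗ κ, fun r => ?_⟩
  have hd : ∀ c, (r • ζ).hom ((prCx I t).d i c) = 0 := fun c => 
    ConcreteCategory.congr_hom (hζ.smul r).d_comp c
  rw [(hζ.smul r).zero_iff_isCob]
  have e : ∀ (t' : ℕ), (r • ζ.hom ∘ₗ κ) ∘ₗ ku (fun l => f l ^ (t' - t)) s i =
      (r • ζ).hom ∘ₗ (κ ∘ₗ ku (fun l => f l ^ (t' - t)) s i) := fun t' => rfl
  constructor
  · rintro ⟨t', h, H⟩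
    refine ⟨t', h, ?_⟩
    rw [← isCob_iff I f s hf, e]
    obtain ⟨κ', hκ'⟩ := Lifts.exists (A := kCx I f s hf t') (B := prCx I t') (kCx_proj I f s hf t')
      (prCx_exact I t') LinearMap.id i
    have h1 := hκ'.isCob H
    have h2 := (ku_lifts I f s hf h i).comp hκ
    have h3 := hκ'.comp (lift_lifts I h i)
    rw [LinearMap.id_comp] at h2
    rw [LinearMap.comp_id] at h3
    have h4 := Lifts.isCob_sub (kCx_proj I f s hf t') (prCx_exact I t) h2 h3 hd
    have h5 := h4.add h1
    rw [LinearMap.comp_assoc, sub_add_cancel] at h5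
    exact h5
  · rintro ⟨t', h, H⟩
    rw [← isCob_iff I f s hf, e] at H
    obtain ⟨T, hT, μ, hμ⟩ := Lifts.exists_pro (projL I) (projL_comp I) (prCx I) (kCx I f s hf)
      (prCx_proj I) (fun {t t'} h j => ku (fun l => f l ^ (t' - t)) s j)
      (ku_lifts I f s hf) (fun t x => by
        obtain ⟨x, rfl⟩ := Ideal.Quotient.mk_surjective x
        exact ⟨fun _ => x, rfl⟩) (kCx_pro I f s hf hI.le) i t'
    refine ⟨T, h.trans hT, ?_⟩
    have h1 := hμ.isCob H
    have h2 := hμ.comp ((ku_lifts I f s hf h i).comp hκ)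
    have h3 := lift_lifts I (h.trans hT) i
    rw [LinearMap.id_comp, projL_comp] at h2
    have h4 := Lifts.isCob_sub (prCx_proj I T) (prCx_exact I t) h3 h2 hd
    have h5 := h4.add h1
    rw [LinearMap.comp_assoc, LinearMap.comp_assoc, LinearMap.comp_assoc, sub_add_cancel] at h5
    exact h5

end Bridge

section Push
variable {A B : Type} [CommRing A] [CommRing B]

lemma kdl_semi (T : A →+ B) (g : ℕ → A) (g' : ℕ → B) (hT : ∀ l x, T (g l * x) = g' l * T x)
    {s j : ℕ} (a : Idx s j) (c : Idx s (j+1) → A) (c' : Idx s (j+1) → B)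
    (hc : ∀ b x, T (c b * x) = c' b * T x) (x : A) :
    T (kdl g s j c a * x) = kdl g' s j c' a * T x := by
  induction a generalizing x with
  | nil =>
    change T (0 * x) = 0 * T x
    simp
  | @skip s j a ih =>
    rw [kdl_skip, kdl_skip, add_mul, add_mul, map_add, ih _ (fun b => c' b.skip) (fun b => hc _)]
    congr 1
    rw [show (-1 : A) ^ j * g s * c a.take * x = g s * (c a.take * ((-1) ^ j * x)) by ring, hT, hc]
    have : T ((-1) ^ j * x) = (-1) ^ j * T x := by
      rcases neg_one_pow_eq_or A j with h | h <;> rcases neg_one_pow_eq_or ℤ j with h' | h' <;>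
      rcases Nat.even_or_odd j with h2 | h2 <;> simp [h2.neg_one_pow]
    rw [this]
    ring
  | take a ih => exact ih _ _ (fun b => hc _) x

lemma kw_semi (T : A →+ B) (g : ℕ → A) (g' : ℕ → B) (hT : ∀ l x, T (g l * x) = g' l * T x)
    {s j : ℕ} (a : Idx s j) (x : A) : T (kw g a * x) = kw g' a * T x := by
  induction a generalizing x with
  | nil => simp [kw]
  | skip a ih => exact ih x
  | take a ih => simp only [kw]; rw [mul_assoc, hT, ih, mul_assoc]

open scoped Classical in
/-- Apply an additive map to the values of a functional on the standard basis. -/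
noncomputable def push (T : A →+ B) {s j : ℕ} (ψ : (Idx s j → A) →ₗ[A] A) :
    (Idx s j → B) →ₗ[B] B :=
  (Pi.basisFun B (Idx s j)).constr B (fun a => T (ψ (Pi.single a 1)))

open scoped Classical in
lemma push_single (T : A →+ B) {s j : ℕ} (ψ : (Idx s j → A) →ₗ[A] A) (a : Idx s j) :
    push T ψ (Pi.single a 1) = T (ψ (Pi.single a 1)) := by
  have := (Pi.basisFun B (Idx s j)).constr_basis B (fun a => T (ψ (Pi.single a 1))) a
  rwa [Pi.basisFun_apply] at this

open scoped Classical in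
lemma fn_ext {s j : ℕ} {ψ ψ' : (Idx s j → A) →ₗ[A] A}
    (h : ∀ a, ψ (Pi.single a 1) = ψ' (Pi.single a 1)) : ψ = ψ' :=
  (Pi.basisFun A (Idx s j)).ext fun a => by rw [Pi.basisFun_apply, h]

open scoped Classical in
lemma fn_sum {s j : ℕ} [Fintype (Idx s j)] (ψ : (Idx s j → A) →ₗ[A] A) (c) :
    ψ c = ∑ a, c a * ψ (Pi.single a 1) := by
  conv_lhs => rw [pi_eq_sum_univ' c, map_sum]
  refine Finset.sum_congr rfl fun a _ => ?_
  rw [map_smul, smul_eq_mul]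

open scoped Classical in
lemma push_kdl (T : A →+ B) (g : ℕ → A) (g' : ℕ → B) (hT : ∀ l x, T (g l * x) = g' l * T x)
    {s j : ℕ} (β : (Idx s j → A) →ₗ[A] A) :
    push T (β ∘ₗ kdl g s j) = push T β ∘ₗ kdl g' s j := by
  refine fn_ext fun b => ?_
  have := Fintype.ofFinite (Idx s j)
  rw [push_single, LinearMap.comp_apply, LinearMap.comp_apply, fn_sum, fn_sum, map_sum]
  refine Finset.sum_congr rfl fun a _ => ?_
  rw [push_single]
  refine kdl_semi T g g' hT a _ _ (fun b' x => ?_) _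
  by_cases h : b' = b
  · subst h; simp
  · simp [h]

open scoped Classical in
lemma ku_single (g : ℕ → A) {s j : ℕ} (a : Idx s j) :
    ku g s j (Pi.single a 1) = kw g a • Pi.single a 1 := by
  ext b
  rw [ku_apply]
  by_cases h : b = a
  · subst h; simp
  · simp [h]

lemma push_ku (T : A →+ B) (g : ℕ → A) (g' : ℕ → B) (hT : ∀ l x, T (g l * x) = g' l * T x)
    {s j : ℕ} (β : (Idx s j → A) →ₗ[A] A) :
    push T (β ∘ₗ ku g s j) = push T β ∘ₗ ku g' s j := by
  classical
  refine fn_ext fun b => ?_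
  rw [push_single, LinearMap.comp_apply, LinearMap.comp_apply, ku_single, ku_single, β.map_smul,
    (push T β).map_smul, push_single, smul_eq_mul, smul_eq_mul, kw_semi T g g' hT]

lemma KCob.push {T : A →+ B} {g : ℕ → A} {g' : ℕ → B} (hT : ∀ l x, T (g l * x) = g' l * T x)
    {s j : ℕ} {ψ : (Idx s j → A) →ₗ[A] A} (h : KCob g s j ψ) : KCob g' s j (push T ψ) := by
  cases j with
  | zero =>
    change _ = 0
    rw [show ψ = 0 from h]
    classical
    exact fn_ext fun b => by rw [push_single]; simp
  | succ j =>
    obtain ⟨β, rfl⟩ := h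
    exact ⟨ZLC.push T β, push_kdl T g g' hT β⟩

lemma semi_pow {T : A →+ B} {g : ℕ → A} {g' : ℕ → B} (hT : ∀ l x, T (g l * x) = g' l * T x)
    (e : ℕ) (l x) : T (g l ^ e * x) = g' l ^ e * T x := by
  induction e generalizing x with
  | zero => simp
  | succ e ih => rw [pow_succ, mul_assoc, ih, hT, pow_succ, mul_assoc]

lemma KZ.push {T : A →+ B} {g : ℕ → A} {g' : ℕ → B} (hT : ∀ l x, T (g l * x) = g' l * T x)
    {s j t : ℕ} {ψ : (Idx s j → A) →ₗ[A] A} (h : KZ g s j t ψ) : KZ g' s j t (push T ψ) := by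
  obtain ⟨t', h, H⟩ := h
  refine ⟨t', h, ?_⟩
  rw [← push_ku T (fun l => g l ^ (t' - t)) _ (semi_pow hT _)]
  exact H.push (semi_pow hT _)

lemma KCob.add {g : ℕ → A} {s j : ℕ} {ψ ξ : (Idx s j → A) →ₗ[A] A} (h : KCob g s j ψ)
    (h' : KCob g s j ξ) : KCob g s j (ψ + ξ) := by
  cases j with
  | zero =>
    change _ = 0
    rw [show ψ = 0 from h, show ξ = 0 from h', add_zero]
  | succ j =>
    obtain ⟨β, rfl⟩ := h
    obtain ⟨γ, rfl⟩ := h'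
    exact ⟨β + γ, by rw [LinearMap.add_comp]⟩

lemma KCob.smul {g : ℕ → A} {s j : ℕ} {ψ : (Idx s j → A) →ₗ[A] A} (h : KCob g s j ψ) (r : A) :
    KCob g s j (r • ψ) := by
  cases j with
  | zero =>
    change _ = 0
    rw [show ψ = 0 from h, smul_zero]
  | succ j =>
    obtain ⟨β, rfl⟩ := h
    exact ⟨r • β, by rw [LinearMap.smul_comp]⟩

lemma KCob.sub {g : ℕ → A} {s j : ℕ} {ψ ξ : (Idx s j → A) →ₗ[A] A} (h : KCob g s j ψ)
    (h' : KCob g s j ξ) : KCob g s j (ψ - ξ) := by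
  have e : ψ - ξ = ψ + (-1 : A) • ξ := by
    refine LinearMap.ext fun c => ?_
    rw [LinearMap.sub_apply, LinearMap.add_apply, LinearMap.smul_apply, smul_eq_mul]
    ring
  rw [e]
  exact h.add (h'.smul (-1))

lemma KCob.trans {f : ℕ → A} {s j t t' t'' : ℕ} (h1 : t ≤ t') (h2 : t' ≤ t'')
    {ψ : (Idx s j → A) →ₗ[A] A}
    (h : KCob (fun l => f l ^ t') s j (ψ ∘ₗ ku (fun l => f l ^ (t' - t)) s j)) :
    KCob (fun l => f l ^ t'') s j (ψ ∘ₗ ku (fun l => f l ^ (t'' - t)) s j) := by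
  have e : ψ ∘ₗ ku (fun l => f l ^ (t'' - t)) s j =
      (ψ ∘ₗ ku (fun l => f l ^ (t' - t)) s j) ∘ₗ ku (fun l => f l ^ (t'' - t')) s j := by
    rw [LinearMap.comp_assoc]
    congr 1
    refine LinearMap.ext fun c => funext fun a => ?_
    rw [LinearMap.comp_apply, ku_apply, ku_apply, ku_apply, ← mul_assoc, kw_pow_trans]
    congr 4
    funext l
    congr 1
    omega
  rw [e]
  cases j with
  | zero =>
    change _ = 0
    rw [show ψ ∘ₗ ku (fun l => f l ^ (t' - t)) s 0 = 0 from h, LinearMap.zero_comp]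
  | succ j =>
    obtain ⟨β, hβ⟩ := h
    rw [hβ]
    refine ⟨β ∘ₗ ku (fun l => f l ^ (t'' - t')) s j, ?_⟩
    rw [LinearMap.comp_assoc, LinearMap.comp_assoc]
    congr 1
    exact LinearMap.ext fun c => kdl_ku _ _ _ (fun l => by rw [← pow_add]; congr 1; omega) s j c

/-- The eventual coboundaries as a submodule. -/
def kzSub (f : ℕ → A) (s j t : ℕ) : Submodule A ((Idx s j → A) →ₗ[A] A) where
  carrier := {ψ | KZ f s j t ψ}
  zero_mem' := ⟨t, le_rfl, by
    rw [LinearMap.zero_comp]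
    cases j with
    | zero => rfl
    | succ j => exact ⟨0, by rw [LinearMap.zero_comp]⟩⟩
  add_mem' := by
    rintro ψ ξ ⟨t1, h1, H1⟩ ⟨t2, h2, H2⟩
    refine ⟨max t1 t2, h1.trans (le_max_left _ _), ?_⟩
    rw [LinearMap.add_comp]
    exact (H1.trans h1 (le_max_left _ _)).add (H2.trans h2 (le_max_right _ _))
  smul_mem' := by
    rintro r ψ ⟨t1, h1, H1⟩
    refine ⟨t1, h1, ?_⟩
    rw [LinearMap.smul_comp]
    exact H1.smul r

lemma mem_kzSub (f : ℕ → A) (s j t : ℕ) (ψ) : ψ ∈ kzSub f s j t ↔ KZ f s j t ψ := Iff.rfl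

end Push

section Ops
open MvPolynomial
variable {K : Type} [Field K] {n : ℕ}

/-- The operator lowering the exponent of `x_i` by one, killing exponents divisible by `q`. -/
noncomputable def opT (K : Type) [Field K] {n : ℕ} (q : ℕ) (i : Fin n) :
    MvPolynomial (Fin n) K →ₗ[K] MvPolynomial (Fin n) K :=
  (basisMonomials (Fin n) K).constr K
    (fun e => if q ∣ e i then 0 else monomial (e - Finsupp.single i 1) 1)

lemma opT_monomial (q : ℕ) (i : Fin n) (e : Fin n →₀ ℕ) (c : K) :
    opT K q i (monomial e c) = if q ∣ e i then 0 else monomial (e - Finsupp.single i 1) c := by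
  have := (basisMonomials (Fin n) K).constr_basis K
    (fun e => if q ∣ e i then 0 else monomial (e - Finsupp.single i 1) (1 : K)) e
  rw [coe_basisMonomials] at this
  rw [show monomial e c = c • monomial e (1 : K) by simp [smul_monomial], map_smul]
  refine (congrArg (c • ·) this).trans ?_
  split_ifs <;> simp [smul_monomial]

lemma opT_pow (p : ℕ) [Fact p.Prime] [CharP K p] (e : ℕ) (i : Fin n)
    (r g : MvPolynomial (Fin n) K) :
    opT K (p ^ e) i (r ^ p ^ e * g) = r ^ p ^ e * opT K (p ^ e) i g := by
  induction r using MvPolynomial.induction_on' with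
  | add a b ha hb => rw [add_pow_char_pow, add_mul, map_add, ha, hb, add_mul]
  | monomial d c =>
    rw [monomial_pow]
    induction g using MvPolynomial.induction_on' with
    | add a b ha hb => rw [mul_add, map_add, ha, hb, map_add, mul_add]
    | monomial d' c' =>
      rw [monomial_mul, opT_monomial, opT_monomial]
      have h : p ^ e ∣ (p ^ e • d + d') i ↔ p ^ e ∣ d' i := by
        simp only [Finsupp.add_apply, Finsupp.smul_apply, smul_eq_mul]
        exact (Nat.dvd_add_right (dvd_mul_right _ _))
      simp only [h]
      split_ifs with h1
      · rw [mul_zero]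
      · rw [monomial_mul]
        congr 2
        have : 1 ≤ d' i := by
          rcases Nat.eq_zero_or_pos (d' i) with h2 | h2
          · exact absurd (h2 ▸ dvd_zero _) h1
          · exact h2
        ext j
        simp only [Finsupp.add_apply, Finsupp.tsub_apply, Finsupp.single_apply, Finsupp.smul_apply]
        split_ifs with hj
        · subst hj; omega
        · omega

lemma coeff_sub_opT (q : ℕ) (i : Fin n) (g : MvPolynomial (Fin n) K) (d : Fin n →₀ ℕ) :
    coeff d (g - opT K q i (X i * g)) = if q ∣ d i + 1 then coeff d g else 0 := by
  induction g using MvPolynomial.induction_on' with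
  | add a b ha hb =>
    rw [mul_add, map_add, show a + b - (opT K q i (X i * a) + opT K q i (X i * b)) =
      (a - opT K q i (X i * a)) + (b - opT K q i (X i * b)) by ring, coeff_add, ha, hb, coeff_add]
    split_ifs <;> simp
  | monomial e c =>
    rw [X, monomial_mul, opT_monomial, one_mul]
    have h1 : (Finsupp.single i 1 + e : Fin n →₀ ℕ) i = e i + 1 := by simp [add_comm]
    have h2 : (Finsupp.single i 1 + e : Fin n →₀ ℕ) - Finsupp.single i 1 = e := by simp
    rw [h1, h2]
    by_cases hd : e = d
    · subst hd; split_ifs <;> simp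
    · split_ifs <;> simp [coeff_monomial, hd]

lemma kw_totalDegree (f : ℕ → MvPolynomial (Fin n) K) (N : ℕ) {s j : ℕ} (a : Idx s j) :
    (kw (fun l => f l ^ N) a).totalDegree ≤ N * ∑ l ∈ Finset.range s, (f l).totalDegree := by
  induction a with
  | nil => simp [kw]
  | @skip s j a ih =>
    rw [Finset.sum_range_succ, mul_add]
    exact ih.trans (Nat.le_add_right _ _)
  | @take s j a ih =>
    rw [Finset.sum_range_succ, mul_add, add_comm (N * _)]
    exact (totalDegree_mul _ _).trans (add_le_add (totalDegree_pow _ _) ih)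

open scoped Classical in
lemma kz_zero (p : ℕ) [Fact p.Prime] [CharP K p] (f : ℕ → MvPolynomial (Fin n) K) (s j t : ℕ)
    (hf : ∑ l ∈ Finset.range s, (f l).totalDegree < n)
    (ψ : (Idx s j → MvPolynomial (Fin n) K) →ₗ[MvPolynomial (Fin n) K] MvPolynomial (Fin n) K)
    (h : ∀ i : Fin n, KZ f s j t ((X i : MvPolynomial (Fin n) K) • ψ)) : KZ f s j t ψ := by
  have := Fintype.ofFinite (Idx s j)
  choose t' ht' H using h
  let D := ∑ a, (ψ (Pi.single a 1)).totalDegree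
  let e := t + ∑ i, t' i + D + n + 1
  let q := p ^ e
  have hq : e < q := Nat.lt_pow_self (Fact.out : p.Prime).one_lt
  have htq : t ≤ q := by omega
  refine ⟨q, htq, ?_⟩
  have H' : ∀ i, KCob (fun l => f l ^ q) s j ((X i : MvPolynomial (Fin n) K) • (ψ ∘ₗ ku (fun l => f l ^ (q - t)) s j)) := by
    intro i
    have : t' i ≤ ∑ i, t' i := Finset.single_le_sum (fun _ _ => Nat.zero_le _) (Finset.mem_univ i)
    exact (H i).trans (ht' i) (by omega)
  set ψ' := ψ ∘ₗ ku (fun l => f l ^ (q - t)) s j with hψ'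
  have hdeg : ∀ a, (ψ' (Pi.single a 1)).totalDegree < n * (q - 1) := by
    intro a
    rw [hψ', LinearMap.comp_apply, ku_single, map_smul, smul_eq_mul]
    refine (totalDegree_mul _ _).trans_lt ?_
    have h1 := kw_totalDegree f (q - t) a
    have h2 : (ψ (Pi.single a 1)).totalDegree ≤ D :=
      Finset.single_le_sum (f := fun a => (ψ (Pi.single a 1)).totalDegree)
        (fun _ _ => Nat.zero_le _) (Finset.mem_univ a)
    obtain ⟨n', rfl⟩ : ∃ n', n = n' + 1 := ⟨n - 1, by omega⟩
    have h3 : (q - t) * ∑ l ∈ Finset.range s, (f l).totalDegree ≤ q * n' :=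
      Nat.mul_le_mul (Nat.sub_le _ _) (by omega)
    obtain ⟨q', hq'⟩ : ∃ q', q = q' + 1 := ⟨q - 1, by omega⟩
    have h4 : q * n' + D < (n' + 1) * (q - 1) := by
      rw [hq', Nat.add_sub_cancel]
      have : D + (n' + 1) + 1 < q' + 1 := by omega
      nlinarith
    omega
  have key : ∀ S : Finset (Fin n), ∃ ξ, KCob (fun l => f l ^ q) s j (ψ' - ξ) ∧
      ∀ a d, coeff d (ξ (Pi.single a 1)) ≠ 0 →
        (∀ i ∈ S, q ∣ d i + 1) ∧ coeff d (ψ' (Pi.single a 1)) ≠ 0 := by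
    intro S
    induction S using Finset.induction_on with
    | empty =>
      refine ⟨ψ', ?_, fun a d h => ⟨by simp, h⟩⟩
      rw [sub_self, ← zero_smul (MvPolynomial (Fin n) K) ψ']
      by_cases hn : 0 < n
      · have := (H' ⟨0, hn⟩).smul 0
        rwa [zero_smul, ← zero_smul (MvPolynomial (Fin n) K) ψ'] at this
      · omega
    | insert i S hi ih =>
      obtain ⟨ξ, h1, h2⟩ := ih
      have h3 : KCob (fun l => f l ^ q) s j ((X i : MvPolynomial (Fin n) K) • ξ) := by
        have := (H' i).sub (h1.smul (X i))
        rwa [smul_sub, sub_sub_cancel] at this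
      have h4 := h3.push (T := (opT K q i).toAddMonoidHom) (g' := fun l => f l ^ q)
        (fun l x => opT_pow p e i (f l) x)
      refine ⟨ξ - push (opT K q i).toAddMonoidHom ((X i : MvPolynomial (Fin n) K) • ξ), ?_, ?_⟩
      · have := h1.add h4
        rwa [sub_add] at this
      · intro a d had
        rw [LinearMap.sub_apply, push_single, LinearMap.smul_apply, smul_eq_mul] at had
        have h5 := coeff_sub_opT q i (ξ (Pi.single a 1)) d
        rw [LinearMap.toAddMonoidHom_coe, h5] at had
        split_ifs at had with h6
        · obtain ⟨h7, h8⟩ := h2 a d had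
          refine ⟨?_, h8⟩
          intro i' hi'
          rcases Finset.mem_insert.1 hi' with rfl | hi'
          · exact h6
          · exact h7 i' hi'
        · exact absurd rfl had
  obtain ⟨ξ, h1, h2⟩ := key Finset.univ
  have h3 : ξ = 0 := by
    refine fn_ext fun a => ?_
    ext d
    by_contra hne
    have hne' : coeff d (ξ (Pi.single a 1)) ≠ 0 := by simpa using hne
    obtain ⟨h4, h5⟩ := h2 a d hne'
    have h6 := le_totalDegree (mem_support_iff.2 h5)
    have h7 := hdeg a
    rw [Finsupp.sum_fintype _ _ (fun _ => rfl)] at h6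
    have h8 : ∑ i : Fin n, (q - 1) ≤ ∑ i, d i := Finset.sum_le_sum fun i _ => by
      have := Nat.le_of_dvd (by omega) (h4 i (Finset.mem_univ i))
      omega
    simp at h8
    omega
  rwa [h3, sub_zero] at h1

end Ops

section Final
open MvPolynomial
variable {K : Type} [Field K] {n : ℕ}

/-- Translation. -/
noncomputable def trl (α : Fin n → K) : MvPolynomial (Fin n) K →ₐ[K] MvPolynomial (Fin n) K :=
  aeval fun i => X i + C (α i)

lemma trl_trl (α : Fin n → K) (g) : trl (fun i => - α i) (trl α g) = g := by
  have : (trl (fun i => - α i)).comp (trl α) = AlgHom.id K _ := by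
    refine MvPolynomial.algHom_ext fun i => ?_
    simp [trl, algHom_C]
  exact DFunLike.congr_fun this g

lemma trl_totalDegree (α : Fin n → K) (g) : (trl α g).totalDegree ≤ g.totalDegree := by
  rw [trl, aeval_def, eval₂_eq]
  refine (totalDegree_finsetSum _ _).trans (Finset.sup_le fun d hd => ?_)
  refine (totalDegree_mul _ _).trans ?_
  rw [algebraMap_eq, totalDegree_C, zero_add]
  refine (totalDegree_finsetProd _ _).trans ?_
  refine le_trans ?_ (le_totalDegree hd)
  refine Finset.sum_le_sum fun i _ => ?_
  refine (totalDegree_pow _ _).trans ?_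
  have : (X i + C (α i) : MvPolynomial (Fin n) K).totalDegree ≤ 1 := by
    refine (totalDegree_add _ _).trans ?_
    simp
  calc d i * _ ≤ d i * 1 := Nat.mul_le_mul_left _ this
    _ = d i := mul_one _

lemma kz_pt (p : ℕ) [Fact p.Prime] [CharP K p] (f : ℕ → MvPolynomial (Fin n) K) (s j t : ℕ)
    (hf : ∑ l ∈ Finset.range s, (f l).totalDegree < n)
    (ψ : (Idx s j → MvPolynomial (Fin n) K) →ₗ[MvPolynomial (Fin n) K] MvPolynomial (Fin n) K)
    (α : Fin n → K)
    (h : ∀ i : Fin n, KZ f s j t ((X i - C (α i) : MvPolynomial (Fin n) K) • ψ)) :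
    KZ f s j t ψ := by
  classical
  let T : MvPolynomial (Fin n) K →+ MvPolynomial (Fin n) K := (trl α).toRingHom.toAddMonoidHom
  let T' : MvPolynomial (Fin n) K →+ MvPolynomial (Fin n) K :=
    (trl (fun i => - α i)).toRingHom.toAddMonoidHom
  have hT : ∀ l x, T (f l * x) = trl α (f l) * T x := fun l x => map_mul (trl α) _ _
  have hT' : ∀ l x, T' (trl α (f l) * x) = f l * T' x := fun l x =>
    (map_mul (trl (fun i => - α i)) _ _).trans (by rw [trl_trl]; rfl)
  have h1 : KZ (fun l => trl α (f l)) s j t (push T ψ) := by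
    refine kz_zero p _ s j t (lt_of_le_of_lt (Finset.sum_le_sum fun l _ => trl_totalDegree _ _) hf)
      _ fun i => ?_
    have := (h i).push hT
    convert this using 1
    refine fn_ext fun a => ?_
    rw [LinearMap.smul_apply, push_single, push_single, LinearMap.smul_apply, smul_eq_mul,
      smul_eq_mul]
    refine Eq.trans ?_ (map_mul (trl α) _ _).symm
    congr 1
    simp [trl, algHom_C]
  have h2 := h1.push hT'
  convert h2 using 1
  refine fn_ext fun a => ?_
  rw [push_single, push_single]
  exact (trl_trl α _).symm

/-- coefficientwise application of a linear map -/
noncomputable def cw {k : Type} [Field k] [Algebra k K] (ρ : K →ₗ[k] k)  :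
    MvPolynomial (Fin n) K →+ MvPolynomial (Fin n) k where
  toFun g := ∑ d ∈ g.support, monomial d (ρ (coeff d g))
  map_zero' := by simp
  map_add' a b := by
    classical
    have : ∀ (g : MvPolynomial (Fin n) K) d,
        coeff d (∑ d ∈ g.support, monomial d (ρ (coeff d g))) = ρ (coeff d g) := fun g d => by
      rw [coeff_sum]
      simp only [coeff_monomial]
      rw [Finset.sum_ite_eq']
      split_ifs with h
      · rfl
      · rw [notMem_support_iff.1 h, map_zero]
    ext d
    rw [coeff_add, this, this, this, coeff_add, map_add]

lemma coeff_cw {k : Type} [Field k] [Algebra k K] (ρ : K →ₗ[k] k) (g : MvPolynomial (Fin n) K) (d) :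
    coeff d (cw ρ g) = ρ (coeff d g) := by
  classical
  change coeff d (∑ d ∈ g.support, monomial d (ρ (coeff d g))) = _
  rw [coeff_sum]
  simp only [coeff_monomial]
  rw [Finset.sum_ite_eq']
  split_ifs with h
  · rfl
  · rw [notMem_support_iff.1 h, map_zero]

lemma cw_mul {k : Type} [Field k] [Algebra k K] (ρ : K →ₗ[k] k) (g : MvPolynomial (Fin n) k)
    (x : MvPolynomial (Fin n) K) : cw ρ (map (algebraMap k K) g * x) = g * cw ρ x := by
  classical
  ext d
  rw [coeff_cw, coeff_mul, coeff_mul, map_sum]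
  refine Finset.sum_congr rfl fun e _ => ?_
  rw [coeff_map, coeff_cw, ← Algebra.smul_def, map_smul, smul_eq_mul]

lemma cw_map {k : Type} [Field k] [Algebra k K] (ρ : K →ₗ[k] k) (hρ : ρ 1 = 1)
    (g : MvPolynomial (Fin n) k) : cw ρ (map (algebraMap k K) g) = g := by
  ext d
  rw [coeff_cw, coeff_map, Algebra.algebraMap_eq_smul_one, map_smul, hρ, smul_eq_mul, mul_one]

lemma exists_point [IsAlgClosed K] {k : Type} [Field k] [Algebra k K]
    (m : Ideal (MvPolynomial (Fin n) k)) (hm : m.IsMaximal) (P : Ideal (MvPolynomial (Fin n) K))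
    (hP : P.IsPrime) (hmP : ∀ r ∈ m, map (algebraMap k K) r ∈ P) (i : Fin n) :
    ∃ α : K, X i - C α ∈ P := by
  have hfin : Module.Finite k (MvPolynomial (Fin n) k ⧸ m) := by
    let _ := Ideal.Quotient.field m
    exact finite_of_finite_type_of_isJacobsonRing k (MvPolynomial (Fin n) k ⧸ m)
  obtain ⟨h, hmon, hh⟩ := Algebra.IsIntegral.isIntegral (R := k) (Ideal.Quotient.mk m (X i))
  have h1 : Polynomial.aeval (X i : MvPolynomial (Fin n) k) h ∈ m := by
    rw [← Ideal.Quotient.eq_zero_iff_mem, ← hh, ← Polynomial.aeval_def]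
    exact (Polynomial.aeval_algHom_apply (Ideal.Quotient.mkₐ k m) (X i) h).symm
  have h2 := hmP _ h1
  have h3 : map (algebraMap k K) (Polynomial.aeval (X i : MvPolynomial (Fin n) k) h) =
      Polynomial.aeval (X i : MvPolynomial (Fin n) K) (h.map (algebraMap k K)) := by
    rw [Polynomial.aeval_def, Polynomial.aeval_def, Polynomial.eval₂_map, Polynomial.hom_eval₂]
    simp only [map_X]
    congr 1
    ext c
    simp [algebraMap_eq]
  rw [h3] at h2
  have h4 := (IsAlgClosed.splits (h.map (algebraMap k K))).eq_prod_roots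
  rw [(hmon.map _).leadingCoeff] at h4
  rw [h4, map_mul, Polynomial.aeval_C, map_one, one_mul, map_multiset_prod,
    hP.multiset_prod_mem_iff_exists_mem] at h2
  obtain ⟨y, hy, hyP⟩ := h2
  rw [Multiset.map_map, Multiset.mem_map] at hy
  obtain ⟨α, -, rfl⟩ := hy
  refine ⟨α, ?_⟩
  simpa [algebraMap_eq] using hyP

lemma totalDegree_map_le_aux {k : Type} [Field k] (φ : k →+* K)
    (g : MvPolynomial (Fin n) k) : (map φ g).totalDegree ≤ g.totalDegree :=
  Finset.sup_mono (support_map_subset φ g)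

theorem kz_main (p : ℕ) [Fact p.Prime] {k : Type} [Field k] [CharP k p]
    (f : ℕ → MvPolynomial (Fin n) k) (s j t : ℕ)
    (hf : ∑ l ∈ Finset.range s, (f l).totalDegree < n)
    (ψ : (Idx s j → MvPolynomial (Fin n) k) →ₗ[MvPolynomial (Fin n) k] MvPolynomial (Fin n) k)
    (m : Ideal (MvPolynomial (Fin n) k)) (hm : m.IsMaximal) (N : ℕ)
    (h : ∀ r ∈ m ^ N, KZ f s j t (r • ψ)) : KZ f s j t ψ := by
  classical
  let K := AlgebraicClosure k
  have : CharP K p := charP_of_injective_algebraMap (algebraMap k K).injective p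
  let ι : MvPolynomial (Fin n) k →+* MvPolynomial (Fin n) K := map (algebraMap k K)
  let T : MvPolynomial (Fin n) k →+ MvPolynomial (Fin n) K := ι.toAddMonoidHom
  have hT : ∀ l x, T (f l * x) = ι (f l) * T x := fun l x => map_mul ι _ _
  obtain ⟨ρ, hρ⟩ := LinearMap.exists_leftInverse_of_injective (Algebra.linearMap k K)
    (LinearMap.ker_eq_bot.2 (algebraMap k K).injective)
  have hρ1 : ρ 1 = 1 := by
    have := LinearMap.congr_fun hρ 1
    simpa using this
  suffices H : KZ (fun l => ι (f l)) s j t (push T ψ) by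
    have h2 := H.push (T := cw ρ) (g' := f) (fun l x => cw_mul ρ (f l) x)
    convert h2 using 1
    refine fn_ext fun a => ?_
    rw [push_single, push_single]
    exact (cw_map ρ hρ1 _).symm
  have hN : ∀ r ∈ m ^ N, KZ (fun l => ι (f l)) s j t (ι r • push T ψ) := by
    intro r hr
    have := (h r hr).push hT
    convert this using 1
    refine fn_ext fun a => ?_
    rw [LinearMap.smul_apply, push_single, push_single, LinearMap.smul_apply, smul_eq_mul,
      smul_eq_mul]
    exact (map_mul ι _ _).symm
  have hdeg : ∑ l ∈ Finset.range s, (ι (f l)).totalDegree < n :=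
    lt_of_le_of_lt (Finset.sum_le_sum fun l _ => totalDegree_map_le_aux _ _) hf
  by_contra hne
  let Z := kzSub (fun l => ι (f l)) s j t
  have hne' : Z.mkQ (push T ψ) ≠ 0 := fun h0 => hne ((Submodule.Quotient.mk_eq_zero Z).1 h0)
  obtain ⟨P, hP, hle⟩ := exists_le_isAssociatedPrime_of_isNoetherianRing
    (MvPolynomial (Fin n) K) _ hne'
  rw [isAssociatedPrime_iff] at hP
  obtain ⟨hPp, y, hy⟩ := hP
  have hmP : ∀ r ∈ m, map (algebraMap k K) r ∈ P := by
    intro r hr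
    refine hPp.mem_of_pow_mem N (hle ?_)
    rw [Submodule.mem_colon_singleton, Submodule.mem_bot, ← map_smul, ← map_pow]
    exact (Submodule.Quotient.mk_eq_zero Z).2 (hN _ (Ideal.pow_mem_pow hr N))
  choose α hα using exists_point m hm P hPp hmP
  obtain ⟨ξ, rfl⟩ := Z.mkQ_surjective y
  have h5 : KZ (fun l => ι (f l)) s j t ξ := by
    refine kz_pt p _ s j t hdeg ξ α fun i => ?_
    have := hα i
    rw [hy, Submodule.mem_colon_singleton, Submodule.mem_bot, ← map_smul] at this
    exact (Submodule.Quotient.mk_eq_zero Z).1 this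
  have h6 : Z.mkQ ξ = 0 := (Submodule.Quotient.mk_eq_zero Z).2 h5
  refine hPp.ne_top ((Ideal.eq_top_iff_one _).2 ?_)
  rw [hy, Submodule.mem_colon_singleton, h6, smul_zero]
  exact Submodule.zero_mem _

end Final

end ZLC

/-- **Proposition (Zhang).** Let `k` be a field of characteristic `p > 0`, let
`R = k[x₁,…,xₙ]` and let `I = (f₁,…,f_s)` be an ideal of `R` with `∑ deg fⱼ < n`.
Then `H⁰_m(H^i_I(R)) = 0` for every `i` and every maximal ideal `m` of `R`. -/
theorem zerothLocalCohomology_localCohomology_eq_bot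
    (p : ℕ) (hp : p.Prime) (k : Type) [Field k] [CharP k p]
    (n s : ℕ) (f : Fin s → MvPolynomial (Fin n) k)
    (hdeg : ∑ j, (f j).totalDegree < n)
    (i : ℕ) (m : Ideal (MvPolynomial (Fin n) k)) (hm : m.IsMaximal) :
    zerothLocalCohomology m
      ((localCohomology (Ideal.span (Set.range f)) i).obj
        (ModuleCat.of (MvPolynomial (Fin n) k) (MvPolynomial (Fin n) k))) = ⊥ := by
  have := Fact.mk hp
  rw [eq_bot_iff]
  rintro z ⟨N, hz⟩
  let g : ℕ → MvPolynomial (Fin n) k := fun l => if h : l < s then f ⟨l, h⟩ else 0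
  have hgf : ∀ j : Fin s, g j = f j := fun j => by simp [g]
  have hI : Ideal.span (Set.range f) = Ideal.span (Set.image g {l | l < s}) := by
    congr 1
    ext x
    constructor
    · rintro ⟨j, rfl⟩
      exact ⟨j, j.2, hgf j⟩
    · rintro ⟨l, hl, rfl⟩
      exact ⟨⟨l, hl⟩, (hgf ⟨l, hl⟩).symm⟩
  have hg : ∑ l ∈ Finset.range s, (g l).totalDegree < n := by
    rw [Finset.sum_range]
    simpa only [hgf] using hdeg
  obtain ⟨t, ψ, H⟩ := ZLC.bridge (Ideal.span (Set.range f)) g s hI i z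
  have h1 : ZLC.KZ g s i t ψ := ZLC.kz_main p g s i t hg ψ m hm N fun r hr => (H r).1 (hz r hr)
  have h2 := (H 1).2 (by rwa [one_smul])
  rw [one_smul] at h2
  exact h2
end

section
/- Let $k$ be a perfect field of characteristic $p > 0$, let $R = k[x_1,\dots,x_n]$, let $l \geq 1$, and let $F : R_s \to R_t$ be the ring homomorphism $r \mapsto r^{p^l}$, where $R_s$ and $R_t$ denote two copies of $R$ serving as source and target. Let $F_*$ denote restriction of scalars along $F$ and $F^*(-) = R_t \otimes_{R_s} (-)$ denote extension of scalars along $F$. Then for every $R_t$-module $M$ and every $R_s$-module $N$ there is an isomorphism of $R_t$-modules $\operatorname{Hom}_{R_s}(F_*(M), N) \cong \operatorname{Hom}_{R_t}(M, F^*(N))$. -/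
open TensorProduct

/-! Two copies `R_s` (source) and `R_t` (target) of the polynomial ring `k[x₁,…,xₙ]`,
together with the iterated Frobenius `F : R_s →+* R_t`, `r ↦ r ^ (p ^ l)`.
The parameters `p` and `l` are carried in the types so that the various scalar
restriction/extension instances along `F` can be registered. -/

/-- The source copy `R_s` of the polynomial ring `k[x₁,…,xₙ]`. -/
def Rs (k : Type) [Field k] (n p l : ℕ) : Type := MvPolynomial (Fin n) k

/-- The target copy `R_t` of the polynomial ring `k[x₁,…,xₙ]`. -/
def Rt (k : Type) [Field k] (n p l : ℕ) : Type := MvPolynomial (Fin n) k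

noncomputable instance (k : Type) [Field k] (n p l : ℕ) : CommRing (Rs k n p l) :=
  inferInstanceAs (CommRing (MvPolynomial (Fin n) k))

noncomputable instance (k : Type) [Field k] (n p l : ℕ) : CommRing (Rt k n p l) :=
  inferInstanceAs (CommRing (MvPolynomial (Fin n) k))

/-- The iterated Frobenius homomorphism `F : R_s →+* R_t`, `r ↦ r ^ (p ^ l)`. -/
noncomputable def Frob (k : Type) [Field k] (n p l : ℕ) [Fact p.Prime] [CharP k p] :
    Rs k n p l →+* Rt k n p l :=
  haveI : ExpChar (MvPolynomial (Fin n) k) p := ExpChar.prime Fact.out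
  iterateFrobenius (MvPolynomial (Fin n) k) p l

/-- `R_t` as an `R_s`-module via `F` (restriction of scalars along `F`). -/
noncomputable instance (k : Type) [Field k] (n p l : ℕ) [Fact p.Prime] [CharP k p] :
    Module (Rs k n p l) (Rt k n p l) :=
  Module.compHom (Rt k n p l) (Frob k n p l)

instance (k : Type) [Field k] (n p l : ℕ) [Fact p.Prime] [CharP k p] :
    SMulCommClass (Rs k n p l) (Rt k n p l) (Rt k n p l) :=
  ⟨fun a s x => mul_left_comm (Frob k n p l a) s x⟩

/-- `F_*(M)`: an `R_t`-module `M` viewed as an `R_s`-module by restriction of scalars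
along the Frobenius `F : R_s →+* R_t`.  (As a type it is just `M`; the point is the
`R_s`-module instance below.) -/
abbrev FStar (k : Type) [Field k] (n p l : ℕ) (M : Type) [AddCommGroup M]
    [Module (Rt k n p l) M] : Type := M

/-- The `R_s`-action on `F_*(M)`: `a • m = F(a) • m`. -/
noncomputable instance (k : Type) [Field k] (n p l : ℕ) [Fact p.Prime] [CharP k p]
    (M : Type) [AddCommGroup M] [Module (Rt k n p l) M] :
    Module (Rs k n p l) (FStar k n p l M) :=
  Module.compHom M (Frob k n p l)

/-- For `r : R_t`, multiplication by `r` on `M` is an `R_s`-linear endomorphism of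
`F_*(M)` (the two actions commute since `R_t` is commutative). -/
noncomputable def rMul (k : Type) [Field k] (n p l : ℕ) [Fact p.Prime] [CharP k p]
    (M : Type) [AddCommGroup M] [Module (Rt k n p l) M] (r : Rt k n p l) :
    FStar k n p l M →ₗ[Rs k n p l] FStar k n p l M where
  toFun m := r • m
  map_add' m m' := smul_add r m m'
  map_smul' a m := by
    show r • (Frob k n p l a • m) = Frob k n p l a • (r • m)
    exact smul_comm r (Frob k n p l a) m

/-- The `R_t`-module structure on `Hom_{R_s}(F_*(M), N)` coming from the `R_t`-module
structure of `M`: `(r • g) m = g (r • m)`. -/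
noncomputable def homModule (k : Type) [Field k] (n p l : ℕ) [Fact p.Prime] [CharP k p]
    (M N : Type) [AddCommGroup M] [AddCommGroup N]
    [Module (Rt k n p l) M] [Module (Rs k n p l) N] :
    Module (Rt k n p l) (FStar k n p l M →ₗ[Rs k n p l] N) where
  smul r g := g.comp (rMul k n p l M r)
  one_smul g := by ext m; exact congrArg g (one_smul (Rt k n p l) m)
  mul_smul r r' g := by
    ext m
    exact congrArg g (by rw [mul_comm]; exact mul_smul r' r m)
  smul_zero r := rfl
  smul_add r g g' := rfl
  add_smul r r' g := by
    ext m
    show g ((r + r') • m) = g (r • m) + g (r' • m)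
    rw [add_smul, map_add]
  zero_smul g := by
    ext m
    show g ((0 : Rt k n p l) • m) = 0
    rw [zero_smul, map_zero]


open MvPolynomial in
/-- The `k`-linear projection picking the exponents congruent to `q - 1`. -/
noncomputable def topProj (k : Type) [Field k] (n q : ℕ) :
    MvPolynomial (Fin n) k →ₗ[k] MvPolynomial (Fin n) k :=
  (basisMonomials (Fin n) k).constr k (fun a =>
    if ∀ j, a j % q = q - 1 then monomial (Finsupp.equivFunOnFinite.symm (fun j => a j / q)) 1 else 0)

open MvPolynomial in
theorem topProj_monomial (k : Type) [Field k] (n q : ℕ) (a : Fin n →₀ ℕ) :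
    topProj k n q (monomial a 1) =
    if ∀ j, a j % q = q - 1 then
      monomial (Finsupp.equivFunOnFinite.symm (fun j => a j / q)) 1 else 0 := by
  have := (basisMonomials (Fin n) k).constr_basis k (fun a =>
    if ∀ j, a j % q = q - 1 then
      monomial (Finsupp.equivFunOnFinite.symm (fun j => a j / q)) (1 : k) else 0) a
  rw [coe_basisMonomials] at this
  exact this

open MvPolynomial in
theorem monomial_eq_smul_one {k : Type} [Field k] {n : ℕ} (a : Fin n →₀ ℕ) (c : k) :
    monomial a c = c • (monomial a 1 : MvPolynomial (Fin n) k) := by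
  rw [smul_monomial, smul_eq_mul, mul_one]

open MvPolynomial in
theorem topProj_expand (k : Type) [Field k] (n q : ℕ) (hq : 0 < q)
    (s r : MvPolynomial (Fin n) k) :
    topProj k n q (expand q s * r) = s * topProj k n q r := by
  induction s using MvPolynomial.induction_on' with
  | add s s' hs hs' => rw [map_add, add_mul, map_add, hs, hs', add_mul]
  | monomial b d =>
    induction r using MvPolynomial.induction_on' with
    | add s s' hs hs' => rw [mul_add, map_add, map_add, hs, hs', mul_add]
    | monomial a c =>
      rw [monomial_eq_smul_one a c, monomial_eq_smul_one b d, map_smul, expand_monomial,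
        smul_mul_smul_comm, monomial_mul, one_mul, map_smul, map_smul, smul_mul_smul_comm,
        topProj_monomial, topProj_monomial]
      congr 1
      have h : (∀ j, (q • b + a) j % q = q - 1) ↔ (∀ j, a j % q = q - 1) := by
        simp
      by_cases h' : ∀ j, a j % q = q - 1
      · rw [if_pos (h.2 h'), if_pos h', monomial_mul, one_mul]
        refine congrArg (fun t => monomial t (1 : k)) ?_
        ext j
        simp [Nat.mul_add_div hq]
      · rw [if_neg (fun H => h' (h.1 H)), if_neg h', mul_zero]

/-- The monomial basis elements. -/
noncomputable def eB (k : Type) [Field k] (n q : ℕ) (i : Fin n → Fin q) :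
    MvPolynomial (Fin n) k :=
  MvPolynomial.monomial (Finsupp.equivFunOnFinite.symm (fun j => (i j : ℕ))) 1

theorem arith_aux (q a i : ℕ) (hi : i < q) :
    ((q - (i + 1) + a) % q = q - 1 ↔ i = a % q) ∧ (i = a % q → (q - (i + 1) + a) / q = a / q) := by
  have hq : 0 < q := by omega
  have h1 := Nat.div_add_mod a q
  have h2 := Nat.mod_lt a hq
  generalize a / q = b at *
  generalize a % q = c at *
  subst h1
  have e : q - (i + 1) + (q * b + c) = q * b + (q - (i + 1) + c) := by omega
  rw [e, Nat.mul_add_mod, Nat.mul_add_div hq]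
  refine ⟨⟨fun h => ?_, fun h => ?_⟩, fun h => ?_⟩
  · by_contra hne
    rcases Nat.lt_or_gt_of_ne hne with hlt | hlt
    · rw [Nat.mod_eq_sub_mod (by omega), Nat.mod_eq_of_lt (by omega)] at h
      omega
    · rw [Nat.mod_eq_of_lt (by omega)] at h
      omega
  · rw [Nat.mod_eq_of_lt (by omega)]; omega
  · rw [Nat.div_eq_of_lt (by omega)]; omega

open MvPolynomial in
theorem recon (k : Type) [Field k] (n q : ℕ) (hq : 0 < q) (r : MvPolynomial (Fin n) k) :
    ∑ i : Fin n → Fin q, expand q (topProj k n q (eB k n q (fun j => (i j).rev) * r)) * eB k n q i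
      = r := by
  induction r using MvPolynomial.induction_on' with
  | add s s' hs hs' =>
    simp only [mul_add, map_add, add_mul, Finset.sum_add_distrib]
    rw [hs, hs']
  | monomial a c =>
    rw [monomial_eq_smul_one a c]
    simp only [mul_smul_comm, map_smul, smul_mul_assoc, ← Finset.smul_sum]
    congr 1
    rw [Finset.sum_eq_single (fun j => ⟨a j % q, Nat.mod_lt _ hq⟩)]
    · rw [eB, eB, monomial_mul, one_mul, topProj_monomial, if_pos, expand_monomial, monomial_mul,
        one_mul]
      · refine congrArg (fun t => monomial t (1 : k)) ?_
        ext j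
        have := (arith_aux q (a j) (a j % q) (Nat.mod_lt _ hq)).2 rfl
        simp [Fin.val_rev, this, Nat.div_add_mod]
      · intro j
        have := (arith_aux q (a j) (a j % q) (Nat.mod_lt _ hq)).1.2 rfl
        simpa [Fin.val_rev] using this
    · intro i _ hi
      rw [eB, eB, monomial_mul, one_mul, topProj_monomial, if_neg, map_zero, zero_mul]
      intro H
      apply hi
      funext j
      apply Fin.ext
      apply (arith_aux q (a j) (i j) (i j).2).1.1
      simpa [Fin.val_rev] using H j
    · simp


theorem exists_dual (k : Type) [Field k] [PerfectField k]
    (p : ℕ) [Fact p.Prime] [CharP k p] (n l : ℕ) :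
    ∃ (e e' : (Fin n → Fin (p ^ l)) → Rt k n p l) (π : Rt k n p l →ₗ[Rs k n p l] Rs k n p l),
      (∀ r, ∑ i, Frob k n p l (π (e' i * r)) * e i = r) ∧
      (∀ r, ∑ i, Frob k n p l (π (e i * r)) * e' i = r) := by
  haveI : ExpChar k p := ExpChar.prime Fact.out
  haveI : ExpChar (MvPolynomial (Fin n) k) p := ExpChar.prime Fact.out
  have hq : 0 < p ^ l := pow_pos (Fact.out : p.Prime).pos l
  let φ : k →+* k := iterateFrobenius k p l
  let ψ : k →+* k := (iterateFrobeniusEquiv k p l).symm.toRingHom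
  have hφψ : φ.comp ψ = RingHom.id k := by
    ext x; exact (iterateFrobeniusEquiv k p l).apply_symm_apply x
  have hψφ : ψ.comp φ = RingHom.id k := by
    ext x; exact (iterateFrobeniusEquiv k p l).symm_apply_apply x
  have hF : ∀ s : MvPolynomial (Fin n) k,
      Frob k n p l s = MvPolynomial.expand (p ^ l) (MvPolynomial.map φ s) := by
    intro s
    rw [← MvPolynomial.map_expand]
    exact (MvPolynomial.map_iterateFrobenius_expand p s l).symm
  let π0 : MvPolynomial (Fin n) k → MvPolynomial (Fin n) k := fun r =>
    MvPolynomial.map ψ (topProj k n (p ^ l) r)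
  have hlin : ∀ s r : MvPolynomial (Fin n) k,
      π0 (MvPolynomial.expand (p ^ l) (MvPolynomial.map φ s) * r) = s * π0 r := by
    intro s r
    simp only [π0]
    rw [topProj_expand k n _ hq, map_mul, MvPolynomial.map_map, hψφ, MvPolynomial.map_id]
  have hFπ : ∀ r : MvPolynomial (Fin n) k,
      Frob k n p l (π0 r) = MvPolynomial.expand (p ^ l) (topProj k n (p ^ l) r) := by
    intro r
    rw [hF]
    simp only [π0]
    rw [MvPolynomial.map_map, hφψ, MvPolynomial.map_id]
  have hadd : ∀ a b : MvPolynomial (Fin n) k, π0 (a + b) = π0 a + π0 b := by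
    intro a b
    simp only [π0, map_add]
  let π : Rt k n p l →ₗ[Rs k n p l] Rs k n p l :=
    { toFun := π0
      map_add' := fun a b => hadd a b
      map_smul' := fun s r => by
        have h1 : π0 (Frob k n p l s * r : Rt k n p l) = _ :=
          congrArg (fun t : Rt k n p l => π0 (t * r : Rt k n p l)) (hF s)
        exact h1.trans (hlin s r) }
  let E : (Fin n → Fin (p ^ l)) → Rt k n p l := fun i => eB k n (p ^ l) i
  have hA : ∀ r : Rt k n p l, ∑ i : Fin n → Fin (p ^ l),
      Frob k n p l (π (E (fun j => (i j).rev) * r)) * E i = r := by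
    intro r
    refine Eq.trans (Finset.sum_congr rfl fun i _ => ?_) (recon k n (p ^ l) hq r)
    exact congrArg (fun t : Rt k n p l => t * E i) (hFπ _)
  refine ⟨E, fun i => E (fun j => (i j).rev), π, hA, ?_⟩
  intro r
  refine Eq.trans ?_ (hA r)
  refine Fintype.sum_equiv (Equiv.arrowCongr (Equiv.refl _) Fin.revPerm) _ _ fun i => ?_
  simp
  rfl

/-- **Duality (Lyubeznik).**  Let `k` be a perfect field of characteristic `p > 0`,
`R = k[x₁,…,xₙ]`, `l ≥ 1`, and `F : R_s →+* R_t`, `r ↦ r^(pˡ)`, the iterated Frobenius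
between two copies of `R`.  For every `R_t`-module `M` and every `R_s`-module `N` there
is an `R_t`-linear isomorphism `Hom_{R_s}(F_*(M), N) ≅ Hom_{R_t}(M, F^*(N))`, where
`F^*(N) = R_t ⊗_{R_s} N` is extension of scalars along `F`. -/
theorem frobenius_duality (k : Type) [Field k] [PerfectField k]
    (p : ℕ) [Fact p.Prime] [CharP k p] (n l : ℕ) (hl : 1 ≤ l)
    (M N : Type) [AddCommGroup M] [AddCommGroup N]
    [Module (Rt k n p l) M] [Module (Rs k n p l) N] :
    letI := homModule k n p l M N
    Nonempty ((FStar k n p l M →ₗ[Rs k n p l] N) ≃ₗ[Rt k n p l]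
      (M →ₗ[Rt k n p l] (Rt k n p l ⊗[Rs k n p l] N))) := by
  letI := homModule k n p l M N
  obtain ⟨e, e', π, hA, hB⟩ := exists_dual k p n l
  -- `π ⊗ id`
  let P : (Rt k n p l ⊗[Rs k n p l] N) →ₗ[Rs k n p l] N :=
    (TensorProduct.lid (Rs k n p l) N).toLinearMap ∘ₗ (LinearMap.rTensor N π)
  have hP : ∀ (r : Rt k n p l) (x : N), P (r ⊗ₜ x) = π r • x := fun r x => rfl
  have hz : ∀ z : Rt k n p l ⊗[Rs k n p l] N, ∑ i, e i ⊗ₜ[Rs k n p l] P (e' i • z) = z := by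
    intro z
    induction z using TensorProduct.induction_on with
    | zero => simp
    | add a b ha hb =>
      simp only [smul_add, map_add, TensorProduct.tmul_add, Finset.sum_add_distrib]
      rw [ha, hb]
    | tmul r x =>
      have : ∀ i, e i ⊗ₜ[Rs k n p l] P (e' i • (r ⊗ₜ[Rs k n p l] x)) =
          (Frob k n p l (π (e' i * r)) * e i) ⊗ₜ[Rs k n p l] x := by
        intro i
        rw [TensorProduct.smul_tmul', hP, ← TensorProduct.smul_tmul]
        rfl
      rw [Finset.sum_congr rfl fun i _ => this i, ← TensorProduct.sum_tmul, hA]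
  have hext : ∀ z w : Rt k n p l ⊗[Rs k n p l] N,
      (∀ r : Rt k n p l, P (r • z) = P (r • w)) → z = w := by
    intro z w h
    rw [← hz z, ← hz w]
    exact Finset.sum_congr rfl fun i _ => by rw [h]
  have hg : ∀ (g : FStar k n p l M →ₗ[Rs k n p l] N) (r : Rt k n p l) (m : M),
      P (r • ∑ i, e i ⊗ₜ[Rs k n p l] g (e' i • m)) = g (r • m) := by
    intro g r m
    rw [Finset.smul_sum, map_sum]
    have : ∀ i, P (r • (e i ⊗ₜ[Rs k n p l] g (e' i • m))) =
        g ((Frob k n p l (π (e i * r)) * e' i) • m) := by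
      intro i
      rw [TensorProduct.smul_tmul', hP, ← map_smul, smul_eq_mul, mul_comm r, mul_smul]
      rfl
    rw [Finset.sum_congr rfl fun i _ => this i, ← map_sum, ← Finset.sum_smul, hB]
  let Φ : (FStar k n p l M →ₗ[Rs k n p l] N) →
      (M →ₗ[Rt k n p l] (Rt k n p l ⊗[Rs k n p l] N)) := fun g =>
    { toFun := fun m => ∑ i, e i ⊗ₜ[Rs k n p l] g (e' i • m)
      map_add' := fun a b => by
        simp only [smul_add, map_add, TensorProduct.tmul_add, Finset.sum_add_distrib]
      map_smul' := fun s m => by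
        apply hext
        intro r
        rw [hg, RingHom.id_apply, ← mul_smul r s (∑ i, _), hg, mul_smul] }
  let Ψ : (M →ₗ[Rt k n p l] (Rt k n p l ⊗[Rs k n p l] N)) →
      (FStar k n p l M →ₗ[Rs k n p l] N) := fun h =>
    { toFun := fun m => P (h m)
      map_add' := fun a b => by rw [map_add, map_add]
      map_smul' := fun s m => by
        have h1 : h (s • (m : FStar k n p l M)) = Frob k n p l s • h m :=
          map_smul h (Frob k n p l s) m
        have h2 : ∀ z : Rt k n p l ⊗[Rs k n p l] N, Frob k n p l s • z = s • z := by
          intro z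
          induction z using TensorProduct.induction_on with
          | zero => simp
          | add a b ha hb => rw [smul_add, smul_add, ha, hb]
          | tmul r x => rfl
        rw [h1, h2, map_smul]; rfl }
  have hΨΦ : ∀ g, Ψ (Φ g) = g := by
    intro g
    ext m
    have := hg g 1 m
    rw [one_smul, one_smul] at this
    exact this
  have hΦΨ : ∀ h, Φ (Ψ h) = h := by
    intro h
    ext m
    refine Eq.trans (Finset.sum_congr rfl fun i _ => ?_) (hz (h m))
    rw [← map_smul]
    rfl
  refine ⟨LinearEquiv.symm
    { toFun := Ψ
      invFun := Φ
      map_add' := fun a b => by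
        ext m
        exact map_add P (a m) (b m)
      map_smul' := fun s h => by
        ext m
        change P (s • h m) = P (h (s • m))
        rw [map_smul h]
      left_inv := hΦΨ
      right_inv := hΨΦ }⟩
end
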